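/- Let G and H be finite metacyclic groups. If the rational group algebras ℚG and ℚH are isomorphic as ℚ-algebras, then G and H are isomorphic as groups. -/

import Mathlib

open scoped Classical

noncomputable section

namespace ArXiv230800432

/-- The `σ`-part of a natural number: product of `p ^ vₚ(n)` over primes `p ∈ σ` dividing `n`. -/
def natPart (n : ℕ) (σ : Set ℕ) : ℕ :=
  ∏ p ∈ n.primeFactors, if p ∈ σ then p ^ (n.factorization p) else 1

/-- A metacyclic factorization `G = A·B` with `A` cyclic normal and `B` cyclic. -/
structure MetacyclicFact (G : Type*) [Group G] where
  A : Subgroup G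
  B : Subgroup G
  normalA : A.Normal
  cyclicA : IsCyclic A
  cyclicB : IsCyclic B
  mul_cover : ∀ g : G, ∃ x ∈ A, ∃ y ∈ B, g = x * y

/-- A group is metacyclic if it admits a metacyclic factorization. -/
def IsMetacyclic (G : Type*) [Group G] : Prop :=
  Nonempty (MetacyclicFact G)

variable {G : Type*} [Group G]

/-- `π_G`: primes `p` dividing `|G|` such that `G` has a normal Hall `p'`-subgroup. -/
def piSet (G : Type*) [Group G] : Set ℕ :=
  {p | p.Prime ∧ p ∣ Nat.card G ∧
    ∃ N : Subgroup G, N.Normal ∧ Nat.card N = ordCompl[p] (Nat.card G)}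

/-- `π'_G = π(G) \ π_G`. -/
def piSet' (G : Type*) [Group G] : Set ℕ :=
  {p | p.Prime ∧ p ∣ Nat.card G} \ piSet G

/-- The image mod `d` of `T_G(A)`: classes `[t]_d` such that some `g ∈ G` acts on `A` by
conjugation as `x ↦ x ^ t`.  For `d = |A|` this is exactly `T_G(A)`. -/
def TGmod (A : Subgroup G) (d : ℕ) : Subgroup (ZMod d)ˣ :=
  Subgroup.closure
    {u : (ZMod d)ˣ | ∃ g : G, ∃ t : ℕ, ((t : ZMod d) = (u : ZMod d)) ∧
      ∀ x ∈ A, g⁻¹ * x * g = x ^ t}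

/-- `T_G(A)` as subgroup of `(ℤ/|A|ℤ)ˣ`. -/
def TG (A : Subgroup G) : Subgroup (ZMod (Nat.card A))ˣ :=
  TGmod A (Nat.card A)

/-- The image of `T` under `Res_q : (ℤ/dℤ)ˣ → (ℤ/qℤ)ˣ` is trivial. -/
def resTriv (d q : ℕ) (T : Subgroup (ZMod d)ˣ) : Prop :=
  ∀ u ∈ T, ∀ t : ℕ, ((t : ZMod d) = (u : ZMod d)) → (t : ZMod q) = 1

/-- The image of `T` under `Res_q` is contained in `⟨-1⟩`. -/
def resInPMOne (d q : ℕ) (T : Subgroup (ZMod d)ˣ) : Prop :=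
  ∀ u ∈ T, ∀ t : ℕ, ((t : ZMod d) = (u : ZMod d)) →
    ((t : ZMod q) = 1 ∨ (t : ZMod q) = -1)

/-- The image of `T` under `Res_q` as a set of units mod `q`. -/
def resSet (d q : ℕ) (T : Subgroup (ZMod d)ˣ) : Set (ZMod q)ˣ :=
  {v | ∃ u ∈ T, ∃ t : ℕ, ((t : ZMod d) = (u : ZMod d)) ∧ ((t : ZMod q) = (v : ZMod q))}

/-- The set of natural numbers representing elements of `T ≤ (ℤ/dℤ)ˣ`. -/
def liftSet {d : ℕ} (T : Subgroup (ZMod d)ˣ) : Set ℕ :=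
  {t | ∃ u ∈ T, (t : ZMod d) = (u : ZMod d)}

/-- `r^G(A)`: the greatest divisor `r` of `|A|` such that `Res_{r_{2'}}(T_G(A)) = 1` and
`Res_{r_2}(T_G(A)) ⊆ ⟨-1⟩`. -/
def rOfA (A : Subgroup G) : ℕ :=
  sSup {r : ℕ | r ∣ Nat.card A ∧ resTriv (Nat.card A) (ordCompl[2] r) (TG A) ∧
    resInPMOne (Nat.card A) (ordProj[2] r) (TG A)}

/-- `ε^G(A)`: `-1` if `Res_{r_2}(T_G(A)) ≠ 1`, and `1` otherwise. -/
def epsOfA (A : Subgroup G) : ℤ :=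
  if resTriv (Nat.card A) (ordProj[2] (rOfA A)) (TG A) then 1 else -1

/-- `k^G(A)`: order of the image of `T_G(A)` in `(ℤ/m_ν ℤ)ˣ`, `ν` the primes dividing `|A|`
but not `r^G(A)`. -/
def kOfA (A : Subgroup G) : ℕ :=
  (resSet (Nat.card A) (natPart (Nat.card A) {p | ¬ p ∣ rOfA A}) (TG A)).ncard

/-- The triple `(|A|, r^G(A), [G:B])` attached to a metacyclic factorization. -/
def factTriple (f : MetacyclicFact G) : ℕ × ℕ × ℕ :=
  (Nat.card f.A, rOfA f.A, f.B.index)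

/-- Lexicographic order on triples. -/
def lex3 (x y : ℕ × ℕ × ℕ) : Prop :=
  x.1 < y.1 ∨ (x.1 = y.1 ∧ (x.2.1 < y.2.1 ∨ (x.2.1 = y.2.1 ∧ x.2.2 ≤ y.2.2)))

/-- A metacyclic factorization is minimal when its triple is lexicographically minimal. -/
def IsMinimalFact (f : MetacyclicFact G) : Prop :=
  ∀ f' : MetacyclicFact G, lex3 (factTriple f) (factTriple f')

def mOf (f : MetacyclicFact G) : ℕ := Nat.card f.A
def nOf (f : MetacyclicFact G) : ℕ := f.A.index
def sOf (f : MetacyclicFact G) : ℕ := f.B.index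
def rOf (f : MetacyclicFact G) : ℕ := rOfA f.A
def epsOf (f : MetacyclicFact G) : ℤ := epsOfA f.A
def kOf (f : MetacyclicFact G) : ℕ := kOfA f.A

/-- The `σ`-part of an element of a finite group. -/
def elemPart (σ : Set ℕ) (g : G) : G :=
  g ^ ((orderOf g / natPart (orderOf g) σ) *
    (((orderOf g / natPart (orderOf g) σ : ℕ) : ZMod (natPart (orderOf g) σ))⁻¹.val))

/-- The (unique, for `N` cyclic) Hall `σ`-subgroup of a subgroup `N`. -/
def hallOf (N : Subgroup G) (σ : Set ℕ) : Subgroup G :=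
  Subgroup.closure {x : G | x ∈ N ∧ orderOf x ∣ natPart (Nat.card N) σ}

/-- `R^G = T_G(G'_{π'})`, realized as a subgroup of `(ℤ/dℤ)ˣ`. -/
def ROf (G : Type*) [Group G] (d : ℕ) : Subgroup (ZMod d)ˣ :=
  TGmod (hallOf (commutator G) (piSet' G)) d

section Reduction

variable {H : Type*} [Group H]

/-- Base change of the algebra map `R[G] → R[H]` induced by a homomorphism `G → R[H]ˣ`. -/
def liftMap {R S : Type*} [CommRing R] [CommRing S] (f : R →+* S)
    (u : G →* MonoidAlgebra R H) : MonoidAlgebra S G →ₐ[S] MonoidAlgebra S H :=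
  MonoidAlgebra.lift S _ G ((MonoidAlgebra.mapRingHom H f : _ →* _).comp u)

theorem liftMap_map {R S : Type*} [CommRing R] [CommRing S] (f : R →+* S)
    (u : G →* MonoidAlgebra R H) (x : MonoidAlgebra R G) :
    liftMap f u (MonoidAlgebra.mapRingHom G f x) =
      MonoidAlgebra.mapRingHom H f (MonoidAlgebra.lift R _ G u x) := by
  suffices h : ((liftMap f u : _ →+* _).comp (MonoidAlgebra.mapRingHom G f)) =
      (MonoidAlgebra.mapRingHom H f).comp (MonoidAlgebra.lift R _ G u : _ →+* _) from
    congrArg (fun φ => φ x) h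
  refine MonoidAlgebra.ringHom_ext (fun r => ?_) (fun g => ?_)
  · simp [liftMap, Algebra.smul_def]
  · simp [liftMap]

theorem exists_lift_of_coeff_mem_range {R K : Type*} [CommRing R] [CommRing K] (i : R →+* K)
    (hi : Function.Injective i) (w : G →* MonoidAlgebra K H)
    (hw : ∀ g h, (w g).coeff h ∈ i.range) :
    ∃ u : G →* MonoidAlgebra R H, ∀ g, MonoidAlgebra.mapRingHom H i (u g) = w g := by
  have hinj : Function.Injective (MonoidAlgebra.mapRingHom H i) := by
    rw [MonoidAlgebra.coe_mapRingHom]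
    exact MonoidAlgebra.map_injective (i : R →+ K) hi
  have hex : ∀ g, ∃ x : MonoidAlgebra R H, MonoidAlgebra.mapRingHom H i x = w g := by
    intro g
    choose c hc using hw g
    refine ⟨∑ h ∈ (w g).coeff.support, MonoidAlgebra.single h (c h), ?_⟩
    simp only [map_sum, MonoidAlgebra.mapRingHom_single, hc]
    exact MonoidAlgebra.sum_coeff_single (w g)
  choose u hu using hex
  refine ⟨⟨⟨u, hinj ?_⟩, fun x y => hinj ?_⟩, hu⟩
  · rw [hu, map_one, map_one]
  · rw [hu, map_mul, map_mul, hu, hu]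

theorem liftMap_comp_liftMap {R K F Q : Type*} [CommRing R] [CommRing K] [CommRing F] [CommRing Q]
    (i : R →+* K) (hi : Function.Injective i) (ψ : R →+* F) (j : Q →+* K)
    (f : MonoidAlgebra Q G ≃ₐ[Q] MonoidAlgebra Q H)
    (u : G →* MonoidAlgebra R H) (v : H →* MonoidAlgebra R G)
    (hu : ∀ g, MonoidAlgebra.mapRingHom H i (u g) =
      MonoidAlgebra.mapRingHom H j (f (MonoidAlgebra.single g 1)))
    (hv : ∀ g, MonoidAlgebra.mapRingHom G i (v g) =
      MonoidAlgebra.mapRingHom G j (f.symm (MonoidAlgebra.single g 1))) :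
    (liftMap ψ v).comp (liftMap ψ u) = AlgHom.id F _ := by
  have hinj : Function.Injective (MonoidAlgebra.mapRingHom G i) := by
    rw [MonoidAlgebra.coe_mapRingHom]
    exact MonoidAlgebra.map_injective (i : R →+ K) hi
  have huv : ∀ g, MonoidAlgebra.lift R _ H v (u g) = MonoidAlgebra.single g 1 := by
    intro g
    apply hinj
    have h1 : liftMap i v = liftMap j ((f.symm : _ →* _).comp (MonoidAlgebra.of Q H)) := by
      unfold liftMap
      congr 1
      ext1 g
      simpa using hv g
    have h2 : MonoidAlgebra.lift Q _ H ((f.symm : _ →* _).comp (MonoidAlgebra.of Q H)) =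
        f.symm.toAlgHom := by
      ext; simp
    rw [← liftMap_map, hu, h1, liftMap_map, h2]
    simp
  refine MonoidAlgebra.algHom_ext (fun g => ?_) (by ext)
  have : liftMap ψ u (MonoidAlgebra.single g 1) = MonoidAlgebra.mapRingHom H ψ (u g) := by
    simp [liftMap]
  rw [AlgHom.comp_apply, this, liftMap_map, huv]
  simp

theorem nonempty_algEquiv_of_coeff_mem_range {R K F : Type*} [CommRing R] [CommRing K] [CommRing F]
    (i : R →+* K) (hi : Function.Injective i) (ψ : R →+* F) {Q : Type*} [CommRing Q]
    (j : Q →+* K) (e : MonoidAlgebra Q G ≃ₐ[Q] MonoidAlgebra Q H)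
    (h₁ : ∀ g h, j ((e (MonoidAlgebra.single g 1)).coeff h) ∈ i.range)
    (h₂ : ∀ h g, j ((e.symm (MonoidAlgebra.single h 1)).coeff g) ∈ i.range) :
    Nonempty (MonoidAlgebra F G ≃ₐ[F] MonoidAlgebra F H) := by
  obtain ⟨u, hu⟩ := exists_lift_of_coeff_mem_range (G := G) (H := H) i hi
    ((MonoidAlgebra.mapRingHom H j : MonoidAlgebra Q H →* MonoidAlgebra K H).comp
      ((e : MonoidAlgebra Q G →* MonoidAlgebra Q H).comp (MonoidAlgebra.of Q G)))
    (fun g h => by simpa using h₁ g h)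
  obtain ⟨v, hv⟩ := exists_lift_of_coeff_mem_range (G := H) (H := G) i hi
    ((MonoidAlgebra.mapRingHom G j : MonoidAlgebra Q G →* MonoidAlgebra K G).comp
      ((e.symm : MonoidAlgebra Q H →* MonoidAlgebra Q G).comp (MonoidAlgebra.of Q H)))
    (fun g h => by simpa using h₂ g h)
  have hu' : ∀ g, MonoidAlgebra.mapRingHom H i (u g) =
        MonoidAlgebra.mapRingHom H j (e (MonoidAlgebra.single g 1)) := fun g => by
    simpa using hu g
  have hv' : ∀ g, MonoidAlgebra.mapRingHom G i (v g) =
        MonoidAlgebra.mapRingHom G j (e.symm (MonoidAlgebra.single g 1)) := fun g => by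
    simpa using hv g
  exact ⟨AlgEquiv.ofAlgHom (liftMap ψ u) (liftMap ψ v)
    (liftMap_comp_liftMap i hi ψ j e.symm v u hv' hu')
    (liftMap_comp_liftMap i hi ψ j e u v hu' hv')⟩

theorem eventually_nonempty_algEquiv_zmod [Finite G] [Finite H]
    (e : MonoidAlgebra ℚ G ≃ₐ[ℚ] MonoidAlgebra ℚ H) :
    ∃ N : ℕ, ∀ ℓ : ℕ, ℓ.Prime → N < ℓ →
      Nonempty (MonoidAlgebra (ZMod ℓ) G ≃ₐ[ZMod ℓ] MonoidAlgebra (ZMod ℓ) H) := by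
  have := Fintype.ofFinite G
  have := Fintype.ofFinite H
  refine ⟨(∑ g, ∑ h, ((e (MonoidAlgebra.single g 1)).coeff h).den) +
    (∑ g, ∑ h, ((e.symm (MonoidAlgebra.single h 1)).coeff g).den), fun ℓ hℓ hN => ?_⟩
  have : Fact ℓ.Prime := ⟨hℓ⟩
  have key : ∀ q : ℚ, q.den < ℓ → algebraMap ℚ ℚ_[ℓ] q ∈ (PadicInt.Coe.ringHom (p := ℓ)).range := by
    intro q hq
    exact ⟨⟨algebraMap ℚ ℚ_[ℓ] q, Padic.norm_rat_le_one
      (fun h => absurd (Nat.le_of_dvd q.den_pos h) (by omega))⟩, rfl⟩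
  refine nonempty_algEquiv_of_coeff_mem_range (PadicInt.Coe.ringHom (p := ℓ))
    Subtype.val_injective (PadicInt.toZMod (p := ℓ)) (algebraMap ℚ ℚ_[ℓ]) e
    (fun g h => key _ (lt_of_le_of_lt ?_ hN)) (fun h g => key _ (lt_of_le_of_lt ?_ hN))
  · refine le_trans ?_ (Nat.le_add_right _ _)
    refine le_trans ?_ (Finset.single_le_sum (fun _ _ => Nat.zero_le _) (Finset.mem_univ g))
    exact Finset.single_le_sum (f := fun h => ((e (MonoidAlgebra.single g 1)).coeff h).den)
      (fun _ _ => Nat.zero_le _) (Finset.mem_univ h)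
  · refine le_trans ?_ (Nat.le_add_left _ _)
    refine le_trans ?_ (Finset.single_le_sum (fun _ _ => Nat.zero_le _) (Finset.mem_univ g))
    exact Finset.single_le_sum (f := fun h => ((e.symm (MonoidAlgebra.single h 1)).coeff g).den)
      (fun _ _ => Nat.zero_le _) (Finset.mem_univ h)

theorem finrank_monoidAlgebra (F A : Type*) [Field F] [Finite A] :
    Module.finrank F (MonoidAlgebra F A) = Nat.card A := by
  have := Fintype.ofFinite A
  rw [LinearEquiv.finrank_eq (MonoidAlgebra.coeffLinearEquiv F), Module.finrank_finsupp_self,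
    Nat.card_eq_fintype_card]

theorem card_eq_of_algEquiv [Finite G] [Finite H]
    (e : MonoidAlgebra ℚ G ≃ₐ[ℚ] MonoidAlgebra ℚ H) : Nat.card G = Nat.card H := by
  rw [← finrank_monoidAlgebra ℚ, ← finrank_monoidAlgebra ℚ, e.toLinearEquiv.finrank_eq]

end Reduction

section Frobenius

theorem add_pow_eq_sum_ofFn {A : Type*} [Ring A] (x y : A) (n : ℕ) :
    (x + y) ^ n = ∑ f : Fin n → Bool, (List.ofFn fun i => bif f i then x else y).prod := by
  induction n with
  | zero => simp
  | succ n ih =>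
    rw [pow_succ', ih, ← Equiv.sum_comp (Fin.consEquiv (fun _ : Fin (n + 1) => Bool)),
      Fintype.sum_prod_type, Fintype.sum_bool]
    simp [Fin.consEquiv, add_mul, Finset.mul_sum, Finset.sum_add_distrib]

theorem sum_eq_sum_fixedPoints {α : Type*} [Fintype α] {p : ℕ} [Fact p.Prime] (σ : α → α)
    (hσ : ∀ a, σ^[p] a = a) (F : α → ZMod p) (hF : ∀ a, F (σ a) = F a) :
    ∑ a, F a = ∑ a ∈ Finset.univ.filter (fun a => σ a = a), F a := by
  have hfib : ∀ s : Finset α, ∑ a ∈ s, F a =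
      ∑ v : ZMod p, ((s.filter (fun a => F a = v)).card : ZMod p) * v := by
    intro s
    rw [← Finset.sum_fiberwise s F]
    refine Finset.sum_congr rfl fun v _ => ?_
    rw [Finset.sum_congr rfl (fun a ha => (Finset.mem_filter.1 ha).2), Finset.sum_const,
      nsmul_eq_mul]
  rw [hfib, hfib]
  refine Finset.sum_congr rfl fun v _ => ?_
  congr 1
  let τ : Function.End {a // F a = v} := fun a => ⟨σ a, by rw [hF, a.2]⟩
  have hτ : ∀ k, ∀ a, ((τ ^ k) a : α) = σ^[k] a := by
    intro k
    induction k with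
    | zero => intro a; rfl
    | succ k ih => intro a; rw [pow_succ', Function.iterate_succ_apply']; exact congrArg σ (ih a)
  have h := Equiv.Perm.card_fixedPoints_modEq (f := τ) (p := p) (n := 1) (by
    rw [pow_one]; funext a; apply Subtype.ext; rw [hτ, hσ]; rfl)
  rw [← ZMod.natCast_eq_natCast_iff, Fintype.card_subtype] at h
  rw [h]
  congr 1
  rw [← Fintype.card_coe]
  refine Fintype.card_congr ⟨fun a => ⟨a.1.1, ?_⟩, fun a => ⟨⟨a.1, ?_⟩, ?_⟩, ?_, ?_⟩
  · have := congrArg Subtype.val a.2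
    simpa [a.1.2] using this
  · exact (Finset.mem_filter.1 a.2).2
  · have := (Finset.mem_filter.1 (Finset.mem_filter.1 a.2).1).2
    exact Subtype.ext this
  · intro a; rfl
  · intro a; rfl

theorem map_add_pow_of_map_mul_comm {A : Type*} [Ring A] {p : ℕ} [hp : Fact p.Prime]
    (φ : A →+ ZMod p) (hφ : ∀ x y, φ (x * y) = φ (y * x)) (x y : A) :
    φ ((x + y) ^ p) = φ (x ^ p) + φ (y ^ p) := by
  obtain ⟨n, rfl⟩ : ∃ n, p = n + 1 := ⟨p - 1, by have := hp.out.pos; omega⟩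
  rw [add_pow_eq_sum_ofFn, map_sum]
  let σ : (Fin (n + 1) → Bool) → (Fin (n + 1) → Bool) := fun f i => f (i + 1)
  have hσ : ∀ (k : ℕ) f i, σ^[k] f i = f (Fin.ofNat (n + 1) (i + k)) := by
    intro k
    induction k with
    | zero => intro f i; simp
    | succ k ih =>
      intro f i
      rw [Function.iterate_succ_apply, ih]
      change f (_ + 1) = _
      congr 1
      apply Fin.ext
      simp [Fin.val_add, add_assoc]
  rw [sum_eq_sum_fixedPoints σ]
  · have : (Finset.univ.filter fun f : Fin (n + 1) → Bool => σ f = f) =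
        {fun _ => true, fun _ => false} := by
      ext f
      simp only [Finset.mem_filter, Finset.mem_univ, true_and, Finset.mem_insert,
        Finset.mem_singleton]
      constructor
      · intro h
        have h2 : ∀ i, f i = f 0 := by
          intro i
          have h4 := congrFun (Function.iterate_fixed h i) 0
          rw [hσ] at h4
          simpa using h4
        cases h0 : f 0
        · right; funext i; rw [h2, h0]
        · left; funext i; rw [h2, h0]
      · rintro (rfl | rfl) <;> rfl
    refine (Finset.sum_congr (s₂ := {fun _ => true, fun _ => false})
      (by convert this) fun _ _ => rfl).trans ?_
    rw [Finset.sum_pair (by intro h; simpa using congrFun h 0)]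
    simp [pow_succ']
  · intro f
    funext i
    rw [hσ]
    congr 1
    apply Fin.ext
    simp [Nat.mod_eq_of_lt i.2]
  · intro f
    rw [List.ofFn_succ', List.ofFn_succ, List.concat_eq_append, List.prod_append, hφ]
    simp [σ]

end Frobenius

section ClassFunctions

/-- The map induced on conjugacy classes by `g ↦ g ^ k`. -/
def conjPow (G : Type*) [Group G] (k : ℕ) : ConjClasses G → ConjClasses G :=
  Quotient.map (fun g => g ^ k) (fun _ _ h => IsConj.pow k h)

theorem conjPow_mk (k : ℕ) (g : G) :
    conjPow G k (ConjClasses.mk g) = ConjClasses.mk (g ^ k) := rfl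

/-- The functional on the group algebra given by a class function. -/
def classFunctional (F G : Type*) [Field F] [Group G] [Fintype G] :
    (ConjClasses G → F) →ₗ[F] MonoidAlgebra F G →ₗ[F] F :=
  LinearMap.mk₂ F (fun f x => ∑ g, x.coeff g * f (ConjClasses.mk g))
    (fun f f' x => by simp [mul_add, Finset.sum_add_distrib])
    (fun c f x => by simp [Finset.mul_sum, mul_left_comm])
    (fun f x y => by simp [add_mul, Finset.sum_add_distrib])
    (fun c f x => by simp [Finset.mul_sum, mul_assoc])

theorem classFunctional_single {F : Type*} [Field F] [Fintype G] (f : ConjClasses G → F) (g : G)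
    (c : F) : classFunctional F G f (MonoidAlgebra.single g c) = c * f (ConjClasses.mk g) := by
  simp [classFunctional, MonoidAlgebra.coeff_single, Finsupp.single_apply]

theorem classFunctional_mul_comm {F : Type*} [Field F] [Fintype G] (f : ConjClasses G → F)
    (x y : MonoidAlgebra F G) :
    classFunctional F G f (x * y) = classFunctional F G f (y * x) := by
  induction x using MonoidAlgebra.induction_linear with
  | zero => simp
  | add x x' h h' => rw [add_mul, mul_add, map_add, map_add, h, h']
  | single g c =>
    induction y using MonoidAlgebra.induction_linear with
    | zero => simp
    | add y y' h h' => rw [add_mul, mul_add, map_add, map_add, h, h']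
    | single g' c' =>
      rw [MonoidAlgebra.single_mul_single, MonoidAlgebra.single_mul_single,
        classFunctional_single, classFunctional_single, mul_comm c,
        ConjClasses.mk_eq_mk_iff_isConj.2 (isConj_iff.2 ⟨g', by group⟩ : IsConj (g * g') (g' * g))]

theorem eq_classFunctional {F : Type*} [Field F] [Fintype G] (φ : MonoidAlgebra F G →ₗ[F] F)
    (hφ : ∀ x y, φ (x * y) = φ (y * x)) :
    φ = classFunctional F G (fun c => φ (MonoidAlgebra.single c.out 1)) := by
  refine LinearMap.ext fun x => ?_
  induction x using MonoidAlgebra.induction_linear with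
  | zero => simp
  | add x x' h h' => rw [map_add, map_add, h, h']
  | single g c =>
    rw [classFunctional_single]
    obtain ⟨u, hu⟩ := isConj_iff.1 (ConjClasses.mk_eq_mk_iff_isConj.1
      (Quotient.out_eq (ConjClasses.mk g) :
        ConjClasses.mk (Quotient.out (ConjClasses.mk g)) = ConjClasses.mk g))
    have h : (MonoidAlgebra.single g c : MonoidAlgebra F G) =
        c • (MonoidAlgebra.single u 1 *
          (MonoidAlgebra.single (Quotient.out (ConjClasses.mk g)) 1 *
            MonoidAlgebra.single u⁻¹ 1)) := by
      simp [MonoidAlgebra.single_mul_single, ← mul_assoc, hu]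
    rw [h, map_smul, hφ, mul_assoc]
    simp [MonoidAlgebra.single_mul_single]

theorem classFunctional_pow {ℓ : ℕ} [Fact ℓ.Prime] [Fintype G] (f : ConjClasses G → ZMod ℓ)
    (x : MonoidAlgebra (ZMod ℓ) G) :
    classFunctional (ZMod ℓ) G f (x ^ ℓ) =
      classFunctional (ZMod ℓ) G (f ∘ conjPow G ℓ) x := by
  induction x using MonoidAlgebra.induction_linear with
  | zero => simp [zero_pow (NeZero.ne ℓ)]
  | add x x' h h' =>
    have := map_add_pow_of_map_mul_comm (classFunctional (ZMod ℓ) G f).toAddMonoidHom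
      (classFunctional_mul_comm f) x x'
    rw [map_add, ← h, ← h']
    exact this
  | single g c =>
    rw [MonoidAlgebra.single_pow, classFunctional_single, classFunctional_single, ZMod.pow_card]
    rfl

theorem trace_funLeft {F X : Type*} [Field F] [Fintype X] (π : X → X) :
    LinearMap.trace F (X → F) (LinearMap.funLeft F F π) =
      ((Finset.univ.filter fun c => π c = c).card : F) := by
  rw [LinearMap.trace_eq_matrix_trace F (Pi.basisFun F X), Matrix.trace]
  simp [LinearMap.funLeft_apply, Pi.single_apply]

variable {H : Type*} [Group H]

/-- Transport of class functions along an isomorphism of group algebras. -/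
def classTransport {F : Type*} [Field F] [Fintype G] [Fintype H]
    (e : MonoidAlgebra F G ≃ₐ[F] MonoidAlgebra F H) :
    (ConjClasses G → F) →ₗ[F] (ConjClasses H → F) where
  toFun f c := classFunctional F G f (e.symm (MonoidAlgebra.single c.out 1))
  map_add' f f' := by funext c; simp
  map_smul' a f := by funext c; simp

theorem classFunctional_classTransport {F : Type*} [Field F] [Fintype G] [Fintype H]
    (e : MonoidAlgebra F G ≃ₐ[F] MonoidAlgebra F H) (f : ConjClasses G → F)
    (y : MonoidAlgebra F H) :
    classFunctional F H (classTransport e f) y = classFunctional F G f (e.symm y) := by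
  have := eq_classFunctional ((classFunctional F G f).comp e.symm.toLinearMap)
    (fun x y => by simp [classFunctional_mul_comm])
  exact (LinearMap.congr_fun this y).symm

theorem classFunctional_injective {F : Type*} [Field F] [Fintype G] {f f' : ConjClasses G → F}
    (h : ∀ x, classFunctional F G f x = classFunctional F G f' x) : f = f' := by
  funext c
  obtain ⟨g, rfl⟩ := ConjClasses.exists_rep c
  simpa [classFunctional_single] using h (MonoidAlgebra.single g 1)

theorem card_fixed_conjPow_eq {ℓ : ℕ} [hℓ : Fact ℓ.Prime] [Fintype G] [Fintype H]
    (hG : Fintype.card G < ℓ) (hH : Fintype.card H < ℓ)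
    (e : MonoidAlgebra (ZMod ℓ) G ≃ₐ[ZMod ℓ] MonoidAlgebra (ZMod ℓ) H) :
    (Finset.univ.filter fun c => conjPow G ℓ c = c).card =
      (Finset.univ.filter fun c => conjPow H ℓ c = c).card := by
  let E : (ConjClasses G → ZMod ℓ) ≃ₗ[ZMod ℓ] (ConjClasses H → ZMod ℓ) :=
    LinearEquiv.ofLinearMap (classTransport e) (classTransport e.symm)
      (LinearMap.ext fun f => classFunctional_injective fun x => by
        simp [classFunctional_classTransport])
      (LinearMap.ext fun f => classFunctional_injective fun x => by
        simp [classFunctional_classTransport])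
  have hE : E.conj (LinearMap.funLeft _ _ (conjPow G ℓ)) = LinearMap.funLeft _ _ (conjPow H ℓ) := by
    refine LinearMap.ext fun f => ?_
    obtain ⟨f, rfl⟩ := E.surjective f
    rw [LinearEquiv.conj_apply_apply, E.symm_apply_apply]
    refine classFunctional_injective fun y => ?_
    change classFunctional _ H (classTransport e (f ∘ conjPow G ℓ)) y =
      classFunctional _ H (classTransport e f ∘ conjPow H ℓ) y
    rw [← classFunctional_pow, classFunctional_classTransport, classFunctional_classTransport,
      map_pow, classFunctional_pow]
  have ht := LinearMap.trace_conj' (LinearMap.funLeft (ZMod ℓ) (ZMod ℓ) (conjPow G ℓ)) E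
  rw [hE, trace_funLeft, trace_funLeft, ZMod.natCast_eq_natCast_iff] at ht
  have hlt : ∀ {n m : ℕ}, n ≤ m → m < ℓ → n < ℓ := fun h h' => h.trans_lt h'
  convert Nat.ModEq.eq_of_lt_of_lt ht.symm
    (hlt (Finset.card_le_univ _) (lt_of_le_of_lt
      (Fintype.card_le_of_surjective _ ConjClasses.mk_surjective) hG))
    (hlt (Finset.card_le_univ _) (lt_of_le_of_lt
      (Fintype.card_le_of_surjective _ ConjClasses.mk_surjective) hH))

/-- The number of pairs `(g, u)` such that `u` conjugates `g` to `g ^ k`. -/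
def powConjCount (G : Type*) [Group G] (k : ℕ) : ℕ :=
  Nat.card {x : G × G // x.2 * x.1 * x.2⁻¹ = x.1 ^ k}

theorem card_conj_eq_pow [Fintype G] (k : ℕ) (g : G) :
    Fintype.card {u : G // u * g * u⁻¹ = g ^ k} =
      if conjPow G k (ConjClasses.mk g) = ConjClasses.mk g then
        Fintype.card G / Fintype.card (ConjClasses.mk g).carrier else 0 := by
  split_ifs with h
  · rw [conjPow_mk, eq_comm, ConjClasses.mk_eq_mk_iff_isConj, isConj_iff] at h
    obtain ⟨u, hu⟩ := h
    rw [ConjClasses.card_carrier, Nat.div_div_self]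
    · refine Fintype.card_congr ⟨fun v => ⟨ConjAct.toConjAct (u⁻¹ * v.1), ?_⟩,
        fun v => ⟨u * ConjAct.ofConjAct v.1, ?_⟩, fun v => ?_, fun v => ?_⟩
      · rw [MulAction.mem_stabilizer_iff, ConjAct.toConjAct_smul]
        have := v.2.trans hu.symm
        rw [mul_inv_rev, inv_inv,
          show u⁻¹ * v.1 * g * ((v.1)⁻¹ * u) = u⁻¹ * (v.1 * g * (v.1)⁻¹) * u by group, this]
        group
      · have := v.2
        rw [MulAction.mem_stabilizer_iff, ConjAct.smul_def] at this
        rw [← hu, mul_inv_rev]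
        conv_rhs => rw [← this]
        group
      · simp
      · simp
    · have := Subgroup.card_subgroup_dvd_card (MulAction.stabilizer (ConjAct G) g)
      simpa [Nat.card_eq_fintype_card] using this
    · exact Fintype.card_ne_zero
  · rw [Fintype.card_eq_zero_iff]
    refine ⟨fun u => h ?_⟩
    rw [conjPow_mk, eq_comm, ConjClasses.mk_eq_mk_iff_isConj, isConj_iff]
    exact ⟨u.1, u.2⟩

theorem powConjCount_eq [Fintype G] (k : ℕ) :
    powConjCount G k = (Finset.univ.filter fun c => conjPow G k c = c).card * Fintype.card G := by
  have h1 : powConjCount G k = ∑ g : G, Fintype.card {u : G // u * g * u⁻¹ = g ^ k} := by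
    rw [powConjCount, Nat.card_congr (Equiv.subtypeProdEquivSigmaSubtype
      (fun g u : G => u * g * u⁻¹ = g ^ k)), Nat.card_eq_fintype_card, Fintype.card_sigma]
  rw [h1, Finset.sum_congr rfl fun g _ => card_conj_eq_pow k g,
    ← Finset.sum_fiberwise Finset.univ (ConjClasses.mk (α := G)), Finset.card_filter,
    Finset.sum_mul]
  refine Finset.sum_congr rfl fun c _ => ?_
  obtain ⟨g₀, rfl⟩ := ConjClasses.exists_rep c
  rw [Finset.sum_congr rfl (g := fun _ => if conjPow G k (ConjClasses.mk g₀) = ConjClasses.mk g₀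
      then Fintype.card G / Fintype.card (ConjClasses.mk g₀).carrier else 0)
    (fun g hg => by rw [(Finset.mem_filter.1 hg).2]), Finset.sum_const]
  have h2 : (Finset.univ.filter fun g => ConjClasses.mk g = ConjClasses.mk g₀).card =
      Fintype.card (ConjClasses.mk g₀).carrier := by
    rw [← Set.toFinset_card]
    congr 1
    ext g
    simp [ConjClasses.mem_carrier_iff_mk_eq]
  rw [h2]
  split_ifs
  · rw [smul_eq_mul, one_mul]
    refine Nat.mul_div_cancel' ?_
    rw [ConjClasses.card_carrier]
    refine Nat.div_dvd_of_dvd ?_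
    have := Subgroup.card_subgroup_dvd_card (MulAction.stabilizer (ConjAct G) g₀)
    simpa [Nat.card_eq_fintype_card] using this
  · simp

theorem powConjCount_eq_of_algEquiv {ℓ : ℕ} [Fact ℓ.Prime] [Finite G] [Finite H]
    (hG : Nat.card G < ℓ) (hH : Nat.card H < ℓ) (hc : Nat.card G = Nat.card H)
    (e : MonoidAlgebra (ZMod ℓ) G ≃ₐ[ZMod ℓ] MonoidAlgebra (ZMod ℓ) H) :
    powConjCount G ℓ = powConjCount H ℓ := by
  have := Fintype.ofFinite G
  have := Fintype.ofFinite H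
  rw [Nat.card_eq_fintype_card] at hG hH
  rw [powConjCount_eq, powConjCount_eq, card_fixed_conjPow_eq hG hH e,
    ← Nat.card_eq_fintype_card, ← Nat.card_eq_fintype_card, hc]

/-- The number of homomorphisms from `G` to a cyclic group of order `d`. -/
def cyclicHomCount (G : Type*) [Group G] (d : ℕ) : ℕ :=
  Nat.card (G →* Multiplicative (ZMod d))

theorem card_algHom_eq {ℓ : ℕ} [hℓ : Fact ℓ.Prime] :
    Nat.card (MonoidAlgebra (ZMod ℓ) G →ₐ[ZMod ℓ] ZMod ℓ) = cyclicHomCount G (ℓ - 1) := by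
  rw [← Nat.card_congr (MonoidAlgebra.lift (ZMod ℓ) (ZMod ℓ) G), cyclicHomCount]
  have hc : Nat.card (ZMod ℓ)ˣ = ℓ - 1 := by
    rw [Nat.card_eq_fintype_card, ZMod.card_units]
  rw [← hc]
  let u : Multiplicative (ZMod (Nat.card (ZMod ℓ)ˣ)) ≃* (ZMod ℓ)ˣ :=
    zmodCyclicMulEquiv inferInstance
  refine Nat.card_congr (Equiv.trans ?_ (MulEquiv.monoidHomCongrRightEquiv u.symm))
  exact ⟨fun f => f.toHomUnits, fun f => (Units.coeHom _).comp f, fun f => by ext; simp,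
    fun f => by ext; simp⟩

theorem cyclicHomCount_eq_of_algEquiv {ℓ : ℕ} [Fact ℓ.Prime]
    (e : MonoidAlgebra (ZMod ℓ) G ≃ₐ[ZMod ℓ] MonoidAlgebra (ZMod ℓ) H) :
    cyclicHomCount G (ℓ - 1) = cyclicHomCount H (ℓ - 1) := by
  rw [← card_algHom_eq, ← card_algHom_eq]
  exact Nat.card_congr (e.arrowCongr AlgEquiv.refl)

end ClassFunctions

section TraceForm

variable {H : Type*} [Group H]

/-- The coefficients of an element of the group algebra of a finite group. -/
def coeffFun (F A : Type*) [Field F] [Finite A] : MonoidAlgebra F A ≃ₗ[F] (A → F) :=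
  (MonoidAlgebra.coeffLinearEquiv F).trans (Finsupp.linearEquivFunOnFinite F F A)

theorem coeffFun_apply {F A : Type*} [Field F] [Finite A] (x : MonoidAlgebra F A) (g : A) :
    coeffFun F A x g = x.coeff g := rfl

theorem trace_mulLeft {F : Type*} [Field F] [Fintype G] (x : MonoidAlgebra F G) :
    LinearMap.trace F _ (LinearMap.mulLeft F x) = Fintype.card G * x.coeff 1 := by
  induction x using MonoidAlgebra.induction_linear with
  | zero => rw [LinearMap.mulLeft_zero_eq_zero]; simp
  | add x y hx hy =>
    have : LinearMap.mulLeft F (x + y) = LinearMap.mulLeft F x + LinearMap.mulLeft F y :=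
      LinearMap.ext fun z => add_mul x y z
    rw [this, map_add, hx, hy]
    simp [mul_add]
  | single g c =>
    have h1 : (coeffFun F G).conj (LinearMap.mulLeft F (MonoidAlgebra.single g c)) =
        c • LinearMap.funLeft F F (fun h => g⁻¹ * h) := by
      refine LinearMap.ext fun f => ?_
      obtain ⟨y, rfl⟩ := (coeffFun F G).surjective f
      rw [LinearEquiv.conj_apply_apply, LinearEquiv.symm_apply_apply]
      funext h
      simp [coeffFun_apply, LinearMap.funLeft_apply]
    rw [← LinearMap.trace_conj' _ (coeffFun F G), h1, map_smul, trace_funLeft]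
    by_cases hg : g = 1
    · subst hg
      simp [MonoidAlgebra.coeff_single, mul_comm]
    · simp [MonoidAlgebra.coeff_single, hg, Finset.filter_false]

theorem coeff_one_algEquiv [Finite G] [Finite H]
    (e : MonoidAlgebra ℚ G ≃ₐ[ℚ] MonoidAlgebra ℚ H) (x : MonoidAlgebra ℚ G) :
    (e x).coeff 1 = x.coeff 1 := by
  have := Fintype.ofFinite G
  have := Fintype.ofFinite H
  have hc := card_eq_of_algEquiv e
  have h1 : e.toLinearEquiv.conj (LinearMap.mulLeft ℚ x) = LinearMap.mulLeft ℚ (e x) := by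
    refine LinearMap.ext fun f => ?_
    obtain ⟨y, rfl⟩ := e.surjective f
    simp
  have h2 := LinearMap.trace_conj' (LinearMap.mulLeft ℚ x) e.toLinearEquiv
  rw [h1, trace_mulLeft, trace_mulLeft, ← Nat.card_eq_fintype_card, ← Nat.card_eq_fintype_card,
    hc] at h2
  exact mul_left_cancel₀ (by exact_mod_cast Nat.card_pos.ne') h2

theorem coeff_one_mul_self [Fintype G] (x : MonoidAlgebra ℚ G) :
    (x * x).coeff 1 = ∑ g, x.coeff g * x.coeff g⁻¹ := by
  rw [MonoidAlgebra.coeff_mul, Finsupp.sum_fintype _ _ (by simp)]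
  refine Finset.sum_congr rfl fun g _ => ?_
  rw [Finsupp.sum_fintype _ _ (by simp), Finset.sum_eq_single g⁻¹]
  · simp
  · intro h _ hh
    rw [if_neg]
    intro h'
    exact hh (eq_inv_of_mul_eq_one_right h')
  · simp

/-- The projection of functions on `G` onto those invariant under inversion. -/
def symmProj (G : Type*) [Group G] : (G → ℚ) →ₗ[ℚ] (G → ℚ) :=
  (1 / 2 : ℚ) • (LinearMap.id + LinearMap.funLeft ℚ ℚ (fun g : G => g⁻¹))

theorem symmProj_apply (f : G → ℚ) (g : G) : symmProj G f g = (f g + f g⁻¹) / 2 := by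
  simp [symmProj, LinearMap.funLeft_apply]; ring

theorem two_mul_finrank_range_symmProj [Fintype G] :
    2 * Module.finrank ℚ (LinearMap.range (symmProj G)) =
      Fintype.card G + (Finset.univ.filter fun g : G => g⁻¹ = g).card := by
  have h : LinearMap.IsProj (LinearMap.range (symmProj G)) (symmProj G) := by
    refine ⟨fun x => ⟨x, rfl⟩, ?_⟩
    rintro _ ⟨f, rfl⟩
    funext g
    simp only [symmProj_apply, inv_inv]
    ring
  have ht := h.trace
  have ht' : LinearMap.trace ℚ _ (symmProj G) =
      (1 / 2 : ℚ) * (Fintype.card G + (Finset.univ.filter fun g : G => g⁻¹ = g).card) := by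
    rw [symmProj, map_smul, map_add, trace_funLeft, LinearMap.trace_id]
    simp
  rw [ht'] at ht
  have : (2 * Module.finrank ℚ (LinearMap.range (symmProj G)) : ℚ) =
      Fintype.card G + (Finset.univ.filter fun g : G => g⁻¹ = g).card := by
    linarith
  exact_mod_cast this

theorem finrank_range_symmProj_le [Fintype G] [Fintype H]
    (e : MonoidAlgebra ℚ G ≃ₐ[ℚ] MonoidAlgebra ℚ H) :
    Module.finrank ℚ (LinearMap.range (symmProj G)) ≤
      Module.finrank ℚ (LinearMap.range (symmProj H)) := by
  let E : (G → ℚ) ≃ₗ[ℚ] (H → ℚ) :=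
    (coeffFun ℚ G).symm.trans (e.toLinearEquiv.trans (coeffFun ℚ H))
  have hE : ∀ f, ∑ h, E f h * E f h⁻¹ = ∑ g, f g * f g⁻¹ := by
    intro f
    obtain ⟨x, rfl⟩ := (coeffFun ℚ G).surjective f
    have h1 : E (coeffFun ℚ G x) = coeffFun ℚ H (e x) := by simp [E]
    simp only [h1, coeffFun_apply]
    rw [← coeff_one_mul_self, ← coeff_one_mul_self, ← map_mul, coeff_one_algEquiv]
  have hinj : Function.Injective
      ((symmProj H).comp ((E : (G → ℚ) →ₗ[ℚ] (H → ℚ)).comp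
        (LinearMap.range (symmProj G)).subtype)) := by
    rw [← LinearMap.ker_eq_bot, LinearMap.ker_eq_bot']
    rintro ⟨f, f₀, rfl⟩ hf
    have h1 : ∀ h, E (symmProj G f₀) h⁻¹ = - E (symmProj G f₀) h := by
      intro h
      have := congrFun hf h
      simp only [LinearMap.comp_apply, symmProj_apply, Submodule.subtype_apply, Pi.zero_apply,
        LinearEquiv.coe_coe] at this
      linarith
    have h2 : ∀ g, symmProj G f₀ g⁻¹ = symmProj G f₀ g := by
      intro g
      simp only [symmProj_apply, inv_inv]
      ring
    have h3 := hE (symmProj G f₀)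
    simp only [h1, h2] at h3
    have h4 : ∑ g, symmProj G f₀ g * symmProj G f₀ g = 0 := by
      refine le_antisymm ?_ (Finset.sum_nonneg fun g _ => mul_self_nonneg _)
      rw [← h3]
      refine Finset.sum_nonpos fun h _ => ?_
      nlinarith [mul_self_nonneg (E (symmProj G f₀) h)]
    rw [Finset.sum_eq_zero_iff_of_nonneg fun g _ => mul_self_nonneg _] at h4
    refine Subtype.ext (funext fun g => ?_)
    exact mul_self_eq_zero.1 (h4 g (Finset.mem_univ g))
  rw [← LinearMap.finrank_range_of_inj hinj]
  exact Submodule.finrank_mono (LinearMap.range_comp_le_range _ _)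

theorem card_inv_eq_self_le [Fintype G] [Fintype H]
    (e : MonoidAlgebra ℚ G ≃ₐ[ℚ] MonoidAlgebra ℚ H) :
    Nat.card {g : G // g⁻¹ = g} ≤ Nat.card {h : H // h⁻¹ = h} := by
  have h1 := two_mul_finrank_range_symmProj (G := G)
  have h2 := two_mul_finrank_range_symmProj (G := H)
  have h3 := finrank_range_symmProj_le e
  have h4 := card_eq_of_algEquiv e
  rw [Nat.card_eq_fintype_card, Nat.card_eq_fintype_card] at h4
  rw [Nat.card_eq_fintype_card, Nat.card_eq_fintype_card, Fintype.card_subtype,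
    Fintype.card_subtype]
  have h5 : (Finset.univ.filter fun g : G => g⁻¹ = g).card ≤
    (Finset.univ.filter fun g : H => g⁻¹ = g).card := by omega
  convert h5

theorem card_inv_eq_self_eq [Finite G] [Finite H]
    (e : MonoidAlgebra ℚ G ≃ₐ[ℚ] MonoidAlgebra ℚ H) :
    Nat.card {g : G // g⁻¹ = g} = Nat.card {h : H // h⁻¹ = h} := by
  have := Fintype.ofFinite G
  have := Fintype.ofFinite H
  exact le_antisymm (card_inv_eq_self_le e) (card_inv_eq_self_le e.symm)

end TraceForm

section Exponents

variable {H : Type*} [Group H]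

/-- Simultaneous congruences modulo powers of distinct primes are satisfied by a large prime. -/
theorem exists_prime_modEq (S : Finset ℕ) (hS : ∀ p ∈ S, p.Prime) (N B : ℕ) (c : ℕ → ℕ)
    (hc : ∀ p ∈ S, ¬ p ∣ c p) :
    ∃ k, k.Prime ∧ B < k ∧ ∀ p ∈ S, k ≡ c p [MOD p ^ N] := by
  obtain ⟨a, ha⟩ : ∃ a : ℕ, ∀ p ∈ S, a ≡ c p [MOD p ^ (N + 1)] := by
    have h := Nat.chineseRemainderOfFinset c (fun p => p ^ (N + 1)) S
      (fun p hp => pow_ne_zero _ (hS p hp).ne_zero)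
      (fun p hp q hq hpq => Nat.Coprime.pow _ _ ((Nat.coprime_primes (hS p hp) (hS q hq)).2 hpq))
    exact ⟨h.1, h.2⟩
  obtain ⟨k, hk, hkp, hka⟩ := Nat.forall_exists_prime_gt_and_modEq B
    (q := ∏ p ∈ S, p ^ (N + 1)) (a := a)
    (Finset.prod_ne_zero_iff.2 fun p hp => pow_ne_zero _ (hS p hp).ne_zero)
    (Nat.Coprime.prod_right fun p hp => Nat.Coprime.pow_right _ <| Nat.Coprime.symm <|
      (Nat.Prime.coprime_iff_not_dvd (hS p hp)).2 fun h => hc p hp <|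
        ((ha p hp).of_dvd (dvd_pow_self p N.succ_ne_zero)).dvd_iff (dvd_refl p) |>.1 h)
  refine ⟨k, hkp, hk, fun p hp => ?_⟩
  exact ((hka.of_dvd (Finset.dvd_prod_of_mem _ hp)).trans (ha p hp)).of_dvd
    (pow_dvd_pow p N.le_succ)

theorem exists_exponent [Finite G] [Finite H]
    (e : MonoidAlgebra ℚ G ≃ₐ[ℚ] MonoidAlgebra ℚ H) (N : ℕ) (c : ℕ → ℕ)
    (hc : ∀ p ∈ (Nat.card G).primeFactors, ¬ p ∣ c p) :
    ∃ k, 2 ≤ k ∧ (∀ p ∈ (Nat.card G).primeFactors, k ≡ c p [MOD p ^ N]) ∧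
      powConjCount G k = powConjCount H k ∧
      cyclicHomCount G (k - 1) = cyclicHomCount H (k - 1) := by
  obtain ⟨B, hB⟩ := eventually_nonempty_algEquiv_zmod e
  have hcard := card_eq_of_algEquiv e
  obtain ⟨k, hk, hkB, hkc⟩ := exists_prime_modEq _ (fun p hp => Nat.prime_of_mem_primeFactors hp)
    N (B + Nat.card G) c hc
  have : Fact k.Prime := ⟨hk⟩
  obtain ⟨e'⟩ := hB k hk (by omega)
  exact ⟨k, hk.two_le, hkc, powConjCount_eq_of_algEquiv (by omega) (by omega) hcard e',
    cyclicHomCount_eq_of_algEquiv e'⟩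

end Exponents

section Presentations

/-- The elements `a`, `b` satisfy the relations `a ^ m = 1`, `b ^ n = a ^ s`,
`b * a * b⁻¹ = a ^ t`, which present the group. -/
structure IsPres (a b : G) (m n s t : ℕ) : Prop where
  order : orderOf a = m
  card : Nat.card G = m * n
  pow : b ^ n = a ^ s
  conj : b * a * b⁻¹ = a ^ t
  form : ∀ g : G, ∃ x y : ℕ, g = a ^ x * b ^ y

/-- The group admits a metacyclic presentation with the given parameters. -/
def HasPres (G : Type*) [Group G] (m n s t : ℕ) : Prop :=
  ∃ a b : G, IsPres a b m n s t

theorem conj_pow_pow {a b : G} {t : ℕ} (h : b * a * b⁻¹ = a ^ t) (y z : ℕ) :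
    b ^ y * a ^ z = a ^ (z * t ^ y) * b ^ y := by
  have h1 : ∀ z, b * a ^ z = a ^ (z * t) * b := by
    intro z
    rw [mul_comm z t, pow_mul, ← h, conj_pow]
    group
  induction y generalizing z with
  | zero => simp
  | succ y ih => rw [pow_succ, mul_assoc, h1, ← mul_assoc, ih, mul_assoc, ← pow_succ,
      mul_assoc z, pow_succ' t]

theorem mul_pow_eq {a b : G} {t : ℕ} (h : b * a * b⁻¹ = a ^ t) (i y l : ℕ) :
    (a ^ i * b ^ y) ^ l = a ^ (i * ∑ k ∈ Finset.range l, (t ^ y) ^ k) * b ^ (y * l) := by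
  induction l with
  | zero => simp
  | succ l ih =>
    rw [pow_succ, ih, mul_assoc, ← mul_assoc (b ^ _), conj_pow_pow h, Finset.sum_range_succ,
      mul_add, pow_add, ← pow_mul, mul_add, pow_add, mul_one]
    group

theorem exists_form [Finite G] {a b : G} {t : ℕ} (h : b * a * b⁻¹ = a ^ t)
    (hab : Subgroup.closure {a, b} = ⊤) (g : G) : ∃ x y : ℕ, g = a ^ x * b ^ y := by
  have hmul : ∀ g g' : G, (∃ x y : ℕ, g = a ^ x * b ^ y) → (∃ x y : ℕ, g' = a ^ x * b ^ y) →
      ∃ x y : ℕ, g * g' = a ^ x * b ^ y := by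
    rintro _ _ ⟨x, y, rfl⟩ ⟨z, w, rfl⟩
    refine ⟨x + z * t ^ y, y + w, ?_⟩
    rw [mul_assoc, ← mul_assoc (b ^ y), conj_pow_pow h, pow_add, pow_add]
    group
  have hg : g ∈ Subgroup.closure {a, b} := by rw [hab]; trivial
  induction hg using Subgroup.closure_induction with
  | mem x hx =>
    rcases hx with rfl | rfl
    · exact ⟨1, 0, by simp⟩
    · exact ⟨0, 1, by simp⟩
  | one => exact ⟨0, 0, by simp⟩
  | mul x y _ _ hx hy => exact hmul x y hx hy
  | inv x _ hx =>
    have hp : ∀ k : ℕ, ∃ y z : ℕ, x ^ k = a ^ y * b ^ z := by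
      intro k
      induction k with
      | zero => exact ⟨0, 0, by simp⟩
      | succ k ih => rw [pow_succ]; exact hmul _ _ ih hx
    obtain ⟨y, z, hyz⟩ := hp (orderOf x - 1)
    refine ⟨y, z, ?_⟩
    rw [← hyz]
    refine inv_eq_of_mul_eq_one_right ?_
    rw [← pow_succ', Nat.sub_add_cancel (orderOf_pos x), pow_orderOf_eq_one]

theorem exists_isPres [Finite G] {a b : G} {t : ℕ} (h : b * a * b⁻¹ = a ^ t)
    (hab : Subgroup.closure {a, b} = ⊤) :
    ∃ s, IsPres a b (orderOf a) (Nat.card G / orderOf a) s t := by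
  have hform := exists_form h hab
  have hnorm : (Subgroup.zpowers a).Normal := by
    refine ⟨fun x hx g => ?_⟩
    obtain ⟨k, rfl⟩ := (Submonoid.mem_powers_iff _ _).1 (mem_powers_iff_mem_zpowers.2 hx)
    obtain ⟨x, y, rfl⟩ := hform g
    rw [mul_assoc (a ^ x), conj_pow_pow h]
    refine ⟨(k * t ^ y : ℕ), ?_⟩
    simp only [zpow_natCast]
    rw [← mul_assoc, ← pow_add, add_comm, pow_add]
    group
  have hcard := Subgroup.card_mul_index (Subgroup.zpowers a)
  rw [Nat.card_zpowers] at hcard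
  have hn : Nat.card G / orderOf a = (Subgroup.zpowers a).index := by
    rw [← hcard, Nat.mul_div_cancel_left _ (orderOf_pos a)]
  have hmem : b ^ (Nat.card G / orderOf a) ∈ Subgroup.zpowers a := by
    rw [hn]
    exact Subgroup.pow_index_mem _ b
  obtain ⟨s, hs⟩ := (Submonoid.mem_powers_iff _ _).1 (mem_powers_iff_mem_zpowers.2 hmem)
  exact ⟨s, rfl, by rw [hn, hcard], hs.symm, h, hform⟩

theorem card_le_of_form [Finite G] {a b : G} {n s : ℕ} (hn : 0 < n) (hpow : b ^ n = a ^ s)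
    (hform : ∀ g : G, ∃ x y : ℕ, g = a ^ x * b ^ y) : Nat.card G ≤ orderOf a * n := by
  have hsurj : Function.Surjective fun x : Fin (orderOf a) × Fin n => a ^ x.1.1 * b ^ x.2.1 := by
    intro g
    obtain ⟨x, y, rfl⟩ := hform g
    refine ⟨⟨⟨(x + s * (y / n)) % orderOf a, Nat.mod_lt _ (orderOf_pos a)⟩,
      ⟨y % n, Nat.mod_lt _ hn⟩⟩, ?_⟩
    simp only [pow_mod_orderOf]
    conv_rhs => rw [← Nat.div_add_mod y n, pow_add, pow_mul, hpow]
    rw [pow_add, pow_mul, mul_assoc]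
  simpa using Nat.card_le_card_of_surjective _ hsurj

theorem exists_hasPres_of_isMetacyclic [Finite G] (h : IsMetacyclic G) :
    ∃ m n s t, HasPres G m n s t := by
  obtain ⟨A, B, hA, hcA, hcB, hcov⟩ := h
  obtain ⟨⟨a, ha⟩, ha'⟩ := hcA
  obtain ⟨⟨b, hb⟩, hb'⟩ := hcB
  have hA' : ∀ x ∈ A, x ∈ Subgroup.zpowers a := by
    intro x hx
    obtain ⟨k, hk⟩ := ha' ⟨x, hx⟩
    exact ⟨k, by simpa using congrArg Subtype.val hk⟩
  have hB' : ∀ x ∈ B, x ∈ Subgroup.zpowers b := by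
    intro x hx
    obtain ⟨k, hk⟩ := hb' ⟨x, hx⟩
    exact ⟨k, by simpa using congrArg Subtype.val hk⟩
  obtain ⟨t, ht⟩ := (Submonoid.mem_powers_iff _ _).1
    (mem_powers_iff_mem_zpowers.2 (hA' _ (hA.conj_mem a ha b)))
  have hab : Subgroup.closure {a, b} = ⊤ := by
    refine eq_top_iff.2 fun g _ => ?_
    obtain ⟨x, hx, y, hy, rfl⟩ := hcov g
    exact mul_mem
      (Subgroup.zpowers_le.2 (Subgroup.subset_closure (by simp)) (hA' x hx))
      (Subgroup.zpowers_le.2 (Subgroup.subset_closure (by simp)) (hB' y hy))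
  obtain ⟨s, hs⟩ := exists_isPres ht.symm hab
  exact ⟨_, _, _, _, a, b, hs⟩

namespace IsPres

variable {a b : G} {m n s t : ℕ}

theorem closure_eq_top (h : IsPres a b m n s t) : Subgroup.closure {a, b} = ⊤ := by
  refine eq_top_iff.2 fun g _ => ?_
  obtain ⟨x, y, rfl⟩ := h.form g
  exact mul_mem (pow_mem (Subgroup.subset_closure (by simp)) _)
    (pow_mem (Subgroup.subset_closure (by simp)) _)

theorem pos_left [Finite G] (h : IsPres a b m n s t) : 0 < m :=
  h.order ▸ orderOf_pos a

theorem pos_right [Finite G] (h : IsPres a b m n s t) : 0 < n := by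
  have := h.card ▸ Nat.card_pos (α := G)
  exact Nat.pos_of_ne_zero (right_ne_zero_of_mul this.ne')

theorem pow_eq_pow (h : IsPres a b m n s t) {x y : ℕ} : a ^ x = a ^ y ↔ x ≡ y [MOD m] := by
  rw [pow_eq_pow_iff_modEq, h.order]

theorem pow_modEq_one (h : IsPres a b m n s t) : t ^ n ≡ 1 [MOD m] := by
  have h1 := conj_pow_pow h.conj n 1
  rw [h.pow, pow_one, one_mul, ← pow_succ, pow_succ'] at h1
  have h2 := mul_right_cancel h1
  rw [← h.pow_eq_pow, pow_one]
  exact h2.symm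

theorem mul_modEq (h : IsPres a b m n s t) : s * t ≡ s [MOD m] := by
  have h1 := conj_pow_pow h.conj 1 s
  rw [← h.pow_eq_pow]
  rw [← h.pow, pow_one, ← pow_succ', pow_succ, pow_one] at h1
  rw [← h.pow]
  exact (mul_right_cancel h1).symm

theorem coprime [Finite G] (h : IsPres a b m n s t) : t.Coprime m := by
  have h1 := h.pow_modEq_one
  have hn := h.pos_right
  have : (t ^ n).Coprime m := by
    rw [Nat.Coprime, h1.gcd_eq, Nat.gcd_one_left]
  exact Nat.Coprime.coprime_dvd_left (dvd_pow_self t hn.ne') this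

theorem congr_left (h : IsPres a b m n s t) {t' : ℕ} (ht : t ≡ t' [MOD m]) :
    IsPres a b m n s t' :=
  ⟨h.order, h.card, h.pow, h.conj.trans (h.pow_eq_pow.2 ht), h.form⟩

theorem exists_hom [Finite G] {H : Type*} [Group H] [Finite H] (h : IsPres a b m n s t)
    {a' b' : H} (ha : a' ^ m = 1) (hb : b' ^ n = a' ^ s) (hc : b' * a' * b'⁻¹ = a' ^ t) :
    ∃ f : G →* H, f a = a' ∧ f b = b' := by
  let K : Subgroup (G × H) := Subgroup.closure {(a, a'), (b, b')}
  let α : K := ⟨(a, a'), Subgroup.subset_closure (by simp)⟩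
  let β : K := ⟨(b, b'), Subgroup.subset_closure (by simp)⟩
  have hαβ : Subgroup.closure {α, β} = ⊤ := by
    have := Subgroup.closure_closure_coe_preimage (k := {(a, a'), (b, b')})
    rw [← this]
    congr 1
    ext x
    simp [α, β, Subtype.ext_iff]
  have hconj : β * α * β⁻¹ = α ^ t := Subtype.ext (Prod.ext h.conj hc)
  have hform := exists_form hconj hαβ
  have hpow : β ^ n = α ^ s := Subtype.ext (Prod.ext h.pow hb)
  have hα : orderOf α = m := by
    rw [Subgroup.orderOf_mk, Prod.orderOf_mk, h.order]
    exact Nat.lcm_eq_left (orderOf_dvd_of_pow_eq_one ha)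
  have hle := card_le_of_form h.pos_right hpow hform
  rw [hα] at hle
  let f : K →* G := (MonoidHom.fst G H).comp K.subtype
  have hf : Function.Surjective f := by
    intro g
    obtain ⟨x, y, rfl⟩ := h.form g
    exact ⟨α ^ x * β ^ y, by simp [f, α, β]⟩
  have hbij : Function.Bijective f :=
    hf.bijective_of_nat_card_le (by rw [h.card]; exact hle)
  let F := MulEquiv.ofBijective f hbij
  have hFa : F.symm a = α := F.symm_apply_eq.2 rfl
  have hFb : F.symm b = β := F.symm_apply_eq.2 rfl
  refine ⟨((MonoidHom.snd G H).comp K.subtype).comp F.symm.toMonoidHom, ?_, ?_⟩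
  · simp [hFa, α]
  · simp [hFb, β]

end IsPres

theorem exists_unit_mul_modEq {m s s' : ℕ} (hm : 0 < m) (h : s.gcd m = s'.gcd m) :
    ∃ j : ℕ, j.Coprime m ∧ j * s' ≡ s [MOD m] := by
  obtain ⟨d, hd⟩ : ∃ d, s.gcd m = d := ⟨_, rfl⟩
  have hd' : s'.gcd m = d := h ▸ hd
  have hdpos : 0 < d := hd ▸ Nat.gcd_pos_of_pos_right s hm
  obtain ⟨s₁, rfl⟩ : d ∣ s := hd ▸ Nat.gcd_dvd_left s m
  obtain ⟨s₂, rfl⟩ : d ∣ s' := hd' ▸ Nat.gcd_dvd_left s' m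
  obtain ⟨m₁, rfl⟩ : d ∣ m := hd ▸ Nat.gcd_dvd_right _ m
  rw [Nat.gcd_mul_left] at hd hd'
  have h1 : s₁.Coprime m₁ := Nat.eq_of_mul_eq_mul_left hdpos (by rw [hd, mul_one])
  have h2 : s₂.Coprime m₁ := Nat.eq_of_mul_eq_mul_left hdpos (by rw [hd', mul_one])
  have : NeZero (d * m₁) := ⟨hm.ne'⟩
  obtain ⟨u, hu⟩ := ZMod.unitsMap_surjective (Dvd.intro_left d rfl : m₁ ∣ d * m₁)
    (ZMod.unitOfCoprime s₁ h1 * (ZMod.unitOfCoprime s₂ h2)⁻¹)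
  refine ⟨(u : ZMod (d * m₁)).val, ZMod.val_coe_unit_coprime u, ?_⟩
  have h3 : ((u : ZMod (d * m₁)).val : ZMod m₁) * s₂ = s₁ := by
    have h4 : ((u : ZMod (d * m₁)).val : ZMod m₁) =
        ((ZMod.unitsMap (Dvd.intro_left d rfl : m₁ ∣ d * m₁) u : (ZMod m₁)ˣ) : ZMod m₁) := by
      rw [ZMod.unitsMap_val, ZMod.natCast_val]
    rw [h4, hu, Units.val_mul, mul_assoc, ← ZMod.coe_unitOfCoprime s₂ h2, Units.inv_mul,
      mul_one, ZMod.coe_unitOfCoprime]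
  have h5 : (u : ZMod (d * m₁)).val * s₂ ≡ s₁ [MOD m₁] := by
    rw [← ZMod.natCast_eq_natCast_iff]
    exact_mod_cast h3
  rw [mul_left_comm]
  exact h5.mul_left' d

namespace HasPres

variable {m n s t : ℕ}

theorem pos_left [Finite G] (h : HasPres G m n s t) : 0 < m := by
  obtain ⟨a, b, h⟩ := h; exact h.pos_left

theorem pos_right [Finite G] (h : HasPres G m n s t) : 0 < n := by
  obtain ⟨a, b, h⟩ := h; exact h.pos_right

theorem card (h : HasPres G m n s t) : Nat.card G = m * n := by
  obtain ⟨a, b, h⟩ := h; exact h.card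

theorem coprime [Finite G] (h : HasPres G m n s t) : t.Coprime m := by
  obtain ⟨a, b, h⟩ := h; exact h.coprime

theorem pow_modEq_one (h : HasPres G m n s t) : t ^ n ≡ 1 [MOD m] := by
  obtain ⟨a, b, h⟩ := h; exact h.pow_modEq_one

theorem mul_modEq (h : HasPres G m n s t) : s * t ≡ s [MOD m] := by
  obtain ⟨a, b, h⟩ := h; exact h.mul_modEq

theorem congr_conj (h : HasPres G m n s t) {t' : ℕ} (ht : t ≡ t' [MOD m]) :
    HasPres G m n s t' := by
  obtain ⟨a, b, h⟩ := h; exact ⟨a, b, h.congr_left ht⟩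

theorem of_gcd_eq [Finite G] (h : HasPres G m n s t) {s' : ℕ} (hs : s.gcd m = s'.gcd m) :
    HasPres G m n s' t := by
  have hm := h.pos_left
  obtain ⟨a, b, h⟩ := h
  obtain ⟨j, hj, hjs⟩ := exists_unit_mul_modEq hm hs
  have ho : orderOf (a ^ j) = m := by
    rw [Nat.Coprime.orderOf_pow, h.order]
    rw [h.order]; exact hj.symm
  refine ⟨a ^ j, b, ho, h.card, ?_, ?_, ?_⟩
  · rw [h.pow, ← pow_mul, h.pow_eq_pow]; exact hjs.symm
  · rw [← conj_pow, h.conj, ← pow_mul, ← pow_mul, mul_comm]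
  · intro g
    obtain ⟨x, y, rfl⟩ := h.form g
    have ha : a ∈ Subgroup.zpowers (a ^ j) := by
      rw [mem_zpowers_pow_iff, h.order]
      rw [Nat.coprime_comm] at hj
      exact hj.symm
    obtain ⟨k, hk⟩ := (Submonoid.mem_powers_iff _ _).1 (mem_powers_iff_mem_zpowers.2 ha)
    exact ⟨k * x, y, by rw [pow_mul (a ^ j), hk]⟩

theorem pow_conj [Finite G] (h : HasPres G m n s t) {j : ℕ} (hj : j.Coprime (Nat.card G)) :
    HasPres G m n s (t ^ j) := by
  have key : HasPres G m n (s * j) (t ^ j) := by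
    obtain ⟨a, b, h⟩ := h
    refine ⟨a, b ^ j, h.order, h.card, ?_, ?_, ?_⟩
    · rw [← pow_mul, mul_comm, pow_mul, h.pow, ← pow_mul]
    · have := conj_pow_pow h.conj j 1
      rw [pow_one, one_mul] at this
      rw [this]; group
    · intro g
      obtain ⟨x, y, rfl⟩ := h.form g
      have hb : b ∈ Subgroup.zpowers (b ^ j) := by
        rw [mem_zpowers_pow_iff]
        exact Nat.Coprime.coprime_dvd_right (orderOf_dvd_natCard b) hj
      obtain ⟨k, hk⟩ := (Submonoid.mem_powers_iff _ _).1 (mem_powers_iff_mem_zpowers.2 hb)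
      exact ⟨x, k * y, by rw [pow_mul (b ^ j), hk]⟩
  refine key.of_gcd_eq ?_
  refine Nat.Coprime.gcd_mul_right_cancel _ ?_
  exact Nat.Coprime.coprime_dvd_right (h.card ▸ Dvd.intro _ rfl) hj

theorem add_geomSum [Finite G] (h : HasPres G m n s t) (i : ℕ) :
    HasPres G m n (s + i * ∑ k ∈ Finset.range n, t ^ k) t := by
  obtain ⟨a, b, h⟩ := h
  have hconj : a ^ i * b * a * (a ^ i * b)⁻¹ = a ^ t := by
    have := h.conj
    rw [mul_inv_rev, show a ^ i * b * a * (b⁻¹ * (a ^ i)⁻¹) = a ^ i * (b * a * b⁻¹) * (a ^ i)⁻¹ by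
      group, this, ← pow_add, add_comm, pow_add]
    group
  have hpow := mul_pow_eq h.conj i 1 n
  simp only [pow_one, one_mul] at hpow
  refine ⟨a, a ^ i * b, h.order, h.card, ?_, hconj, ?_⟩
  · rw [hpow, h.pow, ← pow_add, add_comm]
  · refine exists_form hconj (eq_top_iff.2 ?_)
    rw [← h.closure_eq_top, Subgroup.closure_le]
    have ha : a ∈ Subgroup.closure {a, a ^ i * b} := Subgroup.subset_closure (by simp)
    rintro x (rfl | rfl)
    · exact ha
    · have : a ^ i * x ∈ Subgroup.closure {a, a ^ i * x} := Subgroup.subset_closure (by simp)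
      have h2 := mul_mem (inv_mem (pow_mem ha i)) this
      rwa [inv_mul_cancel_left] at h2

/-- Replacing `a` by `a ^ i * b ^ y`. -/
theorem twist [Finite G] (h : HasPres G m n s t) {i y l q w : ℕ} (hi : i.Coprime m)
    (hq : y * l = n * q)
    (hl : (i * (∑ k ∈ Finset.range l, (t ^ y) ^ k) + s * q) * w + i ≡ i * t [MOD m]) :
    ∃ m' n' s', HasPres G m' n' s' (l * w + 1) ∧
      (∀ L Q M, y * L = n * Q →
        m ∣ (i * (∑ k ∈ Finset.range L, (t ^ y) ^ k) + s * Q) * M → m' ∣ L * M) ∧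
      (m' = m → HasPres G m n s (l * w + 1)) := by
  obtain ⟨a, b, h⟩ := h
  have hpow : ∀ L Q, y * L = n * Q → (a ^ i * b ^ y) ^ L =
      a ^ (i * (∑ k ∈ Finset.range L, (t ^ y) ^ k) + s * Q) := by
    intro L Q hQ
    rw [mul_pow_eq h.conj, hQ, pow_mul b, h.pow, ← pow_mul, ← pow_add]
  have hconj : b * (a ^ i * b ^ y) * b⁻¹ = (a ^ i * b ^ y) ^ (l * w + 1) := by
    have h1 := conj_pow_pow h.conj 1 i
    simp only [pow_one] at h1
    have h2 := h.pow_eq_pow.2 hl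
    rw [pow_add] at h2
    rw [pow_succ, pow_mul, hpow l q hq, ← pow_mul, ← mul_assoc, ← mul_assoc, h1, h2]
    group
  have hgen : Subgroup.closure {a ^ i * b ^ y, b} = ⊤ := by
    refine eq_top_iff.2 ?_
    rw [← h.closure_eq_top, Subgroup.closure_le]
    have hb : b ∈ Subgroup.closure {a ^ i * b ^ y, b} := Subgroup.subset_closure (by simp)
    have hai : a ^ i ∈ Subgroup.closure {a ^ i * b ^ y, b} := by
      have h1 : a ^ i * b ^ y ∈ Subgroup.closure {a ^ i * b ^ y, b} :=
        Subgroup.subset_closure (by simp)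
      have h2 := mul_mem h1 (inv_mem (pow_mem hb y))
      rwa [mul_inv_cancel_right] at h2
    have ha : a ∈ Subgroup.zpowers (a ^ i) := by
      rw [mem_zpowers_pow_iff, h.order]
      exact hi
    have ha' : a ∈ Subgroup.closure {a ^ i * b ^ y, b} := Subgroup.zpowers_le.2 hai ha
    intro x hx
    rcases hx with hx | hx
    · rw [hx]; exact ha'
    · rw [hx]; exact hb
  obtain ⟨s', hs'⟩ := exists_isPres hconj hgen
  refine ⟨_, _, s', ⟨_, _, hs'⟩, ?_, ?_⟩
  · intro L Q M hQ hM
    rw [orderOf_dvd_iff_pow_eq_one, pow_mul, hpow L Q hQ, ← pow_mul, ← orderOf_dvd_iff_pow_eq_one,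
      h.order]
    exact hM
  · intro hm
    have hn : Nat.card G / orderOf (a ^ i * b ^ y) = n := by
      rw [hm, h.card, Nat.mul_div_cancel_left _ h.pos_left]
    rw [hn, hm] at hs'
    refine HasPres.of_gcd_eq ⟨_, _, hs'⟩ ?_
    have h1 : orderOf (b ^ n) = m / m.gcd s := by rw [h.pow, orderOf_pow, h.order]
    have h2 : orderOf (b ^ n) = m / m.gcd s' := by rw [hs'.pow, orderOf_pow, hm]
    have hmpos := h.pos_left
    rw [Nat.gcd_comm, Nat.gcd_comm s]
    rw [h2] at h1
    have h3 := Nat.div_mul_cancel (Nat.gcd_dvd_left m s)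
    have h4 := Nat.div_mul_cancel (Nat.gcd_dvd_left m s')
    rw [h1] at h4
    refine Nat.eq_of_mul_eq_mul_left ?_ (h4.trans h3.symm)
    exact Nat.div_pos (Nat.gcd_le_left s hmpos) (Nat.gcd_pos_of_pos_left s hmpos)

theorem nonempty_mulEquiv [Finite G] {H : Type*} [Group H] [Finite H]
    (h : HasPres G m n s t) (h' : HasPres H m n s t) : Nonempty (G ≃* H) := by
  obtain ⟨a, b, h⟩ := h
  obtain ⟨a', b', h'⟩ := h'
  obtain ⟨f, hfa, hfb⟩ := h.exists_hom (a' := a') (b' := b')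
    (by rw [← h'.order, pow_orderOf_eq_one]) h'.pow h'.conj
  have hf : Function.Surjective f := by
    intro g
    obtain ⟨x, y, rfl⟩ := h'.form g
    exact ⟨a ^ x * b ^ y, by rw [map_mul, map_pow, map_pow, hfa, hfb]⟩
  exact ⟨MulEquiv.ofBijective f (hf.bijective_of_nat_card_le (by rw [h.card, h'.card]))⟩

end HasPres

end Presentations

section Counting

namespace IsPres

variable {a b : G} {m n s t : ℕ}

theorem bijective_form [Finite G] (h : IsPres a b m n s t) :
    Function.Bijective fun x : ZMod m × Fin n => a ^ x.1.val * b ^ x.2.1 := by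
  have hm := h.pos_left
  have hn := h.pos_right
  have : NeZero m := ⟨hm.ne'⟩
  have hsurj : Function.Surjective fun x : ZMod m × Fin n => a ^ x.1.val * b ^ x.2.1 := by
    intro g
    obtain ⟨x, y, rfl⟩ := h.form g
    refine ⟨⟨((x + s * (y / n) : ℕ) : ZMod m), ⟨y % n, Nat.mod_lt _ hn⟩⟩, ?_⟩
    simp only [ZMod.val_natCast]
    rw [← h.order, pow_mod_orderOf]
    conv_rhs => rw [← Nat.div_add_mod y n, pow_add, pow_mul, h.pow]
    rw [pow_add, pow_mul, mul_assoc]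
  exact hsurj.bijective_of_nat_card_le (by simp [h.card])

theorem pow_mul_pow_eq_iff [Finite G] (h : IsPres a b m n s t) (X Y Z : ℕ) :
    a ^ X * b ^ Y = a ^ Z ↔ n ∣ Y ∧ X + s * (Y / n) ≡ Z [MOD m] := by
  have hm := h.pos_left
  have hn := h.pos_right
  have : NeZero m := ⟨hm.ne'⟩
  have key : n ∣ Y → (a ^ X * b ^ Y = a ^ Z ↔ X + s * (Y / n) ≡ Z [MOD m]) := by
    rintro ⟨q, rfl⟩
    rw [Nat.mul_div_cancel_left _ hn, pow_mul, h.pow, ← pow_mul, ← pow_add, h.pow_eq_pow]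
  refine ⟨fun he => ?_, fun he => (key he.1).2 he.2⟩
  have hd : n ∣ Y := by
    have h1 : (fun x : ZMod m × Fin n => a ^ x.1.val * b ^ x.2.1)
        (((X + s * (Y / n) : ℕ) : ZMod m), ⟨Y % n, Nat.mod_lt _ hn⟩) =
        (fun x : ZMod m × Fin n => a ^ x.1.val * b ^ x.2.1) ((Z : ZMod m), ⟨0, hn⟩) := by
      simp only [ZMod.val_natCast, pow_zero, mul_one]
      rw [← h.order, pow_mod_orderOf, pow_mod_orderOf, ← he]
      conv_rhs => rw [← Nat.div_add_mod Y n, pow_add, pow_mul, h.pow]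
      rw [pow_add, pow_mul, mul_assoc]
    have h2 := congrArg (fun x => (x.2 : Fin n).1) (h.bijective_form.1 h1)
    exact Nat.dvd_of_mod_eq_zero h2
  exact ⟨hd, (key hd).1 he⟩

theorem conj_eq_pow_iff [Finite G] (h : IsPres a b m n s t) {k : ℕ} (hk : 1 ≤ k) (x y z w : ℕ) :
    (a ^ z * b ^ w) * (a ^ x * b ^ y) * (a ^ z * b ^ w)⁻¹ = (a ^ x * b ^ y) ^ k ↔
      n ∣ y * (k - 1) ∧ (z : ZMod m) * (1 - (t : ZMod m) ^ y) +
        x * ((t : ZMod m) ^ w - ∑ i ∈ Finset.range k, ((t : ZMod m) ^ y) ^ i) -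
        s * (y * (k - 1) / n : ℕ) = 0 := by
  rw [mul_inv_eq_iff_eq_mul, mul_pow_eq h.conj]
  have e1 : a ^ z * b ^ w * (a ^ x * b ^ y) = a ^ (z + x * t ^ w) * b ^ (w + y) := by
    rw [mul_assoc, ← mul_assoc (b ^ w), conj_pow_pow h.conj, pow_add, pow_add]; group
  have e2 : a ^ (x * ∑ i ∈ Finset.range k, (t ^ y) ^ i) * b ^ (y * k) * (a ^ z * b ^ w) =
      a ^ (x * (∑ i ∈ Finset.range k, (t ^ y) ^ i) + z * t ^ (y * k)) * b ^ (y * (k - 1)) *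
        b ^ (w + y) := by
    have : y * (k - 1) + (w + y) = y * k + w := by
      obtain ⟨k, rfl⟩ := Nat.exists_eq_add_of_le' hk
      simp; ring
    rw [mul_assoc, ← mul_assoc (b ^ _), conj_pow_pow h.conj, mul_assoc _ (b ^ _) (b ^ _),
      ← pow_add, ← this, pow_add a, pow_add b (y * (k - 1))]
    simp only [mul_assoc]
  rw [e1, e2, mul_left_inj, eq_comm, h.pow_mul_pow_eq_iff]
  refine and_congr_right fun hd => ?_
  have ht : t ^ (y * k) ≡ t ^ y [MOD m] := by
    obtain ⟨q, hq⟩ := hd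
    have : y * k = n * q + y := by
      obtain ⟨k, rfl⟩ := Nat.exists_eq_add_of_le' hk
      simp at hq ⊢; rw [← hq]; ring
    rw [this, pow_add, pow_mul]
    simpa using (h.pow_modEq_one.pow q).mul_right (t ^ y)
  have ht' := (ZMod.natCast_eq_natCast_iff _ _ _).2 ht
  push_cast at ht'
  rw [← ZMod.natCast_eq_natCast_iff]
  push_cast
  rw [ht', ← sub_eq_zero, ← neg_eq_zero]
  constructor <;> intro h' <;> rw [← h'] <;> ring

end IsPres


theorem card_filter_pow_modEq {n t k e : ℕ} (hn : 0 < n) (ht : t ^ n ≡ 1 [MOD e]) :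
    ((Finset.range n).filter fun w => t ^ w ≡ k [MOD e]).card =
      if ∃ j, t ^ j ≡ k [MOD e] then n / orderOf (t : ZMod e) else 0 := by
  have hcast : ∀ w c : ℕ, t ^ w ≡ c [MOD e] ↔ (t : ZMod e) ^ w = c := by
    intro w c; rw [← ZMod.natCast_eq_natCast_iff]; push_cast; rfl
  have hD : orderOf (t : ZMod e) ∣ n := by
    rw [orderOf_dvd_iff_pow_eq_one]
    simpa using (hcast n 1).1 ht
  have hDpos : 0 < orderOf (t : ZMod e) := Nat.pos_of_dvd_of_pos hD hn
  split_ifs with hj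
  · obtain ⟨j, hj⟩ := hj
    have : ∀ w, t ^ w ≡ k [MOD e] ↔ w ≡ j [MOD orderOf (t : ZMod e)] := by
      intro w
      rw [hcast, ← (hcast j k).1 hj]
      have hu : IsUnit (t : ZMod e) :=
        IsUnit.of_pow_eq_one ((hcast n 1).1 ht |>.trans (by simp)) hn.ne'
      obtain ⟨u, hu⟩ := hu
      rw [← hu, orderOf_units, ← pow_eq_pow_iff_modEq]
      norm_cast
    simp_rw [this]
    have h1 := Nat.count_modEq_card n hDpos j
    obtain ⟨c, rfl⟩ := hD
    rw [Nat.count_eq_card_filter_range] at h1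
    rw [h1]
    simp
  · push Not at hj
    rw [Finset.card_eq_zero, Finset.filter_eq_empty_iff]
    exact fun w _ => hj w

theorem sum_filter_dvd {n D k : ℕ} (hn : 0 < n) (hD : D ∣ n) (f : ℕ → ℂ) :
    ∑ y ∈ (Finset.range n).filter (fun y => n ∣ y * (k - 1) ∧ D ∣ y), f (y * (k - 1) / n) =
      ∑ i ∈ Finset.range ((n / D).gcd (k - 1)), f (i * ((k - 1) / (n / D).gcd (k - 1))) := by
  obtain ⟨n', rfl⟩ := hD
  have hDpos : 0 < D := Nat.pos_of_mul_pos_right hn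
  have hn' : 0 < n' := Nat.pos_of_mul_pos_left hn
  rw [Nat.mul_div_cancel_left _ hDpos]
  obtain ⟨h, hh⟩ : ∃ h, n'.gcd (k - 1) = h := ⟨_, rfl⟩
  have hpos : 0 < h := hh ▸ Nat.gcd_pos_of_pos_left _ hn'
  obtain ⟨n₁, hn₁⟩ : h ∣ n' := hh ▸ Nat.gcd_dvd_left _ _
  obtain ⟨k₁, hk₁⟩ : h ∣ k - 1 := hh ▸ Nat.gcd_dvd_right _ _
  have hcop : n₁.Coprime k₁ := by
    rw [hn₁, hk₁, Nat.gcd_mul_left] at hh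
    exact Nat.eq_of_mul_eq_mul_left hpos (by rw [hh, mul_one])
  have hn₁pos : 0 < n₁ := by
    rcases Nat.eq_zero_or_pos n₁ with rfl | h'
    · simp [hn₁] at hn'
    · exact h'
  rw [hh, hk₁, Nat.mul_div_cancel_left _ hpos]
  symm
  refine Finset.sum_bij (fun i _ => D * n₁ * i) ?_ ?_ ?_ ?_
  · intro i hi
    rw [Finset.mem_range] at hi
    rw [Finset.mem_filter, Finset.mem_range, hn₁]
    refine ⟨?_, ⟨i * k₁, by ring⟩, ⟨n₁ * i, by ring⟩⟩
    rw [mul_comm h, ← mul_assoc]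
    exact Nat.mul_lt_mul_of_pos_left hi (by positivity)
  · intro i _ j _ hij
    exact Nat.eq_of_mul_eq_mul_left (by positivity) hij
  · intro y hy
    rw [Finset.mem_filter, Finset.mem_range] at hy
    obtain ⟨hy1, hy2, y', rfl⟩ := hy
    have h1 : n₁ ∣ y' := by
      rw [hn₁, show D * (h * n₁) = (D * h) * n₁ by ring,
        show D * y' * (h * k₁) = (D * h) * (y' * k₁) by ring] at hy2
      exact hcop.dvd_of_dvd_mul_right (Nat.dvd_of_mul_dvd_mul_left (by positivity) hy2)
    obtain ⟨i, rfl⟩ := h1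
    refine ⟨i, ?_, by ring⟩
    rw [Finset.mem_range]
    rw [hn₁, show D * (n₁ * i) = D * n₁ * i by ring, show D * (h * n₁) = D * n₁ * h by ring] at hy1
    exact lt_of_mul_lt_mul_left hy1 (Nat.zero_le _)
  · intro i _
    rw [hn₁, show D * n₁ * i * (h * k₁) = (i * k₁) * (D * (h * n₁)) by ring, Nat.mul_div_cancel _]
    positivity

/-- The contribution of characters of order `e` of the cyclic normal subgroup to the number of
pairs `(g, u)` with `u * g * u⁻¹ = g ^ k`. -/
def powConjTerm (n s t k e : ℕ) : ℚ :=
  if (∃ j, t ^ j ≡ k [MOD e]) ∧ e * (n / orderOf (t : ZMod e)).gcd (k - 1) ∣ s * (k - 1) then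
    ((n / orderOf (t : ZMod e)).gcd (k - 1) : ℚ) / orderOf (t : ZMod e) else 0

theorem sum_range_pow_eq {z : ℂ} {h : ℕ} (hz : z ^ h = 1) :
    ∑ i ∈ Finset.range h, z ^ i = if z = 1 then (h : ℂ) else 0 := by
  split_ifs with h1
  · simp [h1]
  · rw [geom_sum_eq h1, hz, sub_self, zero_div]


theorem IsPres.powConjCount_eq_sum [Finite G] {a b : G} {m n s t : ℕ} [NeZero m]
    (h : IsPres a b m n s t) {k : ℕ} (hk : 1 ≤ k) :
    (powConjCount G k : ℂ) = ∑ y ∈ Finset.range n, ∑ w ∈ Finset.range n,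
      ∑ x : ZMod m, ∑ z : ZMod m, if n ∣ y * (k - 1) ∧ z * (1 - (t : ZMod m) ^ y) +
        x * ((t : ZMod m) ^ w - ∑ i ∈ Finset.range k, ((t : ZMod m) ^ y) ^ i) -
        s * (y * (k - 1) / n : ℕ) = 0 then 1 else 0 := by
  have := Fintype.ofFinite G
  let f := Equiv.ofBijective _ h.bijective_form
  rw [powConjCount, Nat.card_eq_fintype_card, Fintype.card_subtype, Finset.card_filter,
    Fintype.sum_prod_type, ← Equiv.sum_comp f]
  simp_rw [← Equiv.sum_comp f]
  have key : ∀ p q : ZMod m × Fin n, (f q * f p * (f q)⁻¹ = f p ^ k) ↔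
      (n ∣ p.2.1 * (k - 1) ∧ q.1 * (1 - (t : ZMod m) ^ p.2.1) +
        p.1 * ((t : ZMod m) ^ q.2.1 - ∑ i ∈ Finset.range k, ((t : ZMod m) ^ p.2.1) ^ i) -
        s * (p.2.1 * (k - 1) / n : ℕ) = 0) := by
    intro p q
    have := h.conj_eq_pow_iff hk p.1.val p.2.1 q.1.val q.2.1
    simp only [ZMod.natCast_val, ZMod.cast_id', id] at this
    exact this
  simp_rw [key, Fintype.sum_prod_type]
  push_cast
  rw [Finset.sum_comm, Finset.sum_range (n := n)]
  refine Finset.sum_congr rfl fun y _ => ?_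
  rw [Finset.sum_range (n := n)]
  conv_rhs => rw [Finset.sum_comm]
  refine Finset.sum_congr rfl fun x _ => ?_
  rw [Finset.sum_comm]

theorem sum_sum_ite_eq {m : ℕ} [NeZero m] (α β γ : ZMod m) :
    (m : ℂ) * ∑ x : ZMod m, ∑ z : ZMod m, (if z * α + x * β - γ = 0 then 1 else 0) =
      m ^ 2 * ∑ l : ZMod m, if l * α = 0 ∧ l * β = 0 then ZMod.stdAddChar (-(l * γ)) else 0 := by
  have hp := ZMod.isPrimitive_stdAddChar m
  have h1 : ∀ c : ZMod m, (m : ℂ) * (if c = 0 then 1 else 0) =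
      ∑ l : ZMod m, ZMod.stdAddChar (l * c) := by
    intro c
    rw [AddChar.sum_mulShift _ hp]
    simp
  simp_rw [Finset.mul_sum, h1]
  have h2 : ∀ x z l : ZMod m, (ZMod.stdAddChar (l * (z * α + x * β - γ)) : ℂ) =
      ZMod.stdAddChar (-(l * γ)) * (ZMod.stdAddChar (x * (l * β)) *
        ZMod.stdAddChar (z * (l * α))) := by
    intro x z l
    rw [← AddChar.map_add_eq_mul, ← AddChar.map_add_eq_mul]
    congr 1; ring
  simp_rw [h2]
  calc _ = ∑ l : ZMod m, ∑ x : ZMod m, ∑ z : ZMod m, (ZMod.stdAddChar (-(l * γ)) : ℂ) *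
      (ZMod.stdAddChar (x * (l * β)) * ZMod.stdAddChar (z * (l * α))) := by
        symm
        rw [Finset.sum_comm]
        exact Finset.sum_congr rfl fun x _ => Finset.sum_comm
    _ = _ := ?_
  refine Finset.sum_congr rfl fun l _ => ?_
  simp_rw [← Finset.mul_sum, AddChar.sum_mulShift _ hp, ← Finset.sum_mul,
    AddChar.sum_mulShift _ hp, ZMod.card]
  by_cases h3 : l * α = 0 <;> by_cases h4 : l * β = 0 <;> simp [h3, h4]; ring


theorem HasPres.powConjCount_eq [Finite G] {m n s t : ℕ} (h : HasPres G m n s t) {k : ℕ}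
    (hk : 2 ≤ k) :
    (powConjCount G k : ℚ) =
      Nat.card G * ∑ e ∈ m.divisors, (e.totient : ℚ) * powConjTerm n s t k e := by
  have hm := h.pos_left
  have hn := h.pos_right
  have hcard := h.card
  have htn := h.pow_modEq_one
  have hst := h.mul_modEq
  have : NeZero m := ⟨hm.ne'⟩
  have hdvd : ∀ (l : ZMod m) (c : ℕ), l * (c : ZMod m) = 0 ↔ addOrderOf l ∣ c := by
    intro l c
    rw [addOrderOf_dvd_iff_nsmul_eq_zero, nsmul_eq_mul, mul_comm]
  have hmod : ∀ (l : ZMod m) (c d : ℕ),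
      l * (c : ZMod m) = l * (d : ZMod m) ↔ c ≡ d [MOD addOrderOf l] := by
    intro l c d
    rw [← nsmul_eq_nsmul_iff_modEq, nsmul_eq_mul, nsmul_eq_mul, mul_comm, mul_comm l]
  have hord : ∀ l : ZMod m, addOrderOf l ∣ m := by
    intro l
    have := addOrderOf_dvd_card (x := l)
    rwa [ZMod.card] at this
  have key : ∀ l : ZMod m, (∑ y ∈ Finset.range n, ∑ w ∈ Finset.range n,
      if n ∣ y * (k - 1) ∧ l * (1 - (t : ZMod m) ^ y) = 0 ∧
        l * ((t : ZMod m) ^ w - ∑ i ∈ Finset.range k, ((t : ZMod m) ^ y) ^ i) = 0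
      then (ZMod.stdAddChar (N := m) (-(l * (s * (y * (k - 1) / n : ℕ)))) : ℂ) else 0) =
        n * (powConjTerm n s t k (addOrderOf l) : ℚ) := by
    intro l
    obtain ⟨e, he⟩ : ∃ e, addOrderOf l = e := ⟨_, rfl⟩
    have hem : e ∣ m := he ▸ hord l
    have htne := htn.of_dvd hem
    have hD : orderOf (t : ZMod e) ∣ n := by
      rw [orderOf_dvd_iff_pow_eq_one]
      have := (ZMod.natCast_eq_natCast_iff _ _ _).2 htne
      simpa using this
    have c1 : ∀ y, l * (1 - (t : ZMod m) ^ y) = 0 ↔ orderOf (t : ZMod e) ∣ y := by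
      intro y
      rw [orderOf_dvd_iff_pow_eq_one, mul_sub, sub_eq_zero]
      have := hmod l (t ^ y) 1
      rw [he, ← ZMod.natCast_eq_natCast_iff] at this
      push_cast at this
      rw [← this, eq_comm]
    have c2 : ∀ y w, l * (1 - (t : ZMod m) ^ y) = 0 →
        (l * ((t : ZMod m) ^ w - ∑ i ∈ Finset.range k, ((t : ZMod m) ^ y) ^ i) = 0 ↔
        t ^ w ≡ k [MOD e]) := by
      intro y w hy
      have hy' : l * (t : ZMod m) ^ y = l := by
        rw [mul_sub, mul_one, sub_eq_zero] at hy; exact hy.symm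
      have hi : ∀ i : ℕ, l * ((t : ZMod m) ^ y) ^ i = l := by
        intro i
        induction i with
        | zero => simp
        | succ i ih => rw [pow_succ, ← mul_assoc, ih, hy']
      have := hmod l (t ^ w) k
      rw [he] at this
      rw [← this, mul_sub, sub_eq_zero, Finset.mul_sum]
      simp_rw [hi]
      simp [mul_comm l]
    have c3 : ∀ y w, (n ∣ y * (k - 1) ∧ l * (1 - (t : ZMod m) ^ y) = 0 ∧
        l * ((t : ZMod m) ^ w - ∑ i ∈ Finset.range k, ((t : ZMod m) ^ y) ^ i) = 0) ↔
        (n ∣ y * (k - 1) ∧ orderOf (t : ZMod e) ∣ y) ∧ t ^ w ≡ k [MOD e] := by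
      intro y w
      rw [and_assoc, ← c1]
      exact and_congr_right fun _ => and_congr_right fun hy => c2 y w hy
    simp_rw [c3, he]
    obtain ⟨h', hh'⟩ : ∃ h', (n / orderOf (t : ZMod e)).gcd (k - 1) = h' := ⟨_, rfl⟩
    have hDpos : 0 < orderOf (t : ZMod e) := Nat.pos_of_dvd_of_pos hD hn
    have hpos : 0 < h' := hh' ▸ Nat.gcd_pos_of_pos_right _ (by omega)
    let ψ : AddChar (ZMod m) ℂ := ZMod.stdAddChar
    let f : ℕ → ℂ := fun q => ψ (-(l * (s * (q : ℕ))))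
    have c4 : ∀ y, (∑ w ∈ Finset.range n, if (n ∣ y * (k - 1) ∧ orderOf (t : ZMod e) ∣ y) ∧
        t ^ w ≡ k [MOD e] then f (y * (k - 1) / n) else 0) =
        if n ∣ y * (k - 1) ∧ orderOf (t : ZMod e) ∣ y then f (y * (k - 1) / n) *
          ((Finset.range n).filter fun w => t ^ w ≡ k [MOD e]).card else 0 := by
      intro y
      split_ifs with hy
      · simp only [hy, and_self, true_and]
        rw [← Finset.sum_filter, Finset.sum_const, nsmul_eq_mul, mul_comm]
      · simp [hy]
    refine (Finset.sum_congr rfl fun y _ => c4 y).trans ?_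
    rw [← Finset.sum_filter, ← Finset.sum_mul, card_filter_pow_modEq hn htne,
      sum_filter_dvd hn hD f, powConjTerm, hh']
    by_cases hj : ∃ j, t ^ j ≡ k [MOD e]
    · rw [if_pos hj]
      simp only [hj, true_and]
      obtain ⟨c, hc⟩ : h' ∣ k - 1 := hh' ▸ Nat.gcd_dvd_right _ _
      have hz : ∀ i, f (i * ((k - 1) / h')) = (ψ (-(l * (s * ((k - 1) / h' : ℕ))))) ^ i := by
        intro i
        rw [← AddChar.map_nsmul_eq_pow]
        simp only [f, nsmul_eq_mul]
        congr 1; push_cast; ring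
      simp_rw [hz]
      have hd1 : e * h' ∣ s * (k - 1) ↔ e ∣ s * ((k - 1) / h') := by
        rw [hc, Nat.mul_div_cancel_left _ hpos, show s * (h' * c) = s * c * h' by ring]
        exact Nat.mul_dvd_mul_iff_right hpos
      have hone : ψ (-(l * (s * ((k - 1) / h' : ℕ)))) = 1 ↔ e * h' ∣ s * (k - 1) := by
        rw [hd1, ← he, ← hdvd, ← AddChar.map_zero_eq_one ψ]
        rw [ZMod.injective_stdAddChar.eq_iff, neg_eq_zero]
        push_cast; rfl
      have hpow : (ψ (-(l * (s * ((k - 1) / h' : ℕ))))) ^ h' = 1 := by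
        rw [← AddChar.map_nsmul_eq_pow, nsmul_eq_mul, hc, Nat.mul_div_cancel_left _ hpos]
        have : (h' : ZMod m) * -(l * (s * (c : ℕ))) = -(l * (s * (k - 1 : ℕ) : ℕ)) := by
          rw [hc]; push_cast; ring
        rw [this]
        have h0 : l * ((s * (k - 1) : ℕ) : ZMod m) = 0 := by
          obtain ⟨j, hj⟩ := hj
          have hsj : s * t ^ j ≡ s [MOD e] := by
            clear hj
            induction j with
            | zero => simpa using Nat.ModEq.refl s
            | succ j ih =>
              rw [pow_succ, ← mul_assoc]
              exact (ih.mul_right t).trans (hst.of_dvd hem)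
          rw [hdvd, he, Nat.mul_sub, mul_one]
          exact (Nat.modEq_iff_dvd' (Nat.le_mul_of_pos_right s (by omega))).1
            (hsj.symm.trans (hj.mul_left s))
        rw [h0, neg_zero, AddChar.map_zero_eq_one]
      rw [sum_range_pow_eq hpow]
      simp only [hone]
      split_ifs
      · push_cast [Nat.cast_div hD (Nat.cast_ne_zero.2 hDpos.ne' :
          ((orderOf (t : ZMod e) : ℕ) : ℂ) ≠ 0)]
        ring
      · simp
    · simp [hj]
  have hsum : ∑ l : ZMod m, powConjTerm n s t k (addOrderOf l) =
      ∑ e ∈ m.divisors, (e.totient : ℚ) * powConjTerm n s t k e := by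
    rw [← Finset.sum_fiberwise_of_maps_to (s := Finset.univ) (t := m.divisors)
      (g := fun l : ZMod m => addOrderOf l)
      (fun l _ => Nat.mem_divisors.2 ⟨hord l, hm.ne'⟩)]
    refine Finset.sum_congr rfl fun e he => ?_
    rw [Finset.sum_congr rfl (g := fun _ => powConjTerm n s t k e)
      (fun l hl => by rw [(Finset.mem_filter.1 hl).2]), Finset.sum_const, nsmul_eq_mul,
      IsAddCyclic.card_addOrderOf_eq_totient]
    rw [ZMod.card]
    exact Nat.dvd_of_mem_divisors he
  rw [← hsum, hcard]
  obtain ⟨a, b, hab⟩ := h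
  have hP := hab.powConjCount_eq_sum (k := k) (by omega)
  have hmC : (m : ℂ) ≠ 0 := Nat.cast_ne_zero.2 hm.ne'
  have h2 : (m : ℂ) * powConjCount G k =
      m * (m * n * ∑ l : ZMod m, (powConjTerm n s t k (addOrderOf l) : ℚ)) := by
    have h4 : ∀ y w, (m : ℂ) * (∑ x : ZMod m, ∑ z : ZMod m,
        if n ∣ y * (k - 1) ∧ z * (1 - (t : ZMod m) ^ y) +
          x * ((t : ZMod m) ^ w - ∑ i ∈ Finset.range k, ((t : ZMod m) ^ y) ^ i) -
          s * (y * (k - 1) / n : ℕ) = 0 then 1 else 0) = m ^ 2 * ∑ l : ZMod m,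
        if n ∣ y * (k - 1) ∧ l * (1 - (t : ZMod m) ^ y) = 0 ∧
          l * ((t : ZMod m) ^ w - ∑ i ∈ Finset.range k, ((t : ZMod m) ^ y) ^ i) = 0
        then (ZMod.stdAddChar (N := m) (-(l * (s * (y * (k - 1) / n : ℕ)))) : ℂ) else 0 := by
      intro y w
      by_cases hy : n ∣ y * (k - 1)
      · simp only [hy, true_and]
        exact sum_sum_ite_eq _ _ _
      · simp [hy]
    rw [hP, Finset.mul_sum]
    simp_rw [Finset.mul_sum (s := Finset.range n), h4, ← Finset.mul_sum]
    push_cast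
    rw [mul_assoc, Finset.mul_sum (a := (n : ℂ)), ← mul_assoc, ← pow_two,
      ← Finset.sum_congr rfl fun l _ => key l]
    congr 1
    symm
    rw [Finset.sum_comm]
    exact Finset.sum_congr rfl fun y _ => Finset.sum_comm
  have h3 := mul_left_cancel₀ hmC h2
  exact_mod_cast h3


end Counting

section HomCount

/-- Pairs parametrizing the homomorphisms to an abelian group `R` from a group presented by
`a ^ m = 1`, `b ^ n = a ^ s`, `b * a * b⁻¹ = a ^ t`. -/
def homPairs (R : Type*) [AddCommGroup R] (m n s t : ℕ) : Set (R × R) :=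
  {p | m • p.1 = 0 ∧ t • p.1 = p.1 ∧ n • p.2 = s • p.1}

theorem HasPres.cyclicHomCount_eq [Finite G] {m n s t : ℕ} (h : HasPres G m n s t) (d : ℕ)
    [NeZero d] : cyclicHomCount G d = Nat.card (homPairs (ZMod d) m n s t) := by
  obtain ⟨a, b, h⟩ := h
  refine Nat.card_congr (Equiv.ofBijective (fun f => ⟨((f a).toAdd, (f b).toAdd), ?_⟩) ⟨?_, ?_⟩)
  · refine ⟨?_, ?_, ?_⟩
    · rw [← toAdd_pow, ← map_pow, ← h.order, pow_orderOf_eq_one, map_one, toAdd_one]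
    · rw [← toAdd_pow, ← map_pow, ← h.conj, map_mul f, map_mul f, map_inv, mul_inv_cancel_comm]
    · rw [← toAdd_pow, ← toAdd_pow, ← map_pow, ← map_pow, h.pow]
  · intro f f' hff
    have h1 : f a = f' a := congrArg (fun p => p.1.1) hff
    have h2 : f b = f' b := congrArg (fun p => p.1.2) hff
    ext g
    obtain ⟨x, y, rfl⟩ := h.form g
    simp [h1, h2]
  · rintro ⟨⟨α, β⟩, h1, h2, h3⟩
    obtain ⟨f, hfa, hfb⟩ := h.exists_hom (a' := Multiplicative.ofAdd α)
      (b' := Multiplicative.ofAdd β) (by rw [← ofAdd_nsmul, h1, ofAdd_zero])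
      (by rw [← ofAdd_nsmul, ← ofAdd_nsmul, h3])
      (by rw [← ofAdd_nsmul, h2, mul_inv_cancel_comm])
    exact ⟨f, Subtype.ext (by simp [hfa, hfb])⟩

theorem card_homPairs_mul {d d' : ℕ} (hd : d.Coprime d') (m n s t : ℕ) :
    Nat.card (homPairs (ZMod (d * d')) m n s t) =
      Nat.card (homPairs (ZMod d) m n s t) * Nat.card (homPairs (ZMod d') m n s t) := by
  let e := (ZMod.chineseRemainder hd).toAddEquiv
  rw [← Nat.card_prod]
  have he : ∀ x y : ZMod (d * d'), x = y ↔ (e x).1 = (e y).1 ∧ (e x).2 = (e y).2 := by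
    intro x y
    rw [← Prod.ext_iff, e.injective.eq_iff]
  refine Nat.card_congr (Equiv.ofBijective (fun p => ⟨⟨((e p.1.1).1, (e p.1.2).1), ?_⟩,
    ⟨((e p.1.1).2, (e p.1.2).2), ?_⟩⟩) ⟨?_, ?_⟩)
  · have := p.2
    simp only [homPairs, Set.mem_ofPred_eq, he, map_nsmul, map_zero] at this
    exact ⟨this.1.1, this.2.1.1, this.2.2.1⟩
  · have := p.2
    simp only [homPairs, Set.mem_ofPred_eq, he, map_nsmul, map_zero] at this
    exact ⟨this.1.2, this.2.1.2, this.2.2.2⟩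
  · intro p q hpq
    simp only [Prod.ext_iff, Subtype.ext_iff] at hpq
    refine Subtype.ext (Prod.ext ((he _ _).2 ⟨hpq.1.1, hpq.2.1⟩) ((he _ _).2 ⟨hpq.1.2, hpq.2.2⟩))
  · rintro ⟨⟨⟨α, β⟩, h1, h2, h3⟩, ⟨⟨α', β'⟩, h1', h2', h3'⟩⟩
    refine ⟨⟨(e.symm (α, α'), e.symm (β, β')), ?_⟩, ?_⟩
    · simp only [homPairs, Set.mem_ofPred_eq, he, map_nsmul, map_zero, AddEquiv.apply_symm_apply]
      exact ⟨⟨h1, h1'⟩, ⟨h2, h2'⟩, ⟨h3, h3'⟩⟩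
    · simp

theorem card_homPairs_of_coprime {u m n : ℕ} [NeZero u] (hm : m.Coprime u) (hn : n.Coprime u)
    (s t : ℕ) : Nat.card (homPairs (ZMod u) m n s t) = 1 := by
  have key : ∀ {c : ℕ} {x : ZMod u}, c.Coprime u → c • x = 0 → x = 0 := by
    intro c x hc hx
    rw [nsmul_eq_mul] at hx
    exact ((ZMod.unitOfCoprime c hc).mul_right_eq_zero).1 (by rwa [ZMod.coe_unitOfCoprime])
  rw [Nat.card_eq_one_iff_unique]
  refine ⟨⟨?_⟩, ⟨⟨(0, 0), by simp [homPairs]⟩⟩⟩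
  have h0 : ∀ p : homPairs (ZMod u) m n s t, p.1 = (0, 0) := by
    rintro ⟨⟨α, β⟩, h1, h2, h3⟩
    have hα := key hm h1
    refine Prod.ext hα (key hn ?_)
    have : α = 0 := hα
    simpa [this] using h3
  intro p q
  exact Subtype.ext ((h0 p).trans (h0 q).symm)

theorem card_homPairs_eq_sq_iff {d : ℕ} [NeZero d] (m n s t : ℕ) :
    Nat.card (homPairs (ZMod d) m n s t) = d ^ 2 ↔ d ∣ m ∧ t ≡ 1 [MOD d] ∧ d ∣ n ∧ d ∣ s := by
  have h1 : Nat.card (ZMod d × ZMod d) = d ^ 2 := by simp [pow_two]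
  have h2 : Nat.card (homPairs (ZMod d) m n s t) = d ^ 2 ↔ ∀ p, p ∈ homPairs (ZMod d) m n s t := by
    rw [← h1, ← Set.eq_univ_iff_forall]
    constructor
    · intro h
      refine Set.eq_of_subset_of_ncard_le (Set.subset_univ _) ?_
      rw [Set.ncard_univ, ← h, ← Nat.card_coe_set_eq]
    · rintro h
      rw [h, Nat.card_univ]
  rw [h2]
  constructor
  · intro h
    obtain ⟨h3, h4, h5⟩ := h (1, 0)
    obtain ⟨h6, h7, h8⟩ := h (0, 1)
    simp only [nsmul_eq_mul, mul_one, mul_zero] at h3 h4 h5 h6 h7 h8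
    refine ⟨(ZMod.natCast_eq_zero_iff _ _).1 h3, ?_, (ZMod.natCast_eq_zero_iff _ _).1 h8,
      (ZMod.natCast_eq_zero_iff _ _).1 h5.symm⟩
    rw [← ZMod.natCast_eq_natCast_iff, h4, Nat.cast_one]
  · rintro ⟨h3, h4, h5, h6⟩ ⟨α, β⟩
    rw [← ZMod.natCast_eq_natCast_iff, Nat.cast_one] at h4
    rw [← ZMod.natCast_eq_zero_iff] at h3 h5 h6
    simp [homPairs, h3, h4, h5, h6]

theorem card_nsmul_eq {d c : ℕ} [NeZero d] (hc : c ∣ d) (y : ZMod d) (hy : (d / c) • y = 0) :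
    Nat.card {x : ZMod d // c • x = y} = c := by
  obtain ⟨d', rfl⟩ := hc
  have hd : 0 < c * d' := Nat.pos_of_ne_zero (NeZero.ne _)
  have hcpos : 0 < c := Nat.pos_of_mul_pos_right hd
  rw [Nat.mul_div_cancel_left _ hcpos] at hy
  have hd' : 0 < d' := Nat.pos_of_mul_pos_left hd
  obtain ⟨y, rfl⟩ := ZMod.natCast_zmod_surjective y
  rw [nsmul_eq_mul, ← Nat.cast_mul, ZMod.natCast_eq_zero_iff, mul_comm d'] at hy
  obtain ⟨z, rfl⟩ := Nat.dvd_of_mul_dvd_mul_right hd' hy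
  have h1 : Nat.card {x : ZMod (c * d') // c • x = (c * z : ℕ)} =
      Nat.card {x : ZMod (c * d') // c • x = 0} := by
    refine Nat.card_congr ((Equiv.subRight (z : ZMod (c * d'))).subtypeEquiv fun x => ?_)
    simp [mul_sub, sub_eq_zero]
  rw [h1]
  have := IsAddCyclic.card_nsmulAddMonoidHom_ker (G := ZMod (c * d')) c
  rw [Nat.card_zmod, Nat.gcd_eq_right (Dvd.intro _ rfl)] at this
  exact this

theorem card_homPairs_of_dvd {d m n s t : ℕ} [NeZero d] (hd : m * n ∣ d) (hn : 0 < n)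
    (ht : 1 ≤ t) : Nat.card (homPairs (ZMod d) m n s t) = n * m.gcd (t - 1) := by
  have hg : ∀ α : ZMod d, (m • α = 0 ∧ t • α = α) ↔ m.gcd (t - 1) • α = 0 := by
    intro α
    have : t • α = α ↔ (t - 1) • α = 0 := by
      conv_lhs => rw [← Nat.sub_add_cancel ht, add_nsmul, one_nsmul]
      simp
    rw [this, ← addOrderOf_dvd_iff_nsmul_eq_zero, ← addOrderOf_dvd_iff_nsmul_eq_zero,
      ← addOrderOf_dvd_iff_nsmul_eq_zero, Nat.dvd_gcd_iff]
  have hmd : m ∣ d / n := by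
    obtain ⟨c, rfl⟩ := hd
    exact ⟨c, Nat.div_eq_of_eq_mul_left hn (by ring)⟩
  let e : homPairs (ZMod d) m n s t ≃
      Σ α : {α : ZMod d // m.gcd (t - 1) • α = 0}, {β : ZMod d // n • β = s • α.1} :=
    { toFun := fun p => ⟨⟨p.1.1, (hg _).1 ⟨p.2.1, p.2.2.1⟩⟩, ⟨p.1.2, p.2.2.2⟩⟩
      invFun := fun p => ⟨(p.1.1, p.2.1), ((hg _).2 p.1.2).1, ((hg _).2 p.1.2).2, p.2.2⟩
      left_inv := fun _ => rfl
      right_inv := fun _ => rfl }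
  rw [Nat.card_congr e, Nat.card_sigma]
  have h1 : ∀ α : {α : ZMod d // m.gcd (t - 1) • α = 0},
      Nat.card {β : ZMod d // n • β = s • α.1} = n := by
    intro α
    refine card_nsmul_eq (dvd_of_mul_left_dvd hd) _ ?_
    obtain ⟨c, hc⟩ := hmd
    rw [hc, mul_comm, mul_nsmul', smul_comm m s, ((hg _).2 α.2).1, smul_zero, smul_zero]
  simp_rw [h1]
  rw [Finset.sum_const, Finset.card_univ, ← Nat.card_eq_fintype_card, smul_eq_mul,
    card_nsmul_eq (((Nat.gcd_dvd_left _ _).trans (dvd_of_mul_right_dvd hd))) 0 (smul_zero _),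
    mul_comm]

variable {H : Type*} [Group H]

theorem HasPres.mul_gcd_eq [Finite G] [Finite H] (e : MonoidAlgebra ℚ G ≃ₐ[ℚ] MonoidAlgebra ℚ H)
    {m n s t m' n' s' t' : ℕ} (h : HasPres G m n s t) (h' : HasPres H m' n' s' t')
    (ht : 1 ≤ t) (ht' : 1 ≤ t') : n * m.gcd (t - 1) = n' * m'.gcd (t' - 1) := by
  have hcard := card_eq_of_algEquiv e
  have hpos : 0 < Nat.card G := Nat.card_pos
  obtain ⟨k, hk, hkc, -, hF⟩ := exists_exponent e (Nat.card G) (fun _ => 1)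
    (fun p hp hd => (Nat.prime_of_mem_primeFactors hp).one_lt.ne' (Nat.dvd_one.1 hd))
  have : NeZero (k - 1) := ⟨by omega⟩
  have hdvd : Nat.card G ∣ k - 1 := by
    rw [← Nat.factorization_le_iff_dvd hpos.ne' (by omega)]
    intro p
    by_cases hp : p ∈ (Nat.card G).primeFactors
    · have hpp := Nat.prime_of_mem_primeFactors hp
      have h1 : p ^ Nat.card G ∣ k - 1 := (Nat.modEq_iff_dvd' (by omega)).1 (hkc p hp).symm
      refine (Nat.factorization_lt p hpos.ne').le.trans ?_
      exact (hpp.pow_dvd_iff_le_factorization (by omega)).1 h1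
    · rw [Finsupp.notMem_support_iff.1 hp]
      exact Nat.zero_le _
  rw [h.cyclicHomCount_eq, h'.cyclicHomCount_eq,
    card_homPairs_of_dvd (by rwa [← h.card]) h.pos_right ht,
    card_homPairs_of_dvd (by rwa [← h'.card, ← hcard]) h'.pos_right ht'] at hF
  exact hF

theorem factorization_sub_one_eq {q k v N : ℕ} (hq : q.Prime) (hk : 2 ≤ k) (hv : v < N)
    (h : k ≡ 1 + q ^ v [MOD q ^ N]) : (k - 1).factorization q = v := by
  have h1 : k - 1 ≡ q ^ v [MOD q ^ N] := by
    refine Nat.ModEq.add_right_cancel' 1 ?_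
    rwa [Nat.sub_add_cancel (by omega), add_comm (q ^ v)]
  refine le_antisymm ?_ ?_
  · by_contra! hlt
    have h2 : q ^ (v + 1) ∣ k - 1 := (hq.pow_dvd_iff_le_factorization (by omega)).2 hlt
    have h3 : q ^ (v + 1) ∣ q ^ v := ((h1.of_dvd (pow_dvd_pow q hv)).dvd_iff dvd_rfl).1 h2
    exact absurd ((Nat.pow_dvd_pow_iff_le_right hq.one_lt).1 h3) (by omega)
  · rw [← hq.pow_dvd_iff_le_factorization (by omega)]
    exact ((h1.of_dvd (pow_dvd_pow q hv.le)).dvd_iff dvd_rfl).2 dvd_rfl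

theorem HasPres.card_homPairs_eq [Finite G] [Finite H]
    (e : MonoidAlgebra ℚ G ≃ₐ[ℚ] MonoidAlgebra ℚ H)
    {m n s t m' n' s' t' : ℕ} (h : HasPres G m n s t) (h' : HasPres H m' n' s' t') {D : ℕ}
    (hD0 : 0 < D) (hD : ∀ q, q.Prime → q ∣ D → q ∣ Nat.card G) (h2 : 2 ∣ Nat.card G → 2 ∣ D) :
    Nat.card (homPairs (ZMod D) m n s t) = Nat.card (homPairs (ZMod D) m' n' s' t') := by
  have hcard := card_eq_of_algEquiv e
  obtain ⟨k, hk, hkc, -, hF⟩ := exists_exponent e (D + 1) (fun q => 1 + q ^ D.factorization q) (by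
    intro q hq hd
    have hqp := Nat.prime_of_mem_primeFactors hq
    rcases Nat.eq_zero_or_pos (D.factorization q) with h0 | h0
    · rw [h0, pow_zero] at hd
      obtain rfl := (Nat.prime_dvd_prime_iff_eq hqp Nat.prime_two).1 hd
      exact (Nat.prime_two.factorization_pos_of_dvd hD0.ne'
        (h2 (Nat.dvd_of_mem_primeFactors hq))).ne' h0
    · exact hqp.one_lt.ne' (Nat.dvd_one.1 ((Nat.dvd_add_left (dvd_pow_self q h0.ne')).1 hd)))
  have hv : ∀ q ∈ (Nat.card G).primeFactors, (k - 1).factorization q = D.factorization q := by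
    intro q hq
    exact factorization_sub_one_eq (Nat.prime_of_mem_primeFactors hq) hk
      ((Nat.factorization_lt q hD0.ne').trans (Nat.lt_succ_self D)) (hkc q hq)
  have hmem : ∀ q, q.Prime → q ∣ Nat.card G → q ∈ (Nat.card G).primeFactors :=
    fun q hq hd => Nat.mem_primeFactors.2 ⟨hq, hd, Nat.card_pos.ne'⟩
  have hdvd : D ∣ k - 1 := by
    rw [← Nat.factorization_le_iff_dvd hD0.ne' (by omega)]
    intro q
    by_cases hq : q.Prime ∧ q ∣ D
    · rw [hv q (hmem q hq.1 (hD q hq.1 hq.2))]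
    · have : D.factorization q = 0 := by
        by_contra h0
        exact hq ⟨Nat.prime_of_mem_primeFactors (Finsupp.mem_support_iff.2 h0),
          Nat.dvd_of_mem_primeFactors (Finsupp.mem_support_iff.2 h0)⟩
      rw [this]; exact Nat.zero_le _
  obtain ⟨u, hu⟩ := hdvd
  have hu0 : u ≠ 0 := by rintro rfl; omega
  have hucop : (Nat.card G).Coprime u := by
    refine Nat.coprime_of_dvd fun q hq hqG hqu => ?_
    have := hv q (hmem q hq hqG)
    rw [hu, Nat.factorization_mul hD0.ne' hu0, Finsupp.add_apply] at this
    exact (hq.factorization_pos_of_dvd hu0 hqu).ne' (by omega)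
  have hDu : D.Coprime u :=
    Nat.coprime_of_dvd fun q hq hqD hqu => hq.one_lt.ne'
      (Nat.dvd_one.1 (hucop ▸ Nat.dvd_gcd (hD q hq hqD) hqu))
  have : NeZero (D * u) := ⟨(Nat.mul_pos hD0 (Nat.pos_of_ne_zero hu0)).ne'⟩
  have : NeZero u := ⟨hu0⟩
  have c1 : m.Coprime u := Nat.Coprime.coprime_dvd_left (h.card ▸ Dvd.intro _ rfl) hucop
  have c2 : n.Coprime u := Nat.Coprime.coprime_dvd_left (h.card ▸ Dvd.intro_left _ rfl) hucop
  have c3 : m'.Coprime u :=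
    Nat.Coprime.coprime_dvd_left (hcard ▸ h'.card ▸ Dvd.intro _ rfl) hucop
  have c4 : n'.Coprime u :=
    Nat.Coprime.coprime_dvd_left (hcard ▸ h'.card ▸ Dvd.intro_left _ rfl) hucop
  rw [hu, h.cyclicHomCount_eq, h'.cyclicHomCount_eq, card_homPairs_mul hDu, card_homPairs_mul hDu,
    card_homPairs_of_coprime c1 c2, card_homPairs_of_coprime c3 c4] at hF
  simpa using hF

theorem HasPres.pow_dvd_and_iff [Finite G] [Finite H]
    (e : MonoidAlgebra ℚ G ≃ₐ[ℚ] MonoidAlgebra ℚ H)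
    {m n s t m' n' s' t' : ℕ} (h : HasPres G m n s t) (h' : HasPres H m' n' s' t')
    {p : ℕ} (hp : p.Prime) (j : ℕ) :
    (p ^ j ∣ m ∧ t ≡ 1 [MOD p ^ j] ∧ p ^ j ∣ n ∧ p ^ j ∣ s) ↔
      (p ^ j ∣ m' ∧ t' ≡ 1 [MOD p ^ j] ∧ p ^ j ∣ n' ∧ p ^ j ∣ s') := by
  have : NeZero (p ^ j) := ⟨(pow_pos hp.pos j).ne'⟩
  have hcard := card_eq_of_algEquiv e
  rcases Nat.eq_zero_or_pos j with rfl | hj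
  · simp [Nat.modEq_one]
  by_cases hpG : p ∣ Nat.card G
  · rw [← card_homPairs_eq_sq_iff, ← card_homPairs_eq_sq_iff]
    have key : Nat.card (homPairs (ZMod (p ^ j)) m n s t) =
        Nat.card (homPairs (ZMod (p ^ j)) m' n' s' t') := by
      have hpj : ∀ q, q.Prime → q ∣ p ^ j → q ∣ Nat.card G := fun q hq hd =>
        (hq.dvd_of_dvd_pow hd).trans hpG
      by_cases h2 : 2 ∣ Nat.card G ∧ p ≠ 2
      · have hcop : (2 : ℕ).Coprime (p ^ j) := Nat.Coprime.pow_right _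
          ((Nat.coprime_primes Nat.prime_two hp).2 h2.2.symm)
        have h3 := h.card_homPairs_eq e h' (D := 2) two_pos
          (fun q _ hd => hd.trans h2.1) (fun _ => dvd_rfl)
        have h4 := h.card_homPairs_eq e h' (D := 2 * p ^ j) (Nat.mul_pos two_pos (pow_pos hp.pos j))
          (fun q hq hd => (hq.dvd_mul.1 hd).elim (fun hd => hd.trans h2.1) (hpj q hq))
          (fun _ => Dvd.intro _ rfl)
        rw [card_homPairs_mul hcop, card_homPairs_mul hcop, h3] at h4
        refine Nat.eq_of_mul_eq_mul_left ?_ h4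
        have : Nonempty (homPairs (ZMod 2) m' n' s' t') := ⟨⟨0, by simp [homPairs]⟩⟩
        exact Nat.card_pos
      · refine h.card_homPairs_eq e h' (pow_pos hp.pos j) hpj fun h2' => ?_
        have : p = 2 := by_contra fun h3 => h2 ⟨h2', h3⟩
        rw [this]
        exact dvd_pow_self 2 hj.ne'
    rw [key]
  · have hpj : p ∣ p ^ j := dvd_pow_self p hj.ne'
    constructor
    · rintro ⟨h1, -⟩
      exact absurd (h.card ▸ (hpj.trans h1).mul_right n) hpG
    · rintro ⟨h1, -⟩
      exact absurd (hcard ▸ h'.card ▸ (hpj.trans h1).mul_right n') hpG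

end HomCount

section Arithmetic

theorem modEq_of_forall_prime_pow {M a b : ℕ}
    (h : ∀ ℓ k, ℓ.Prime → ℓ ^ k ∣ M → 0 < k → a ≡ b [MOD ℓ ^ k]) : a ≡ b [MOD M] := by
  rw [Nat.modEq_iff_dvd, Int.natCast_dvd, Nat.dvd_iff_prime_pow_dvd_dvd]
  intro ℓ k hℓ hk
  rcases Nat.eq_zero_or_pos k with rfl | hk0
  · simp
  · rw [← Int.natCast_dvd, ← Nat.modEq_iff_dvd]
    exact h ℓ k hℓ hk hk0

theorem geomSum_modEq {τ M : ℕ} (h : τ ≡ 1 [MOD M]) (L : ℕ) :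
    ∑ k ∈ Finset.range L, τ ^ k ≡ L [MOD M] := by
  induction L with
  | zero => rfl
  | succ L ih =>
    rw [Finset.sum_range_succ]
    simpa using ih.add (h.pow L)

theorem geomSum_one_add_modEq (u l : ℕ) :
    ∑ k ∈ Finset.range l, (1 + u) ^ k ≡ l + u * l.choose 2 [MOD u ^ 2] := by
  have hpow : ∀ k, (1 + u) ^ k ≡ 1 + k * u [MOD u ^ 2] := by
    intro k
    induction k with
    | zero => simp [Nat.ModEq.refl]
    | succ k ih =>
      rw [pow_succ]
      refine (ih.mul_right _).trans ?_
      rw [show (1 + k * u) * (1 + u) = 1 + (k + 1) * u + u ^ 2 * k by ring]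
      simp [Nat.ModEq]
  induction l with
  | zero => rfl
  | succ l ih =>
    rw [Finset.sum_range_succ]
    refine (ih.add (hpow l)).trans ?_
    rw [Nat.choose_succ_succ' l 1, Nat.choose_one_right]
    have : l + u * l.choose 2 + (1 + l * u) = l + 1 + u * (l + l.choose 2) := by ring
    rw [this]

theorem pow_modEq_one_of_dvd {p r e t y : ℕ} (hr : 1 ≤ r) (h : t ≡ 1 [MOD p ^ r])
    (hy : p ^ e ∣ y) : t ^ y ≡ 1 [MOD p ^ (r + e)] := by
  have key : t ^ p ^ e ≡ 1 [MOD p ^ (r + e)] := by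
    induction e generalizing y with
    | zero => simpa using h
    | succ e ih =>
      have h1 := ih (dvd_refl _)
      have h2 : (p : ℤ) ∣ ∑ k ∈ Finset.range p, ((t ^ p ^ e : ℕ) : ℤ) ^ k := by
        have := geomSum_modEq (h1.of_dvd (dvd_pow_self p (by omega))) p
        have := (this.dvd_iff dvd_rfl).2 dvd_rfl
        exact_mod_cast this
      have h3 := (mul_geom_sum ((t ^ p ^ e : ℕ) : ℤ) p)
      have h4 : (p : ℤ) ^ (r + e) ∣ ((t ^ p ^ e : ℕ) : ℤ) - 1 := by
        have := (Nat.modEq_iff_dvd.1 h1.symm)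
        exact_mod_cast this
      have h5 := mul_dvd_mul h4 h2
      rw [h3, ← pow_succ] at h5
      refine (Nat.modEq_iff_dvd.2 ?_).symm
      rw [pow_succ p e, pow_mul]
      push_cast at h5 ⊢
      exact h5
  obtain ⟨c, rfl⟩ := hy
  rw [pow_mul]
  simpa using key.pow c

theorem geomSum_mul (t a b : ℕ) : ∑ k ∈ Finset.range (a * b), t ^ k =
    (∑ k ∈ Finset.range a, t ^ k) * ∑ k ∈ Finset.range b, (t ^ a) ^ k := by
  induction b with
  | zero => simp
  | succ b ih =>
    rw [Nat.mul_succ, Finset.sum_range_add, ih, Finset.sum_range_succ, mul_add, ← pow_mul]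
    congr 1
    rw [Finset.sum_mul]
    exact Finset.sum_congr rfl fun k _ => by rw [pow_add, mul_comm]

theorem factorization_geomSum {p t n : ℕ} (hp : p.Prime) (ht : t ≡ 1 [MOD p])
    (h : p ≠ 2 ∨ t ≡ 1 [MOD 4] ∨ ¬ p ∣ n) (hn : 0 < n) (ht0 : 1 ≤ t) :
    (∑ k ∈ Finset.range n, t ^ k).factorization p = n.factorization p := by
  induction n using Nat.strong_induction_on with
  | _ n ih =>
    by_cases hpn : p ∣ n
    · obtain ⟨l, rfl⟩ := hpn
      have hl : 0 < l := Nat.pos_of_mul_pos_left hn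
      have hdvd : p ∣ p * l := dvd_mul_right p l
      have h' : p ≠ 2 ∨ t ≡ 1 [MOD 4] := by tauto
      have h1 := ih l (by nlinarith [hp.two_le]) (h'.elim Or.inl fun h => Or.inr (Or.inl h)) hl
      have htl : 1 ≤ t ^ l := Nat.one_le_pow _ _ ht0
      obtain ⟨u, hu⟩ := Nat.exists_eq_add_of_le htl
      have hpu : p ∣ u := by
        have := (ht.pow l).symm
        rw [hu, one_pow] at this
        simpa using (Nat.modEq_iff_dvd' (by omega)).1 this
      have hpu2 : p ^ 2 ∣ u * p.choose 2 := by
        by_cases hp2 : p = 2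
        · subst hp2
          have := ((h'.resolve_left (by simp)).pow l).symm
          rw [hu, one_pow] at this
          exact ((by simpa using (Nat.modEq_iff_dvd' (by omega)).1 this : 4 ∣ u)).mul_right _
        · rw [sq]
          exact mul_dvd_mul hpu (hp.dvd_choose_self (by norm_num)
            (lt_of_le_of_ne hp.two_le (Ne.symm hp2)))
      have hS : ∑ k ∈ Finset.range p, (t ^ l) ^ k ≡ p [MOD p ^ 2] := by
        rw [hu]
        refine ((geomSum_one_add_modEq u p).of_dvd (pow_dvd_pow_of_dvd hpu 2)).trans ?_
        simpa using (Nat.ModEq.refl p).add (Nat.modEq_zero_iff_dvd.2 hpu2)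
      have hSp : p ∣ ∑ k ∈ Finset.range p, (t ^ l) ^ k :=
        ((hS.of_dvd (dvd_pow_self p two_ne_zero)).dvd_iff dvd_rfl).2 dvd_rfl
      have hSp2 : ¬ p ^ 2 ∣ ∑ k ∈ Finset.range p, (t ^ l) ^ k := fun hd => by
        have := Nat.le_of_dvd hp.pos ((hS.dvd_iff dvd_rfl).1 hd)
        nlinarith [hp.two_le]
      have hS0 : ∑ k ∈ Finset.range p, (t ^ l) ^ k ≠ 0 := fun h0 => hSp2 (h0 ▸ dvd_zero _)
      have hS1 : (∑ k ∈ Finset.range p, (t ^ l) ^ k).factorization p = 1 := by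
        have h2 := (hp.dvd_iff_one_le_factorization hS0).1 hSp
        have h3 := mt (hp.pow_dvd_iff_le_factorization hS0).2 hSp2
        omega
      have hT0 : ∑ k ∈ Finset.range l, t ^ k ≠ 0 := by
        refine (Finset.sum_pos (fun k _ => Nat.pow_pos ht0) ?_).ne'
        simpa using hl.ne'
      rw [mul_comm p l, geomSum_mul, Nat.factorization_mul hT0 hS0,
        Nat.factorization_mul hl.ne' hp.ne_zero, Finsupp.add_apply, Finsupp.add_apply, h1, hS1,
        hp.factorization_self]
    · rw [Nat.factorization_eq_zero_of_not_dvd hpn]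
      refine Nat.factorization_eq_zero_of_not_dvd fun hd => hpn ?_
      exact ((geomSum_modEq ht n).dvd_iff dvd_rfl).1 hd

theorem pow_modEq_one_iff {p t y x : ℕ} (hp : p.Prime) (ht : t ≡ 1 [MOD p])
    (h : p ≠ 2 ∨ t ≡ 1 [MOD 4] ∨ ¬ p ∣ y) (hy : 0 < y) (ht1 : 1 < t) :
    t ^ y ≡ 1 [MOD p ^ x] ↔ x ≤ (t - 1).factorization p + y.factorization p := by
  have hS0 : ∑ k ∈ Finset.range y, t ^ k ≠ 0 := by
    refine (Finset.sum_pos (fun k _ => Nat.pow_pos (by omega)) ?_).ne'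
    simpa using hy.ne'
  have hmul : (t - 1) * ∑ k ∈ Finset.range y, t ^ k = t ^ y - 1 := by
    zify [ht1.le, Nat.one_le_pow y t (by omega)]
    exact mul_geom_sum _ _
  have hne : (t - 1) * ∑ k ∈ Finset.range y, t ^ k ≠ 0 := mul_ne_zero (by omega) hS0
  rw [Nat.ModEq.comm, Nat.modEq_iff_dvd' (Nat.one_le_pow y t (by omega)), ← hmul,
    hp.pow_dvd_iff_le_factorization hne, Nat.factorization_mul (by omega) hS0, Finsupp.add_apply,
    factorization_geomSum hp ht h hy ht1.le]

theorem exists_pow_modEq {p t u r : ℕ} (hp : p.Prime) (hr : 1 ≤ r) (ht0 : 1 ≤ t)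
    (ht : t ≡ 1 [MOD p ^ r]) (ht' : ¬ t ≡ 1 [MOD p ^ (r + 1)]) (h2 : p ≠ 2 ∨ 2 ≤ r)
    (hu : u ≡ 1 [MOD p ^ r]) (x : ℕ) : ∃ i, t ^ i ≡ u [MOD p ^ x] := by
  have htp : t ≡ 1 [MOD p] := ht.of_dvd (dvd_pow_self p (by omega))
  have ht1 : 1 < t := lt_of_le_of_ne ht0 fun h => ht' (h ▸ Nat.ModEq.refl _)
  have h4 : p ≠ 2 ∨ t ≡ 1 [MOD 4] := by
    rcases eq_or_ne p 2 with rfl | hp2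
    · exact Or.inr (ht.of_dvd (pow_dvd_pow 2 (h2.resolve_left (by simp))))
    · exact Or.inl hp2
  have hfac : (t - 1).factorization p = r := by
    have h1 := fun x => pow_modEq_one_iff (x := x) (y := 1) hp htp
      (h4.imp_right Or.inl) one_pos ht1
    simp only [pow_one, Nat.factorization_one, Finsupp.coe_zero, Pi.zero_apply, add_zero] at h1
    have := (h1 r).1 ht
    have := mt (h1 (r + 1)).2 ht'
    omega
  suffices H : ∀ k, ∃ i, t ^ i ≡ u [MOD p ^ (r + k)] by
    obtain ⟨i, hi⟩ := H x
    exact ⟨i, hi.of_dvd (pow_dvd_pow p (by omega))⟩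
  intro k
  induction k with
  | zero => exact ⟨0, by simpa using hu.symm⟩
  | succ k ih =>
    obtain ⟨i, hi⟩ := ih
    have hT := fun x => pow_modEq_one_iff (x := x) (y := p ^ k) hp htp
      (h4.imp_right Or.inl) (Nat.pow_pos hp.pos) ht1
    simp only [hfac, hp.factorization_pow, Finsupp.single_eq_same] at hT
    obtain ⟨w, hw⟩ := (Nat.modEq_iff_dvd.1 ((hT (r + k)).2 le_rfl).symm)
    obtain ⟨d, hd⟩ := Nat.modEq_iff_dvd.1 hi
    have hpw : ¬ (p : ℤ) ∣ w := fun ⟨c, hc⟩ => by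
      have := (hT (r + k + 1)).1 (Nat.modEq_iff_dvd.2 ⟨c, by
        rw [hw, hc]; push_cast; ring⟩).symm
      omega
    have hcop : IsCoprime (w : ℤ) p :=
      ((Nat.prime_iff_prime_int.1 hp).coprime_iff_not_dvd.2 hpw).symm
    obtain ⟨x, y, hxy⟩ := hcop
    have : NeZero p := ⟨hp.ne_zero⟩
    set j := ((x * d : ℤ) : ZMod p).val with hj
    have hjp : ((j : ℕ) : ZMod p) = (x : ZMod p) * d := by
      rw [hj, ZMod.natCast_zmod_val, Int.cast_mul]
    have hxy' : (x : ZMod p) * w = 1 := by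
      have := congrArg (Int.cast : ℤ → ZMod p) hxy
      simpa using this
    have htp' : (t : ZMod p) = 1 := by
      simpa using (ZMod.natCast_eq_natCast_iff t 1 p).2 htp
    refine ⟨i + p ^ k * j, ?_⟩
    have hgeom := mul_geom_sum ((t : ℤ) ^ p ^ k) j
    push_cast at hw hd
    rw [show (t : ℤ) ^ p ^ k - 1 = (p : ℤ) ^ (r + k) * w from hw] at hgeom
    have hdiv : (p : ℤ) ∣ d - t ^ i * (w * ∑ l ∈ Finset.range j, ((t : ℤ) ^ p ^ k) ^ l) := by
      rw [← ZMod.intCast_zmod_eq_zero_iff_dvd]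
      push_cast
      rw [htp']
      simp only [one_pow, Finset.sum_const, Finset.card_range, nsmul_eq_mul, mul_one, hjp]
      linear_combination (-(d : ZMod p)) * hxy'
    rw [Nat.modEq_iff_dvd]
    push_cast
    have : (u : ℤ) - t ^ (i + p ^ k * j) = p ^ (r + k) *
        (d - t ^ i * (w * ∑ l ∈ Finset.range j, ((t : ℤ) ^ p ^ k) ^ l)) := by
      rw [pow_add, pow_mul]
      linear_combination hd + (t : ℤ) ^ i * hgeom
    rw [this, ← add_assoc, pow_succ]
    exact mul_dvd_mul_left _ hdiv

theorem modEq_neg_one_of_pow {t j x : ℕ} (hx : 2 ≤ x) (h : 2 ^ x ∣ t ^ j + 1) : 2 ^ x ∣ t + 1 := by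
  have hodd : ¬ 2 ∣ j := by
    rintro ⟨i, rfl⟩
    have h4 : 4 ∣ t ^ (2 * i) + 1 := (pow_dvd_pow 2 hx).trans h
    rw [mul_comm, pow_mul] at h4
    have : t ^ i % 4 < 4 := Nat.mod_lt _ (by norm_num)
    rw [Nat.dvd_iff_mod_eq_zero, Nat.add_mod, Nat.pow_mod] at h4
    interval_cases t ^ i % 4 <;> simp at h4
  have hj : Odd j := by rwa [← Nat.not_even_iff_odd, even_iff_two_dvd]
  have ht : Odd t := by
    rw [← Nat.not_even_iff_odd]
    intro he
    have : 2 ∣ t ^ j + 1 := (dvd_pow_self 2 (by omega)).trans h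
    rw [← even_iff_two_dvd, Nat.even_add_one] at this
    exact this (he.pow_of_ne_zero (by rintro rfl; simp at hodd))
  have h1 : (2 : ℤ) ^ x ∣ (∑ k ∈ Finset.range j, (-(t : ℤ)) ^ k) * ((-(t : ℤ)) - 1) := by
    rw [geom_sum_mul, hj.neg_pow]
    have : (2 : ℤ) ^ x ∣ (t : ℤ) ^ j + 1 := by exact_mod_cast h
    rw [show -(t : ℤ) ^ j - 1 = -((t : ℤ) ^ j + 1) by ring]
    exact this.neg_right
  have h2 : IsCoprime ((2 : ℤ) ^ x) (∑ k ∈ Finset.range j, (-(t : ℤ)) ^ k) := by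
    refine IsCoprime.pow_left ?_
    refine (Int.prime_two.coprime_iff_not_dvd).2 fun hd => hodd ?_
    have h5 : (2 : ℤ) ∣ ∑ k ∈ Finset.range j, ((-(t : ℤ)) ^ k - 1) := by
      refine Finset.dvd_sum fun k _ => ?_
      have h6 : (2 : ℤ) ∣ -(t : ℤ) - 1 := by
        obtain ⟨c, rfl⟩ := ht
        exact ⟨-c - 1, by push_cast; ring⟩
      simpa using h6.trans (sub_dvd_pow_sub_pow (-(t : ℤ)) 1 k)
    rw [Finset.sum_sub_distrib] at h5
    have := (dvd_sub_right hd).1 h5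
    simp only [Finset.sum_const, Finset.card_range, nsmul_eq_mul, mul_one] at this
    exact_mod_cast this
  have h3 := h2.dvd_of_dvd_mul_left h1
  have h4 : (2 : ℤ) ^ x ∣ (t : ℤ) + 1 := by
    rw [show (t : ℤ) + 1 = -(-(t : ℤ) - 1) by ring]
    exact h3.neg_right
  exact_mod_cast h4

theorem exists_coprime_modEq {j D N : ℕ} (hj : j.Coprime D) (hD : D ∣ N) (hN : 0 < N) :
    ∃ j', j' ≡ j [MOD D] ∧ j'.Coprime N := by
  have : NeZero N := ⟨hN.ne'⟩
  obtain ⟨u, hu⟩ := ZMod.unitsMap_surjective hD (ZMod.unitOfCoprime j hj)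
  refine ⟨(u : ZMod N).val, ?_, ZMod.val_coe_unit_coprime u⟩
  rw [← ZMod.natCast_eq_natCast_iff]
  have := congrArg Units.val hu
  rw [ZMod.unitsMap_val, ZMod.coe_unitOfCoprime] at this
  rw [← this, ← ZMod.natCast_val]

theorem orderOf_natCast_dvd_iff {t c y : ℕ} : orderOf (t : ZMod c) ∣ y ↔ t ^ y ≡ 1 [MOD c] := by
  rw [orderOf_dvd_iff_pow_eq_one, ← ZMod.natCast_eq_natCast_iff]
  push_cast
  rfl

theorem orderOf_natCast_dvd_mul {t c M : ℕ}
    (hc : ∀ ℓ k, ℓ.Prime → ℓ ∣ c → ℓ ^ k ∣ M → ℓ ^ k ∣ c)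
    (h1 : ∀ ℓ, ℓ.Prime → ℓ ∣ M → ¬ ℓ ∣ c → t ≡ 1 [MOD ℓ]) :
    orderOf (t : ZMod M) ∣ orderOf (t : ZMod c) * M := by
  rw [orderOf_natCast_dvd_iff]
  refine modEq_of_forall_prime_pow fun ℓ k hℓ hk hk0 => ?_
  by_cases h : ℓ ∣ c
  · have := (orderOf_natCast_dvd_iff (t := t) (c := c)).1 dvd_rfl
    rw [pow_mul]
    simpa using (this.of_dvd (hc ℓ k hℓ h hk)).pow M
  · have hℓM : ℓ ∣ M := (dvd_pow_self ℓ hk0.ne').trans hk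
    have := pow_modEq_one_of_dvd (r := 1) (e := k - 1) (y := orderOf (t : ZMod c) * M) le_rfl
      (by simpa using h1 ℓ hℓ hℓM h) (((pow_dvd_pow ℓ (by omega)).trans hk).mul_left _)
    rwa [show 1 + (k - 1) = k by omega] at this

end Arithmetic

section Minimal

theorem exists_mul_modEq {a M : ℕ} (b : ℕ) (h : a.Coprime M) (hM : 0 < M) :
    ∃ x, a * x ≡ b [MOD M] := by
  have : NeZero M := ⟨hM.ne'⟩
  refine ⟨((a : ZMod M)⁻¹ * b).val, ?_⟩
  rw [← ZMod.natCast_eq_natCast_iff, Nat.cast_mul, ZMod.natCast_zmod_val, ← mul_assoc,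
    ZMod.coe_mul_inv_eq_one a h, one_mul]

theorem mul_pow_dvd_of_factorization_le {p D n e : ℕ} (hp : p.Prime) (hD : D ∣ n) (hn : 0 < n)
    (h : D.factorization p + e ≤ n.factorization p) : D * p ^ e ∣ n := by
  have hD0 : D ≠ 0 := (Nat.pos_of_dvd_of_pos hD hn).ne'
  rw [← Nat.factorization_le_iff_dvd (mul_ne_zero hD0 (pow_ne_zero _ hp.ne_zero)) hn.ne',
    Nat.factorization_mul hD0 (pow_ne_zero _ hp.ne_zero), hp.factorization_pow]
  intro q
  rw [Finsupp.add_apply, Finsupp.single_apply]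
  split_ifs with hq
  · exact hq ▸ h
  · simpa using (Nat.factorization_le_iff_dvd hD0 hn.ne').2 hD q

theorem exists_eq_pow_mul {p m : ℕ} (hp : p.Prime) (hm : 0 < m) :
    ∃ M, m = p ^ m.factorization p * M ∧ ¬ p ∣ M ∧ 0 < M :=
  ⟨_, (Nat.ordProj_mul_ordCompl_eq_self m p).symm, Nat.not_dvd_ordCompl hp hm.ne',
    Nat.ordCompl_pos p hm.ne'⟩

/-- `c` is the part of `m` supported on the primes modulo which `t` is nontrivial. -/
structure IsActPart (c m t : ℕ) : Prop where
  dvd : c ∣ m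
  pow_dvd : ∀ ℓ k, ℓ.Prime → ℓ ∣ c → ℓ ^ k ∣ m → ℓ ^ k ∣ c
  modEq_one : ∀ ℓ, ℓ.Prime → ℓ ∣ m → ¬ ℓ ∣ c → t ≡ 1 [MOD ℓ]
  not_modEq_one : ∀ ℓ, ℓ.Prime → ℓ ∣ c → ¬ t ≡ 1 [MOD ℓ]

theorem factorization_natPart (n : ℕ) (σ : Set ℕ) (ℓ : ℕ) :
    (natPart n σ).factorization ℓ = if ℓ ∈ σ then n.factorization ℓ else 0 := by
  have h : natPart n σ = (n.factorization.filter (· ∈ σ)).prod (· ^ ·) := by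
    rw [natPart, Finsupp.prod_filter_index, Finsupp.support_filter, Finset.prod_filter,
      Nat.support_factorization]
  rw [h, Nat.prod_pow_factorization_eq_self, Finsupp.filter_apply]
  intro p hp
  exact Nat.prime_of_mem_primeFactors (Finset.mem_of_mem_filter p (by simpa using hp))

theorem natPart_ne_zero (n : ℕ) (σ : Set ℕ) : natPart n σ ≠ 0 := by
  refine Finset.prod_ne_zero_iff.2 fun p hp => ?_
  split_ifs
  · exact pow_ne_zero _ (Nat.prime_of_mem_primeFactors hp).ne_zero
  · exact one_ne_zero

theorem exists_isActPart {m : ℕ} (hm : 0 < m) (t : ℕ) : ∃ c, IsActPart c m t := by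
  have hdvd : ∀ ℓ, ℓ.Prime → (ℓ ∣ natPart m {q | ¬ t ≡ 1 [MOD q]} ↔
      ¬ t ≡ 1 [MOD ℓ] ∧ ℓ ∣ m) := by
    intro ℓ hℓ
    rw [hℓ.dvd_iff_one_le_factorization (natPart_ne_zero _ _), factorization_natPart,
      hℓ.dvd_iff_one_le_factorization hm.ne', Set.mem_ofPred_eq]
    split_ifs with h <;> simp [h]
  refine ⟨natPart m {q | ¬ t ≡ 1 [MOD q]}, ?_, ?_, ?_, ?_⟩
  · rw [← Nat.factorization_le_iff_dvd (natPart_ne_zero _ _) hm.ne']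
    intro ℓ
    rw [factorization_natPart]
    split_ifs <;> simp
  · intro ℓ k hℓ hd hk
    rw [hℓ.pow_dvd_iff_le_factorization (natPart_ne_zero _ _), factorization_natPart, if_pos]
    · exact (hℓ.pow_dvd_iff_le_factorization hm.ne').1 hk
    · exact ((hdvd ℓ hℓ).1 hd).1
  · intro ℓ hℓ hd hn
    by_contra h
    exact hn ((hdvd ℓ hℓ).2 ⟨h, hd⟩)
  · intro ℓ hℓ hd
    exact ((hdvd ℓ hℓ).1 hd).1

namespace IsActPart

variable {c m t : ℕ}

theorem orderOf_dvd (h : IsActPart c m t) {M : ℕ} (hM : M ∣ m) :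
    orderOf (t : ZMod M) ∣ orderOf (t : ZMod c) * M :=
  orderOf_natCast_dvd_mul (fun ℓ k hℓ hd hk => h.pow_dvd ℓ k hℓ hd (hk.trans hM))
    fun ℓ hℓ hd hn => h.modEq_one ℓ hℓ (hd.trans hM) hn

theorem dvd_of_modEq (h : IsActPart c m t) {s : ℕ} (hs : s * t ≡ s [MOD m]) (ht : 1 ≤ t) :
    c ∣ s := by
  rw [Nat.dvd_iff_prime_pow_dvd_dvd]
  intro ℓ k hℓ hk
  rcases Nat.eq_zero_or_pos k with rfl | hk0
  · simp
  · have hℓc : ℓ ∣ c := (dvd_pow_self ℓ hk0.ne').trans hk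
    have h1 : ℓ ^ k ∣ s * (t - 1) := by
      rw [Nat.mul_sub, mul_one]
      exact (Nat.modEq_iff_dvd' (Nat.le_mul_of_pos_right _ ht)).1
        (hs.of_dvd (hk.trans h.dvd)).symm
    refine (Nat.Coprime.pow_left k ?_).dvd_of_dvd_mul_right h1
    rw [hℓ.coprime_iff_not_dvd]
    exact fun hd => h.not_modEq_one ℓ hℓ hℓc ((Nat.modEq_iff_dvd' ht).2 hd).symm

end IsActPart

/-- A presentation of minimal `m`, normalized. -/
structure MinPres (G : Type*) [Group G] (m n s t : ℕ) : Prop where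
  pres : HasPres G m n s t
  minimal : ∀ m' n' s' t', HasPres G m' n' s' t' → m ≤ m'
  dvd : s ∣ m
  one_lt : 1 < t

variable {m n s t c p : ℕ}

theorem exists_minPres_of_isMetacyclic [Finite G] (h : IsMetacyclic G) :
    ∃ m n s t, MinPres G m n s t := by
  have hex : ∃ m, ∃ n s t, HasPres G m n s t := exists_hasPres_of_isMetacyclic h
  obtain ⟨n, s, t, h⟩ := Nat.find_spec hex
  refine ⟨Nat.find hex, n, s.gcd (Nat.find hex), t + 2 * Nat.find hex, ?_, ?_, ?_, ?_⟩
  · refine (h.of_gcd_eq (by simp)).congr_conj ?_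
    simp [Nat.ModEq]
  · exact fun m' n' s' t' h' => Nat.find_min' hex ⟨n', s', t', h'⟩
  · exact Nat.gcd_dvd_right _ _
  · have := h.pos_left
    omega

theorem HasPres.false_of_pow_dvd [Finite G] (h : HasPres G m n s t)
    (hmin : ∀ m' n' s' t', HasPres G m' n' s' t' → m ≤ m') (ht : 1 < t) (hc : IsActPart c m t)
    (hp : p.Prime) {σ r : ℕ} (hσ : p ^ σ ∣ s) (hσ' : ¬ p ^ (σ + 1) ∣ s) (hrm : p ^ r ∣ m)
    (hrt : p ^ r ∣ t - 1) (hσr : σ < r) (hn : orderOf (t : ZMod c) * p ^ σ ∣ n)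
    (h2 : p ≠ 2 ∨ t ≡ 1 [MOD 4] ∨ σ = 0) : False := by
  have hm := h.pos_left
  obtain ⟨M, hM, hpM, hM0⟩ := exists_eq_pow_mul hp hm
  set μ := m.factorization p
  have hMm : M ∣ m := ⟨p ^ μ, by rw [hM]; ring⟩
  have hrμ : r ≤ μ := (hp.pow_dvd_iff_le_factorization hm.ne').1 hrm
  have hcop : ∀ e, (p ^ e).Coprime M := fun e =>
    Nat.Coprime.pow_left e (hp.coprime_iff_not_dvd.2 hpM)
  have htp : t ≡ 1 [MOD p] := ((Nat.modEq_iff_dvd' ht.le).2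
    ((dvd_pow_self p (by omega)).trans hrt)).symm
  obtain ⟨s₀, hs₀⟩ := hσ
  have hps₀ : ¬ p ∣ s₀ := fun hd => hσ' (by rw [hs₀, pow_succ]; exact mul_dvd_mul_left _ hd)
  obtain ⟨n₂, hn₂⟩ := (Dvd.intro_left _ rfl : p ^ σ ∣ orderOf (t : ZMod c) * p ^ σ).trans hn
  have hDn : orderOf (t : ZMod c) ∣ n₂ := by
    rw [hn₂, mul_comm (p ^ σ)] at hn
    exact Nat.dvd_of_mul_dvd_mul_right (Nat.pow_pos hp.pos) hn
  set y := n₂ * M with hy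
  have hτM : t ^ y ≡ 1 [MOD M] :=
    orderOf_natCast_dvd_iff.1 ((hc.orderOf_dvd hMm).trans (mul_dvd_mul_right hDn M))
  have hyq : y * p ^ σ = n * M := by rw [hy, hn₂]; ring
  set N := ∑ k ∈ Finset.range (p ^ σ), (t ^ y) ^ k with hN
  have hτ0 : 1 ≤ t ^ y := Nat.one_le_pow _ _ (by omega)
  have hN0 : N ≠ 0 := by
    refine (Finset.sum_pos (fun k _ => Nat.pow_pos hτ0) ?_).ne'
    simpa using fun h => absurd h hp.ne_zero
  have hNfac : N.factorization p = σ := by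
    rw [hN, factorization_geomSum hp (by simpa using htp.pow y) _ (Nat.pow_pos hp.pos) hτ0,
      hp.factorization_pow, Finsupp.single_eq_same]
    rcases h2 with h2 | h2 | h2
    · exact Or.inl h2
    · exact Or.inr (Or.inl (by simpa using h2.pow y))
    · right; right
      rw [h2, pow_zero]
      exact hp.one_lt.ne' ∘ Nat.dvd_one.1
  obtain ⟨N₀, hN₀, hpN₀, -⟩ := exists_eq_pow_mul hp (Nat.pos_of_ne_zero hN0)
  rw [hNfac] at hN₀
  obtain ⟨i₀, hi₀⟩ := exists_mul_modEq (a := N₀) (M := p ^ (μ - σ))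
    (p ^ (r - σ) + (p ^ (μ - σ) - 1) * (s₀ * M))
    ((Nat.Coprime.pow_left _ (hp.coprime_iff_not_dvd.2 hpN₀)).symm) (Nat.pow_pos hp.pos)
  obtain ⟨i, hi, hiM⟩ := Nat.chineseRemainder (hcop (μ - σ)) i₀ 1
  have hK₀ : i * N₀ + s₀ * M ≡ p ^ (r - σ) [MOD p ^ (μ - σ)] := by
    rw [mul_comm] at hi₀
    refine (((hi.mul_right N₀).trans hi₀).add_right (s₀ * M)).trans ?_
    have : p ^ (r - σ) + (p ^ (μ - σ) - 1) * (s₀ * M) + s₀ * M =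
        p ^ (r - σ) + p ^ (μ - σ) * (s₀ * M) := by
      rw [Nat.sub_mul, one_mul, add_assoc, Nat.sub_add_cancel
        (Nat.le_mul_of_pos_left _ (Nat.pow_pos hp.pos))]
    rw [this]
    simp [Nat.ModEq]
  have hpi : ¬ p ∣ i := by
    intro hd
    have h1 := hK₀.of_dvd (dvd_pow_self p (by omega))
    have h3 := (h1.dvd_iff dvd_rfl).2 (dvd_pow_self p (by omega))
    exact (hp.dvd_mul.1 ((Nat.dvd_add_right (hd.mul_right _)).1 h3)).elim hps₀ hpM
  have hicop : i.Coprime m := by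
    rw [hM]
    refine Nat.Coprime.mul_right (Nat.Coprime.pow_right _ (hp.coprime_iff_not_dvd.2 hpi).symm) ?_
    exact hiM.gcd_eq.trans (Nat.gcd_one_left M)
  set K := i * N + s * M with hK
  have hKp : K ≡ p ^ r [MOD p ^ μ] := by
    have := hK₀.mul_left' (p ^ σ)
    rw [← pow_add, ← pow_add, show σ + (μ - σ) = μ by omega, show σ + (r - σ) = r by omega] at this
    rwa [hK, hN₀, hs₀, show i * (p ^ σ * N₀) + p ^ σ * s₀ * M = p ^ σ * (i * N₀ + s₀ * M) by ring]
  have hKM : K ≡ p ^ σ [MOD M] := by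
    have := (hiM.mul (geomSum_modEq hτM (p ^ σ))).add
      (Nat.modEq_zero_iff_dvd.2 (dvd_mul_left M s))
    rwa [one_mul, add_zero] at this
  obtain ⟨w₁, hw₁⟩ := exists_mul_modEq (t - 1) (hcop σ) hM0
  obtain ⟨w, hwp, hwM⟩ := Nat.chineseRemainder (hcop μ) (i * ((t - 1) / p ^ r)) w₁
  have hw : K * w ≡ i * (t - 1) [MOD m] := by
    rw [hM, ← Nat.modEq_and_modEq_iff_modEq_mul (hcop μ)]
    constructor
    · refine (hKp.mul hwp).trans ?_
      rw [mul_left_comm, Nat.mul_div_cancel' hrt]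
    · refine ((hKM.mul hwM).trans hw₁).trans ?_
      simpa using (hiM.mul_right (t - 1)).symm
  have hw' : K * w + i ≡ i * t [MOD m] := by
    have := hw.add_right i
    rwa [show i * (t - 1) + i = i * t by rw [Nat.mul_sub, mul_one,
      Nat.sub_add_cancel (Nat.le_mul_of_pos_right _ (by omega))]] at this
  obtain ⟨m', n', s', h', hdiv, -⟩ := h.twist hicop hyq hw'
  have hd := hdiv (p ^ σ) M (m / p ^ r) hyq (by
    obtain ⟨u, hu⟩ := hrm
    rw [hu, Nat.mul_div_cancel_left _ (Nat.pow_pos hp.pos)]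
    refine mul_dvd_mul_right ?_ u
    exact ((hKp.of_dvd (pow_dvd_pow p hrμ)).dvd_iff dvd_rfl).2 dvd_rfl)
  have hle := hmin _ _ _ _ h'
  obtain ⟨u, hu⟩ := hrm
  rw [hu, Nat.mul_div_cancel_left _ (Nat.pow_pos hp.pos)] at hd
  have hu0 : 0 < u := Nat.pos_of_ne_zero fun h0 => by rw [h0, mul_zero] at hu; omega
  have := Nat.le_of_dvd (Nat.mul_pos (Nat.pow_pos hp.pos) hu0) hd
  have hlt : p ^ σ * u < p ^ r * u :=
    Nat.mul_lt_mul_of_pos_right (Nat.pow_lt_pow_right hp.one_lt hσr) hu0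
  omega

namespace MinPres

theorem pos_left [Finite G] (h : MinPres G m n s t) : 0 < m := h.pres.pos_left

theorem pos_right [Finite G] (h : MinPres G m n s t) : 0 < n := h.pres.pos_right

theorem ne_zero [Finite G] (h : MinPres G m n s t) : s ≠ 0 :=
  (Nat.pos_of_dvd_of_pos h.dvd h.pos_left).ne'

theorem orderOf_dvd [Finite G] (h : MinPres G m n s t) {e : ℕ} (he : e ∣ m) :
    orderOf (t : ZMod e) ∣ n :=
  orderOf_natCast_dvd_iff.2 (h.pres.pow_modEq_one.of_dvd he)

theorem lt_add [Finite G] (h : MinPres G m n s t) (hc : IsActPart c m t) (hp : p.Prime) {r : ℕ}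
    (hrm : p ^ r ∣ m) (hrt : t ≡ 1 [MOD p ^ r])
    (h2 : p ≠ 2 ∨ 2 ≤ r ∨ min (s.factorization p) (n.factorization p) = 0)
    (hlt : min (s.factorization p) (n.factorization p) < r) :
    n.factorization p < min (s.factorization p) (n.factorization p) +
      (orderOf (t : ZMod c)).factorization p := by
  by_contra hle
  rw [not_lt] at hle
  have hrt' : p ^ r ∣ t - 1 := (Nat.modEq_iff_dvd' h.one_lt.le).1 hrt.symm
  have htp : t ≡ 1 [MOD p] := hrt.of_dvd (dvd_pow_self p (by omega))
  have hdvd := mul_pow_dvd_of_factorization_le hp (h.orderOf_dvd hc.dvd) h.pos_right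
    (by rw [add_comm]; exact hle)
  have h4 : p ≠ 2 ∨ t ≡ 1 [MOD 4] ∨ min (s.factorization p) (n.factorization p) = 0 := by
    rcases eq_or_ne p 2 with rfl | hp2
    · exact Or.inr ((h2.resolve_left (by simp)).imp_left fun h => hrt.of_dvd (pow_dvd_pow 2 h))
    · exact Or.inl hp2
  rcases le_or_gt (s.factorization p) (n.factorization p) with hσ | hσ
  · refine h.pres.false_of_pow_dvd h.minimal h.one_lt hc hp (Nat.ordProj_dvd s p)
      (Nat.pow_succ_factorization_not_dvd h.ne_zero hp) hrm hrt' ?_ ?_ ?_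
    all_goals rw [min_eq_left hσ] at *
    all_goals assumption
  · rw [min_eq_right hσ.le] at *
    have hS0 : ∑ k ∈ Finset.range n, t ^ k ≠ 0 := by
      refine (Finset.sum_pos (fun k _ => Nat.pow_pos (by linarith [h.one_lt])) ?_).ne'
      simpa using h.pos_right.ne'
    have hS : (∑ k ∈ Finset.range n, t ^ k).factorization p = n.factorization p := by
      refine factorization_geomSum hp htp (h4.imp_right (Or.imp_right fun h0 hd => ?_)) h.pos_right
        h.one_lt.le
      exact Nat.one_le_iff_ne_zero.1 ((hp.dvd_iff_one_le_factorization h.pos_right.ne').1 hd) h0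
    refine (h.pres.add_geomSum 1).false_of_pow_dvd h.minimal h.one_lt hc hp (σ := n.factorization p)
      ?_ ?_ hrm hrt' hlt hdvd h4
    · refine dvd_add ((hp.pow_dvd_iff_le_factorization h.ne_zero).2 hσ.le) ?_
      rw [one_mul, hp.pow_dvd_iff_le_factorization hS0, hS]
    · rw [Nat.dvd_add_right ((hp.pow_dvd_iff_le_factorization h.ne_zero).2 hσ), one_mul,
        hp.pow_dvd_iff_le_factorization hS0, hS]
      omega

end MinPres

end Minimal

section Comparison

variable {m n s t m' n' s' t' k : ℕ}

/-- The divisor `e` of `m` contributes to the number of solutions of `x * g * x⁻¹ = g ^ k`. -/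
def Feasible (m n s t k e : ℕ) : Prop :=
  e ∣ m ∧ (∃ j, t ^ j ≡ k [MOD e]) ∧
    e * (n / orderOf (t : ZMod e)).gcd (k - 1) ∣ s * (k - 1)

/-- The contribution of `e`, extended by zero to all natural numbers. -/
def divTerm (m n s t k e : ℕ) : ℚ :=
  if Feasible m n s t k e then
    ((n / orderOf (t : ZMod e)).gcd (k - 1) : ℚ) / orderOf (t : ZMod e) else 0

theorem sum_divTerm {N : ℕ} (hN : 0 < N) (hm : m ∣ N) :
    ∑ e ∈ N.divisors, (e.totient : ℚ) * divTerm m n s t k e =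
      ∑ e ∈ m.divisors, (e.totient : ℚ) * powConjTerm n s t k e := by
  symm
  have hm0 : m ≠ 0 := (Nat.pos_of_dvd_of_pos hm hN).ne'
  have h1 : ∀ e ∈ m.divisors, (e.totient : ℚ) * powConjTerm n s t k e =
      (e.totient : ℚ) * divTerm m n s t k e := by
    intro e he
    simp [divTerm, Feasible, powConjTerm, Nat.dvd_of_mem_divisors he]
  rw [Finset.sum_congr rfl h1]
  refine Finset.sum_subset (Nat.divisors_subset_of_dvd hN.ne' hm) fun e _ he => ?_
  rw [divTerm, if_neg, mul_zero]
  exact fun h => he (Nat.mem_divisors.2 ⟨h.1, hm0⟩)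

/-- Both groups have the same number of solutions of `x * g * x⁻¹ = g ^ k`. -/
def SameCount (N m n s t m' n' s' t' k : ℕ) : Prop :=
  2 ≤ k ∧ ∑ e ∈ N.divisors, (e.totient : ℚ) * divTerm m n s t k e =
    ∑ e ∈ N.divisors, (e.totient : ℚ) * divTerm m' n' s' t' k e

theorem SameCount.symm {N : ℕ} (h : SameCount N m n s t m' n' s' t' k) :
    SameCount N m' n' s' t' m n s t k :=
  ⟨h.1, h.2.symm⟩

theorem exists_sameCount [Finite G] {H : Type*} [Group H] [Finite H]
    (e : MonoidAlgebra ℚ G ≃ₐ[ℚ] MonoidAlgebra ℚ H) (h : HasPres G m n s t)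
    (h' : HasPres H m' n' s' t') (N : ℕ) (c : ℕ → ℕ)
    (hc : ∀ p ∈ (Nat.card G).primeFactors, ¬ p ∣ c p) :
    ∃ k, (∀ p ∈ (Nat.card G).primeFactors, k ≡ c p [MOD p ^ N]) ∧
      SameCount (Nat.card G) m n s t m' n' s' t' k := by
  obtain ⟨k, hk, hkc, hcount, -⟩ := exists_exponent e N c hc
  have hcard := card_eq_of_algEquiv e
  refine ⟨k, hkc, hk, ?_⟩
  rw [sum_divTerm Nat.card_pos (h.card ▸ dvd_mul_right m n),
    sum_divTerm Nat.card_pos (hcard ▸ h'.card ▸ dvd_mul_right m' n')]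
  have h1 := h.powConjCount_eq hk
  have h2 := h'.powConjCount_eq hk
  rw [← hcount, h1, ← hcard] at h2
  exact mul_left_cancel₀ (by exact_mod_cast Nat.card_pos.ne') h2

theorem divTerm_eq_of_le {N : ℕ} (hN : N ≠ 0)
    (hsum : ∑ e ∈ N.divisors, (e.totient : ℚ) * divTerm m n s t k e =
      ∑ e ∈ N.divisors, (e.totient : ℚ) * divTerm m' n' s' t' k' e)
    (hle : ∀ e, divTerm m n s t k e ≤ divTerm m' n' s' t' k' e) {e : ℕ} (he : e ∣ N) :
    divTerm m n s t k e = divTerm m' n' s' t' k' e := by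
  have := (Finset.sum_eq_sum_iff_of_le fun e _ =>
    mul_le_mul_of_nonneg_left (hle e) (Nat.cast_nonneg e.totient)).1 hsum e
      (Nat.mem_divisors.2 ⟨he, hN⟩)
  refine mul_left_cancel₀ ?_ this
  exact_mod_cast (Nat.totient_pos.2 (Nat.pos_of_dvd_of_pos he (Nat.pos_of_ne_zero hN))).ne'

theorem gcd_sub_one_pos (hk : 2 ≤ k) (x : ℕ) : 0 < x.gcd (k - 1) :=
  Nat.gcd_pos_of_pos_right _ (by omega)

namespace MinPres

variable {c e : ℕ}

theorem orderOf_pos [Finite G] (h : MinPres G m n s t) (he : e ∣ m) : 0 < orderOf (t : ZMod e) :=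
  Nat.pos_of_dvd_of_pos (h.orderOf_dvd he) h.pos_right

theorem divTerm_ne_zero_iff [Finite G] (h : MinPres G m n s t) (hk : 2 ≤ k) :
    divTerm m n s t k e ≠ 0 ↔ Feasible m n s t k e := by
  rw [divTerm]
  split_ifs with hf
  · have h1 := h.orderOf_pos hf.1
    have h2 := gcd_sub_one_pos hk (n / orderOf (t : ZMod e))
    simp only [hf, iff_true]
    positivity
  · simp [hf]

theorem factorization_gcd_div [Finite G] (h : MinPres G m n s t) (hk : 2 ≤ k) (he : e ∣ m)
    (q : ℕ) : ((n / orderOf (t : ZMod e)).gcd (k - 1)).factorization q =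
      min (n.factorization q - (orderOf (t : ZMod e)).factorization q)
        ((k - 1).factorization q) := by
  rw [Nat.factorization_gcd (Nat.div_pos (Nat.le_of_dvd h.pos_right (h.orderOf_dvd he))
    (h.orderOf_pos he)).ne' (by omega), Nat.factorization_div (h.orderOf_dvd he)]
  rfl

theorem feasible_iff [Finite G] (h : MinPres G m n s t) (hk : 2 ≤ k) (he : e ∣ m) :
    Feasible m n s t k e ↔ (∃ j, t ^ j ≡ k [MOD e]) ∧ ∀ q, q.Prime →
      e.factorization q + min (n.factorization q - (orderOf (t : ZMod e)).factorization q)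
        ((k - 1).factorization q) ≤ s.factorization q + (k - 1).factorization q := by
  have he0 : e ≠ 0 := (Nat.pos_of_dvd_of_pos he h.pos_left).ne'
  have hg := (gcd_sub_one_pos hk (n / orderOf (t : ZMod e))).ne'
  have hk0 : k - 1 ≠ 0 := by omega
  simp only [Feasible, he, true_and]
  refine and_congr_right fun _ => ?_
  rw [← Nat.factorization_prime_le_iff_dvd (mul_ne_zero he0 hg) (mul_ne_zero h.ne_zero hk0),
    Nat.factorization_mul he0 hg, Nat.factorization_mul h.ne_zero hk0]
  simp only [Finsupp.add_apply, h.factorization_gcd_div hk he]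

end MinPres

/-- If every contribution on the left is dominated on the right, then they all agree. -/
theorem SameCount.feasible_of_le [Finite G] {H : Type*} [Group H] [Finite H] {e : ℕ}
    (hs : SameCount (Nat.card G) m n s t m' n' s' t' k) (hcard : Nat.card G = Nat.card H)
    (h : MinPres G m n s t) (h' : MinPres H m' n' s' t')
    (hle : ∀ e, Feasible m n s t k e → Feasible m' n' s' t' k e ∧
      orderOf (t : ZMod e) = orderOf (t' : ZMod e) ∧
      ∀ q, q.Prime →
        min (n.factorization q - (orderOf (t' : ZMod e)).factorization q)
          ((k - 1).factorization q) ≤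
        min (n'.factorization q - (orderOf (t' : ZMod e)).factorization q)
          ((k - 1).factorization q))
    (he : Feasible m' n' s' t' k e) :
    Feasible m n s t k e ∧ ∀ q,
        min (n.factorization q - (orderOf (t' : ZMod e)).factorization q)
          ((k - 1).factorization q) =
        min (n'.factorization q - (orderOf (t' : ZMod e)).factorization q)
          ((k - 1).factorization q) := by
  obtain ⟨hk, hsum⟩ := hs
  have hterm := divTerm_eq_of_le Nat.card_pos.ne' hsum (fun e => by
    by_cases hf : Feasible m n s t k e
    · obtain ⟨hf', hD, hq⟩ := hle e hf
      rw [divTerm, divTerm, if_pos hf, if_pos hf', ← hD]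
      rw [← hD] at hq
      gcongr
      refine Nat.le_of_dvd (gcd_sub_one_pos hk _) ?_
      rw [← Nat.factorization_prime_le_iff_dvd (gcd_sub_one_pos hk _).ne'
        (gcd_sub_one_pos hk _).ne']
      intro q hq'
      have h2 := h'.factorization_gcd_div hk hf'.1 q
      rw [← hD] at h2
      rw [h.factorization_gcd_div hk hf.1, h2]
      exact hq q hq'
    · rw [divTerm, if_neg hf, divTerm]
      split_ifs
      · positivity
      · exact le_rfl) (e := e) (hcard ▸ h'.pres.card ▸ he.1.mul_right n')
  have hne := (h'.divTerm_ne_zero_iff hk).2 he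
  have hf : Feasible m n s t k e := (h.divTerm_ne_zero_iff hk).1 (hterm ▸ hne)
  refine ⟨hf, fun q => ?_⟩
  obtain ⟨-, hD, -⟩ := hle e hf
  rw [divTerm, divTerm, if_pos hf, if_pos he, ← hD] at hterm
  have h0 : ((orderOf (t : ZMod e) : ℕ) : ℚ) ≠ 0 := by exact_mod_cast (h.orderOf_pos hf.1).ne'
  rw [div_left_inj' h0] at hterm
  have h3 := congrArg (fun x => x.factorization q) (Nat.cast_injective hterm)
  have h2 := h'.factorization_gcd_div hk he.1 q
  rw [← hD] at h2 ⊢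
  simpa only [h.factorization_gcd_div hk hf.1, h2] using h3

theorem divTerm_le_of_gcd_eq {k' : ℕ} {N : ℕ} (hN : m * n ∣ N)
    (hgcd : N.gcd (k - 1) = N.gcd (k' - 1)) 
    (hj : ∀ e, e ∣ m → (∃ j, t ^ j ≡ k [MOD e]) → ∃ j, t ^ j ≡ k' [MOD e]) 
    (hD : ∀ e, e ∣ m → orderOf (t : ZMod e) ∣ n) (e : ℕ) :
    divTerm m n s t k e ≤ divTerm m n s t k' e := by
  by_cases hf : Feasible m n s t k e
  · have hdvd : n / orderOf (t : ZMod e) ∣ N :=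
      (Nat.div_dvd_of_dvd (hD e hf.1)).trans ((dvd_mul_left n m).trans hN)
    have hg : (n / orderOf (t : ZMod e)).gcd (k - 1) = (n / orderOf (t : ZMod e)).gcd (k' - 1) := by
      rw [← Nat.gcd_eq_left hdvd, Nat.gcd_assoc, hgcd, ← Nat.gcd_assoc]
    have hf' : Feasible m n s t k' e := by
      refine ⟨hf.1, hj e hf.1 hf.2.1, ?_⟩
      have h1 : e * (n / orderOf (t : ZMod e)).gcd (k - 1) ∣ N :=
        (mul_dvd_mul hf.1 ((Nat.gcd_dvd_left _ _).trans (Nat.div_dvd_of_dvd (hD e hf.1)))).trans hN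
      have h2 := Nat.dvd_gcd (h1.mul_left s) hf.2.2
      rw [Nat.gcd_mul_left, hgcd, hg] at h2
      exact h2.trans (mul_dvd_mul_left s (Nat.gcd_dvd_right _ _))
    rw [divTerm, divTerm, if_pos hf, if_pos hf', hg]
  · rw [divTerm, if_neg hf, divTerm]
    split_ifs
    · positivity
    · exact le_rfl

/-- Two exponents of the same level, one adapted to each group, have the same contributions. -/
theorem SameCount.exists_pow_modEq_of_coupled [Finite G] {H : Type*} [Group H] [Finite H] 
    {k' e : ℕ}
    (hs : SameCount (Nat.card G) m n s t m' n' s' t' k)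
    (hs' : SameCount (Nat.card G) m n s t m' n' s' t' k') (hcard : Nat.card G = Nat.card H)
    (h : MinPres G m n s t) (h' : MinPres H m' n' s' t')
    (hgcd : (Nat.card G).gcd (k - 1) = (Nat.card G).gcd (k' - 1))
    (hj : ∀ e, e ∣ m → (∃ j, t ^ j ≡ k' [MOD e]) → t ≡ k [MOD e])
    (hj' : ∀ e, e ∣ m' → (∃ j, t' ^ j ≡ k [MOD e]) → t' ≡ k' [MOD e])
    (he : Feasible m n s t k e) : ∃ j, t ^ j ≡ k' [MOD e] := by
  have h1 := divTerm_le_of_gcd_eq (s := s) h.pres.card.symm.dvd hgcd.symm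
    (fun e he hje => ⟨1, by simpa using hj e he hje⟩) fun e he => h.orderOf_dvd he
  have h2 := divTerm_le_of_gcd_eq (s := s') (hcard ▸ h'.pres.card.symm.dvd) hgcd
    (fun e he hje => ⟨1, by simpa using hj' e he hje⟩)
    fun e he => h'.orderOf_dvd he
  have hsum : ∑ e ∈ (Nat.card G).divisors, (e.totient : ℚ) * divTerm m n s t k' e =
      ∑ e ∈ (Nat.card G).divisors, (e.totient : ℚ) * divTerm m n s t k e := by
    refine le_antisymm (Finset.sum_le_sum fun e _ =>
      mul_le_mul_of_nonneg_left (h1 e) (Nat.cast_nonneg _)) ?_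
    rw [hs.2, hs'.2]
    exact Finset.sum_le_sum fun e _ => mul_le_mul_of_nonneg_left (h2 e) (Nat.cast_nonneg _)
  have h3 := divTerm_eq_of_le Nat.card_pos.ne' hsum h1 (e := e)
    (h.pres.card ▸ he.1.mul_right n)
  have h4 : Feasible m n s t k' e := by
    rw [← h.divTerm_ne_zero_iff hs'.1, h3, h.divTerm_ne_zero_iff hs.1]
    exact he
  exact h4.2.1

end Comparison

section Matching

variable {m n s t m' n' s' t' c p q : ℕ}

/-- The largest `r` with `p ^ r ∣ m` and `t ≡ 1 [MOD p ^ r]`. -/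
def trivExp (m t p : ℕ) : ℕ := (m.gcd (t - 1)).factorization p

theorem trivExp_le (hm : 0 < m) : trivExp m t p ≤ m.factorization p :=
  (Nat.factorization_le_iff_dvd (Nat.gcd_pos_of_pos_left _ hm).ne' hm.ne').2
    (Nat.gcd_dvd_left _ _) p

theorem le_trivExp_iff (hm : 0 < m) (ht : 1 ≤ t) (hp : p.Prime) {j : ℕ} :
    j ≤ trivExp m t p ↔ p ^ j ∣ m ∧ t ≡ 1 [MOD p ^ j] := by
  rw [trivExp, ← hp.pow_dvd_iff_le_factorization (Nat.gcd_pos_of_pos_left _ hm).ne',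
    Nat.dvd_gcd_iff,
    Nat.ModEq.comm, Nat.modEq_iff_dvd' ht]

namespace MinPres

theorem modEq_one_of_le [Finite G] (h : MinPres G m n s t) (hp : p.Prime) {j : ℕ}
    (hj : j ≤ trivExp m t p) : t ≡ 1 [MOD p ^ j] :=
  ((le_trivExp_iff h.pos_left h.one_lt.le hp).1 hj).2

theorem trivExp_eq_zero_iff [Finite G] (h : MinPres G m n s t) (hp : p.Prime) (hpm : p ∣ m) :
    trivExp m t p = 0 ↔ ¬ t ≡ 1 [MOD p] := by
  have := le_trivExp_iff h.pos_left h.one_lt.le hp (j := 1)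
  rw [pow_one] at this
  have h1 : 1 ≤ trivExp m t p ↔ t ≡ 1 [MOD p] := this.trans (and_iff_right hpm)
  rw [← h1]
  omega

theorem factorization_orderOf_le [Finite G] (h : MinPres G m n s t) {e : ℕ} (he : e ∣ m) :
    (orderOf (t : ZMod e)).factorization p ≤ n.factorization p :=
  (Nat.factorization_le_iff_dvd (h.orderOf_pos he).ne' h.pos_right.ne').2 (h.orderOf_dvd he) p

theorem factorization_le [Finite G] (h : MinPres G m n s t) :
    s.factorization p ≤ m.factorization p :=
  (Nat.factorization_le_iff_dvd h.ne_zero h.pos_left.ne').2 h.dvd p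

theorem le_factorization_add [Finite G] (h : MinPres G m n s t) (p : ℕ) :
    m.factorization p ≤ s.factorization p + trivExp m t p := by
  have ht : t - 1 ≠ 0 := by have := h.one_lt; omega
  have h1 : m.factorization p ≤ s.factorization p + (t - 1).factorization p := by
    rw [← Finsupp.add_apply, ← Nat.factorization_mul h.ne_zero ht]
    refine (Nat.factorization_le_iff_dvd h.pos_left.ne' (mul_ne_zero h.ne_zero ht)).2 ?_ p
    rw [Nat.mul_sub, mul_one]
    exact (Nat.modEq_iff_dvd' (Nat.le_mul_of_pos_right _ (by have := h.one_lt; omega))).1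
      h.pres.mul_modEq.symm
  have h2 : trivExp m t p = min (m.factorization p) ((t - 1).factorization p) := by
    rw [trivExp, Nat.factorization_gcd h.pos_left.ne' ht]
    rfl
  omega

end MinPres

variable {H : Type*} [Group H] [Finite G] [Finite H]

theorem factorization_add_trivExp_eq (e : MonoidAlgebra ℚ G ≃ₐ[ℚ] MonoidAlgebra ℚ H)
    (h : MinPres G m n s t) (h' : MinPres H m' n' s' t') (p : ℕ) :
    n.factorization p + trivExp m t p = n'.factorization p + trivExp m' t' p := by
  have := HasPres.mul_gcd_eq e h.pres h'.pres h.one_lt.le h'.one_lt.le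
  have := congrArg (fun x => x.factorization p) this
  simpa only [trivExp, Nat.factorization_mul h.pos_right.ne'
    (Nat.gcd_pos_of_pos_left _ h.pos_left).ne',
    Nat.factorization_mul h'.pos_right.ne' (Nat.gcd_pos_of_pos_left _ h'.pos_left).ne',
    Finsupp.add_apply] using this

theorem factorization_add_factorization_eq (e : MonoidAlgebra ℚ G ≃ₐ[ℚ] MonoidAlgebra ℚ H)
    (h : MinPres G m n s t) (h' : MinPres H m' n' s' t') (p : ℕ) :
    m.factorization p + n.factorization p = m'.factorization p + n'.factorization p := by
  have := card_eq_of_algEquiv e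
  rw [h.pres.card, h'.pres.card] at this
  have := congrArg (fun x => x.factorization p) this
  simpa only [Nat.factorization_mul h.pos_left.ne' h.pos_right.ne',
    Nat.factorization_mul h'.pos_left.ne' h'.pos_right.ne', Finsupp.add_apply] using this

theorem min_trivExp_eq (e : MonoidAlgebra ℚ G ≃ₐ[ℚ] MonoidAlgebra ℚ H)
    (h : MinPres G m n s t) (h' : MinPres H m' n' s' t') (hp : p.Prime) :
    min (trivExp m t p) (min (s.factorization p) (n.factorization p)) =
      min (trivExp m' t' p) (min (s'.factorization p) (n'.factorization p)) := by
  refine eq_of_forall_le_iff fun j => ?_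
  have := HasPres.pow_dvd_and_iff e h.pres h'.pres hp j
  simp only [le_min_iff, le_trivExp_iff h.pos_left h.one_lt.le hp,
    le_trivExp_iff h'.pos_left h'.one_lt.le hp, ← hp.pow_dvd_iff_le_factorization h.ne_zero,
    ← hp.pow_dvd_iff_le_factorization h'.ne_zero,
    ← hp.pow_dvd_iff_le_factorization h.pos_right.ne',
    ← hp.pow_dvd_iff_le_factorization h'.pos_right.ne']
  tauto

theorem IsActPart.factorization_eq {c m t : ℕ} (hc : IsActPart c m t) (hm : 0 < m) (hq : q.Prime)
    (h : q ∣ c) : c.factorization q = m.factorization q := by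
  have hc0 := (Nat.pos_of_dvd_of_pos hc.dvd hm).ne'
  refine le_antisymm ((Nat.factorization_le_iff_dvd hc0 hm.ne').2 hc.dvd q) ?_
  rw [← hq.pow_dvd_iff_le_factorization hc0]
  exact hc.pow_dvd q _ hq h (Nat.ordProj_dvd m q)

theorem MinPres.factorization_eq_of_dvd (h : MinPres G m n s t) (hc : IsActPart c m t)
    (hq : q.Prime) (h' : q ∣ c) : s.factorization q = m.factorization q := by
  refine le_antisymm h.factorization_le ?_
  rw [← hc.factorization_eq h.pos_left hq h']
  exact (Nat.factorization_le_iff_dvd (Nat.pos_of_dvd_of_pos hc.dvd h.pos_left).ne' h.ne_zero).2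
    (hc.dvd_of_modEq h.pres.mul_modEq h.one_lt.le) q

theorem factorization_eq_of_not_modEq_one (e : MonoidAlgebra ℚ G ≃ₐ[ℚ] MonoidAlgebra ℚ H)
    (h : MinPres G m n s t) (h' : MinPres H m' n' s' t') (hq : q.Prime) (hqm : q ∣ m)
    (ht : ¬ t ≡ 1 [MOD q]) :
    m.factorization q = m'.factorization q ∧ n.factorization q = n'.factorization q ∧
      q ∣ m' ∧ ¬ t' ≡ 1 [MOD q] := by
  have hr := (h.trivExp_eq_zero_iff hq hqm).2 ht
  have h1 := factorization_add_trivExp_eq e h h' q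
  have h2 := factorization_add_factorization_eq e h h' q
  have h3 := min_trivExp_eq e h h' hq
  have hr' : trivExp m' t' q = 0 := by
    by_contra hne
    obtain ⟨c', hc'⟩ := exists_isActPart h'.pos_left t'
    have h4 := (le_trivExp_iff h'.pos_left h'.one_lt.le hq).1 (le_refl (trivExp m' t' q))
    have h5 := h'.lt_add hc' hq h4.1 h4.2 (by omega) (by omega)
    have h6 := h'.factorization_orderOf_le (p := q) hc'.dvd
    omega
  have hm' : m.factorization q = m'.factorization q := by omega
  have hqm' : q ∣ m' := by
    rw [hq.dvd_iff_one_le_factorization h'.pos_left.ne', ← hm',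
      ← hq.dvd_iff_one_le_factorization h.pos_left.ne']
    exact hqm
  exact ⟨hm', by omega, hqm', (h'.trivExp_eq_zero_iff hq hqm').1 hr'⟩

theorem IsActPart.congr_left (e : MonoidAlgebra ℚ G ≃ₐ[ℚ] MonoidAlgebra ℚ H)
    (h : MinPres G m n s t) (h' : MinPres H m' n' s' t') (hc : IsActPart c m t) :
    IsActPart c m' t' where
  dvd := by
    have hc0 := (Nat.pos_of_dvd_of_pos hc.dvd h.pos_left).ne'
    rw [← Nat.factorization_prime_le_iff_dvd hc0 h'.pos_left.ne']
    intro q hq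
    by_cases hd : q ∣ c
    · rw [hc.factorization_eq h.pos_left hq hd]
      exact (factorization_eq_of_not_modEq_one e h h' hq (hd.trans hc.dvd)
        (hc.not_modEq_one q hq hd)).1.le
    · simp [Nat.factorization_eq_zero_of_not_dvd hd]
  pow_dvd ℓ k hℓ hd hk := by
    refine hc.pow_dvd ℓ k hℓ hd ?_
    rw [hℓ.pow_dvd_iff_le_factorization h.pos_left.ne',
      (factorization_eq_of_not_modEq_one e h h' hℓ (hd.trans hc.dvd)
        (hc.not_modEq_one ℓ hℓ hd)).1]
    exact (hℓ.pow_dvd_iff_le_factorization h'.pos_left.ne').1 hk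
  modEq_one ℓ hℓ hd hn := by
    by_contra ht
    obtain ⟨-, -, h1, h2⟩ := factorization_eq_of_not_modEq_one e.symm h' h hℓ hd ht
    exact h2 (hc.modEq_one ℓ hℓ h1 hn)
  not_modEq_one ℓ hℓ hd :=
    (factorization_eq_of_not_modEq_one e h h' hℓ (hd.trans hc.dvd)
        (hc.not_modEq_one ℓ hℓ hd)).2.2.2

theorem gcd_eq_gcd_of_prime_pow {N a b : ℕ}
    (h : ∀ ℓ i, ℓ.Prime → ℓ ^ i ∣ N → (ℓ ^ i ∣ a ↔ ℓ ^ i ∣ b)) : N.gcd a = N.gcd b := by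
  have key : ∀ {a b : ℕ}, (∀ ℓ i, ℓ.Prime → ℓ ^ i ∣ N → (ℓ ^ i ∣ a ↔ ℓ ^ i ∣ b)) →
      N.gcd a ∣ N.gcd b := by
    intro a b h
    refine Nat.dvd_gcd (Nat.gcd_dvd_left _ _) ?_
    rw [Nat.dvd_iff_prime_pow_dvd_dvd]
    intro ℓ i hℓ hi
    exact (h ℓ i hℓ (hi.trans (Nat.gcd_dvd_left _ _))).1 (hi.trans (Nat.gcd_dvd_right _ _))
  exact Nat.dvd_antisymm (key h) (key fun ℓ i hℓ hi => (h ℓ i hℓ hi).symm)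

theorem eq_two_of_pow_modEq {ℓ i j t k : ℕ} (hℓ : ℓ.Prime) (hi : 0 < i) (ht : t ≡ 1 [MOD ℓ])
    (h : t ^ j ≡ k [MOD ℓ ^ i]) (hk : ℓ ^ i ∣ k + 1) : ℓ = 2 ∧ 2 ^ i ∣ t + 1 := by
  have hd : ℓ ^ i ∣ t ^ j + 1 := ((h.add_right 1).dvd_iff dvd_rfl).2 hk
  have h2 : ℓ = 2 := by
    have h1 : ℓ ∣ t ^ j + 1 := (dvd_pow_self ℓ hi.ne').trans hd
    have h3 := (((ht.pow j).add_right 1).dvd_iff dvd_rfl).1 h1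
    rw [one_pow] at h3
    exact (Nat.prime_dvd_prime_iff_eq hℓ Nat.prime_two).1 h3
  subst h2
  refine ⟨rfl, ?_⟩
  rcases Nat.lt_or_ge 1 i with h1 | h1
  · exact modEq_neg_one_of_pow h1 hd
  · obtain rfl : i = 1 := by omega
    rw [pow_one]
    exact ((ht.add_right 1).dvd_iff dvd_rfl).2 dvd_rfl

end Matching

section Matched

variable {m n s t m' n' s' t' c : ℕ}

/-- Normalized minimal presentations of `G` and `H` agreeing at all primes in `S`. -/
structure MatchedPres (G H : Type*) [Group G] [Group H] (S : Set ℕ)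
    (c m n s t m' n' s' t' : ℕ) : Prop where
  left : MinPres G m n s t
  right : MinPres H m' n' s' t'
  actLeft : IsActPart c m t
  actRight : IsActPart c m' t'
  mem : ∀ q, q.Prime → q ∣ c → q ∈ S
  eq_m : ∀ q ∈ S, q.Prime → m.factorization q = m'.factorization q
  eq_n : ∀ q ∈ S, q.Prime → n.factorization q = n'.factorization q
  eq_s : ∀ q ∈ S, q.Prime → s.factorization q = s'.factorization q
  modEq : ∀ q ∈ S, q.Prime → t ≡ t' [MOD q ^ m.factorization q]

theorem MatchedPres.symm {H : Type*} [Group H] {S : Set ℕ}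
    (h : MatchedPres G H S c m n s t m' n' s' t') :
    MatchedPres H G S c m' n' s' t' m n s t where
  left := h.right
  right := h.left
  actLeft := h.actRight
  actRight := h.actLeft
  mem := h.mem
  eq_m q hq hq' := (h.eq_m q hq hq').symm
  eq_n q hq hq' := (h.eq_n q hq hq').symm
  eq_s q hq hq' := (h.eq_s q hq hq').symm
  modEq q hq hq' := h.eq_m q hq hq' ▸ (h.modEq q hq hq').symm

end Matched

section Coupling

variable {m n s t m' n' s' t' c p q : ℕ} {H : Type*} [Group H] [Finite G] [Finite H]

theorem exists_coupled (e : MonoidAlgebra ℚ G ≃ₐ[ℚ] MonoidAlgebra ℚ H)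
    (h : MinPres G m n s t) (h' : MinPres H m' n' s' t') (a b : ℕ → ℕ)
    (ha : ∀ ℓ, ℓ.Prime → ℓ ∣ Nat.card G → ¬ ℓ ∣ a ℓ)
    (hb : ∀ ℓ, ℓ.Prime → ℓ ∣ Nat.card G → ¬ ℓ ∣ b ℓ)
    (hlevel : ∀ ℓ i, ℓ.Prime → ℓ ^ i ∣ Nat.card G →
      (a ℓ ≡ 1 [MOD ℓ ^ i] ↔ b ℓ ≡ 1 [MOD ℓ ^ i]))
    (hact : ∀ ℓ, ℓ.Prime → ℓ ∣ Nat.card G →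
      (a ℓ + 1 = ℓ ^ Nat.card G ∧ b ℓ + 1 = ℓ ^ Nat.card G ∧
        (ℓ ∣ m → t ≡ 1 [MOD ℓ]) ∧ (ℓ ∣ m' → t' ≡ 1 [MOD ℓ])) ∨
      (∀ i, (ℓ ^ i ∣ m → t ≡ a ℓ [MOD ℓ ^ i]) ∧ (ℓ ^ i ∣ m' → t' ≡ b ℓ [MOD ℓ ^ i]))) :
    ∃ k k', 2 ≤ k ∧ 2 ≤ k' ∧
      (∀ ℓ, ℓ.Prime → ℓ ∣ Nat.card G → k ≡ a ℓ [MOD ℓ ^ Nat.card G]) ∧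
      (∀ ℓ, ℓ.Prime → ℓ ∣ Nat.card G → k' ≡ b ℓ [MOD ℓ ^ Nat.card G]) ∧
      (∀ d, Feasible m n s t k d → ∃ j, t ^ j ≡ k' [MOD d]) ∧
      (∀ d, Feasible m' n' s' t' k' d → ∃ j, t' ^ j ≡ k [MOD d]) := by
  have hcard := card_eq_of_algEquiv e
  have hN : ∀ ℓ i, ℓ.Prime → ℓ ^ i ∣ Nat.card G → i ≤ Nat.card G := fun ℓ i hℓ hi =>
    (Nat.lt_pow_self hℓ.one_lt).le.trans (Nat.le_of_dvd Nat.card_pos hi)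
  obtain ⟨k, hk, hs⟩ := exists_sameCount e h.pres h'.pres (Nat.card G) a
    fun ℓ hℓ => ha ℓ (Nat.prime_of_mem_primeFactors hℓ) (Nat.dvd_of_mem_primeFactors hℓ)
  obtain ⟨k', hk', hs'⟩ := exists_sameCount e h.pres h'.pres (Nat.card G) b
    fun ℓ hℓ => hb ℓ (Nat.prime_of_mem_primeFactors hℓ) (Nat.dvd_of_mem_primeFactors hℓ)
  have hk : ∀ ℓ, ℓ.Prime → ℓ ∣ Nat.card G → k ≡ a ℓ [MOD ℓ ^ Nat.card G] := fun ℓ hℓ hd =>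
    hk ℓ (Nat.mem_primeFactors.2 ⟨hℓ, hd, Nat.card_pos.ne'⟩)
  have hk' : ∀ ℓ, ℓ.Prime → ℓ ∣ Nat.card G → k' ≡ b ℓ [MOD ℓ ^ Nat.card G] := fun ℓ hℓ hd =>
    hk' ℓ (Nat.mem_primeFactors.2 ⟨hℓ, hd, Nat.card_pos.ne'⟩)
  have hgcd : (Nat.card G).gcd (k - 1) = (Nat.card G).gcd (k' - 1) := by
    refine gcd_eq_gcd_of_prime_pow fun ℓ i hℓ hi => ?_
    rcases Nat.eq_zero_or_pos i with rfl | hi0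
    · simp
    have hd : ℓ ∣ Nat.card G := (dvd_pow_self ℓ hi0.ne').trans hi
    have h1 := (hk ℓ hℓ hd).of_dvd (pow_dvd_pow ℓ (hN ℓ i hℓ hi))
    have h2 := (hk' ℓ hℓ hd).of_dvd (pow_dvd_pow ℓ (hN ℓ i hℓ hi))
    rw [← Nat.modEq_iff_dvd' (by linarith [hs.1]), ← Nat.modEq_iff_dvd' (by linarith [hs'.1]),
      Nat.ModEq.comm, Nat.ModEq.comm (a := 1)]
    exact ⟨fun h => h2.trans ((hlevel ℓ i hℓ hi).1 (h1.symm.trans h)),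
      fun h => h1.trans ((hlevel ℓ i hℓ hi).2 (h2.symm.trans h))⟩
  have hj : ∀ d, d ∣ m → (∃ j, t ^ j ≡ k' [MOD d]) → t ≡ k [MOD d] := by
    rintro d hd ⟨j, hj⟩
    refine modEq_of_forall_prime_pow fun ℓ i hℓ hi hi0 => ?_
    have him := hi.trans hd
    have hiG : ℓ ^ i ∣ Nat.card G := h.pres.card ▸ him.mul_right n
    have hdG : ℓ ∣ Nat.card G := (dvd_pow_self ℓ hi0.ne').trans hiG
    have hiN := pow_dvd_pow ℓ (hN ℓ i hℓ hiG)
    have h1 := (hk ℓ hℓ hdG).of_dvd hiN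
    rcases hact ℓ hℓ hdG with ⟨h2, h3, h4, -⟩ | h2
    · have h5 : ℓ ^ i ∣ k' + 1 :=
        ((((hk' ℓ hℓ hdG).of_dvd hiN).add_right 1).dvd_iff dvd_rfl).2 (h3 ▸ hiN)
      obtain ⟨rfl, h6⟩ := eq_two_of_pow_modEq hℓ hi0 (h4 ((dvd_pow_self ℓ hi0.ne').trans him))
        (hj.of_dvd hi) h5
      have h7 : 2 ^ i ∣ k + 1 := ((h1.add_right 1).dvd_iff dvd_rfl).2 (h2 ▸ hiN)
      exact Nat.ModEq.add_right_cancel' 1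
        ((Nat.modEq_zero_iff_dvd.2 h6).trans (Nat.modEq_zero_iff_dvd.2 h7).symm)
    · exact ((h2 i).1 him).trans h1.symm
  have hj' : ∀ d, d ∣ m' → (∃ j, t' ^ j ≡ k [MOD d]) → t' ≡ k' [MOD d] := by
    rintro d hd ⟨j, hj⟩
    refine modEq_of_forall_prime_pow fun ℓ i hℓ hi hi0 => ?_
    have him := hi.trans hd
    have hiG : ℓ ^ i ∣ Nat.card G := hcard ▸ h'.pres.card ▸ him.mul_right n'
    have hdG : ℓ ∣ Nat.card G := (dvd_pow_self ℓ hi0.ne').trans hiG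
    have hiN := pow_dvd_pow ℓ (hN ℓ i hℓ hiG)
    have h1 := (hk' ℓ hℓ hdG).of_dvd hiN
    rcases hact ℓ hℓ hdG with ⟨h2, h3, -, h4⟩ | h2
    · have h5 : ℓ ^ i ∣ k + 1 :=
        ((((hk ℓ hℓ hdG).of_dvd hiN).add_right 1).dvd_iff dvd_rfl).2 (h2 ▸ hiN)
      obtain ⟨rfl, h6⟩ := eq_two_of_pow_modEq hℓ hi0 (h4 ((dvd_pow_self ℓ hi0.ne').trans him))
        (hj.of_dvd hi) h5
      have h7 : 2 ^ i ∣ k' + 1 := ((h1.add_right 1).dvd_iff dvd_rfl).2 (h3 ▸ hiN)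
      exact Nat.ModEq.add_right_cancel' 1
        ((Nat.modEq_zero_iff_dvd.2 h6).trans (Nat.modEq_zero_iff_dvd.2 h7).symm)
    · exact ((h2 i).2 him).trans h1.symm
  have hs₁ : SameCount (Nat.card H) m' n' s' t' m n s t k := hcard ▸ hs.symm
  have hs₁' : SameCount (Nat.card H) m' n' s' t' m n s t k' := hcard ▸ hs'.symm
  exact ⟨k, k', hs.1, hs'.1, hk, hk',
    fun d hd => hs.exists_pow_modEq_of_coupled hs' hcard h h' hgcd hj hj' hd,
    fun d hd => hs₁'.exists_pow_modEq_of_coupled hs₁ hcard.symm h' h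
      (hcard ▸ hgcd.symm) hj' hj hd⟩

theorem MinPres.conj_add (h : MinPres G m n s t) {u : ℕ} (hu : HasPres G m n s u) :
    MinPres G m n s (u + 2 * m) where
  pres := hu.congr_conj (by simp [Nat.ModEq])
  minimal := h.minimal
  dvd := h.dvd
  one_lt := by have := h.pos_left; omega

theorem IsActPart.congr_conj (hc : IsActPart c m t) {u : ℕ}
    (hu : ∀ ℓ, ℓ.Prime → ℓ ∣ m → (t ≡ 1 [MOD ℓ] ↔ u ≡ 1 [MOD ℓ])) : IsActPart c m u where
  dvd := hc.dvd
  pow_dvd := hc.pow_dvd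
  modEq_one ℓ hℓ hd hn := (hu ℓ hℓ hd).1 (hc.modEq_one ℓ hℓ hd hn)
  not_modEq_one ℓ hℓ hd := fun h =>
    hc.not_modEq_one ℓ hℓ hd ((hu ℓ hℓ (hd.trans hc.dvd)).2 h)

theorem exists_matchedPres (e : MonoidAlgebra ℚ G ≃ₐ[ℚ] MonoidAlgebra ℚ H)
    (h : MinPres G m n s t) (h' : MinPres H m' n' s' t') (hc : IsActPart c m t) :
    ∃ u, MatchedPres G H {q | q ∣ c} c m n s u m' n' s' t' := by
  have hcard := card_eq_of_algEquiv e
  have hc' := hc.congr_left e h h'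
  have hcG : c ∣ Nat.card G := h.pres.card ▸ hc.dvd.mul_right n
  have hc0 : 0 < c := Nat.pos_of_dvd_of_pos hc.dvd h.pos_left
  have hN0 : Nat.card G ≠ 0 := Nat.card_pos.ne'
  have hkill : ∀ ℓ, ℓ.Prime → ¬ ℓ ∣ ℓ ^ Nat.card G - 1 := fun ℓ hℓ hd => by
    have h1 := (Nat.dvd_sub_iff_right (Nat.one_le_pow _ _ hℓ.pos) (dvd_pow_self ℓ hN0)).1 hd
    exact hℓ.one_lt.ne' (Nat.dvd_one.1 h1)
  obtain ⟨k, k', hk2, hk2', hk, hk', hF, hF'⟩ := exists_coupled e h h'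
    (fun ℓ => if ℓ ∣ c then t else ℓ ^ Nat.card G - 1)
    (fun ℓ => if ℓ ∣ c then t' else ℓ ^ Nat.card G - 1)
    (fun ℓ hℓ _ => by
      split_ifs with hd
      · exact fun h1 => Nat.not_coprime_of_dvd_of_dvd hℓ.one_lt h1 (hd.trans hc.dvd) h.pres.coprime
      · exact hkill ℓ hℓ)
    (fun ℓ hℓ _ => by
      split_ifs with hd
      · exact fun h1 => Nat.not_coprime_of_dvd_of_dvd hℓ.one_lt h1 (hd.trans hc'.dvd)
          h'.pres.coprime
      · exact hkill ℓ hℓ)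
    (fun ℓ i hℓ _ => by
      split_ifs with hd
      · rcases Nat.eq_zero_or_pos i with rfl | hi0
        · simp [Nat.modEq_one]
        · have hi := dvd_pow_self ℓ hi0.ne'
          exact iff_of_false (fun h1 => hc.not_modEq_one ℓ hℓ hd (h1.of_dvd hi))
            fun h1 => hc'.not_modEq_one ℓ hℓ hd (h1.of_dvd hi)
      · rfl)
    (fun ℓ hℓ _ => by
      by_cases hd : ℓ ∣ c
      · right
        simp [hd, Nat.ModEq.refl]
      · left
        have := Nat.sub_add_cancel (Nat.one_le_pow (Nat.card G) ℓ hℓ.pos)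
        simp only [hd, if_false, this, true_and]
        exact ⟨fun h1 => hc.modEq_one ℓ hℓ h1 hd, fun h1 => hc'.modEq_one ℓ hℓ h1 hd⟩)
  have hmod : ∀ {x y : ℕ}, (∀ ℓ, ℓ.Prime → ℓ ∣ Nat.card G →
      x ≡ (if ℓ ∣ c then y else ℓ ^ Nat.card G - 1) [MOD ℓ ^ Nat.card G]) → y ≡ x [MOD c] := by
    intro x y hxy
    refine modEq_of_forall_prime_pow fun ℓ i hℓ hi hi0 => ?_
    have hd := (dvd_pow_self ℓ hi0.ne').trans hi
    have h1 := hxy ℓ hℓ (hd.trans hcG)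
    rw [if_pos hd] at h1
    exact (h1.of_dvd (pow_dvd_pow ℓ ((Nat.lt_pow_self hℓ.one_lt).le.trans
      (Nat.le_of_dvd Nat.card_pos (hi.trans hcG))))).symm
  have htk := hmod hk
  have htk' := hmod hk'
  obtain ⟨j, hj⟩ := hF c ⟨hc.dvd, ⟨1, by simpa using htk⟩, mul_dvd_mul
    (hc.dvd_of_modEq h.pres.mul_modEq h.one_lt.le) (Nat.gcd_dvd_right _ _)⟩
  obtain ⟨j', hj'⟩ := hF' c ⟨hc'.dvd, ⟨1, by simpa using htk'⟩, mul_dvd_mul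
    (hc'.dvd_of_modEq h'.pres.mul_modEq h'.one_lt.le) (Nat.gcd_dvd_right _ _)⟩
  have hj : t ^ j ≡ t' [MOD c] := hj.trans htk'.symm
  have hj' : t' ^ j' ≡ t [MOD c] := hj'.trans htk.symm
  have hjD : j.Coprime (orderOf (t : ZMod c)) := by
    have h1 : t ^ (j * j') ≡ t ^ 1 [MOD c] := by
      rw [pow_mul, pow_one]
      exact (hj.pow j').trans hj'
    have h2 : ((ZMod.unitOfCoprime t (h.pres.coprime.coprime_dvd_right hc.dvd)) ^ (j * j')) =
        (ZMod.unitOfCoprime t (h.pres.coprime.coprime_dvd_right hc.dvd)) ^ 1 := by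
      ext
      rw [Units.val_pow_eq_pow_val, Units.val_pow_eq_pow_val, ZMod.coe_unitOfCoprime]
      exact_mod_cast (ZMod.natCast_eq_natCast_iff _ _ _).2 h1
    rw [pow_eq_pow_iff_modEq, ← orderOf_units, ZMod.coe_unitOfCoprime] at h2
    have h3 : (j * j').Coprime (orderOf (t : ZMod c)) := h2.gcd_eq.trans (Nat.gcd_one_left _)
    exact h3.coprime_dvd_left (dvd_mul_right j j')
  obtain ⟨i, hij, hiN⟩ := exists_coprime_modEq hjD
    ((h.orderOf_dvd hc.dvd).trans (h.pres.card ▸ dvd_mul_left n m)) Nat.card_pos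
  have hti : t ^ i ≡ t' [MOD c] := by
    refine Nat.ModEq.trans ?_ hj
    rw [← ZMod.natCast_eq_natCast_iff]
    push_cast
    rw [pow_eq_pow_of_modEq hij (pow_orderOf_eq_one _)]
  have hadd : t ^ i + 2 * m ≡ t ^ i [MOD m] := by simp [Nat.ModEq]
  have hui : ∀ {x}, x ∣ c → t ^ i + 2 * m ≡ t' [MOD x] := fun hx =>
    ((hadd.of_dvd hc.dvd).trans hti).of_dvd hx
  refine ⟨t ^ i + 2 * m, h.conj_add (h.pres.pow_conj hiN), h', hc.congr_conj fun ℓ hℓ hd => ?_, hc',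
    fun q _ hq => hq, ?_, ?_, ?_, ?_⟩
  · by_cases hℓc : ℓ ∣ c
    · exact iff_of_false (hc.not_modEq_one ℓ hℓ hℓc)
        fun h1 => hc'.not_modEq_one ℓ hℓ hℓc ((hui hℓc).symm.trans h1)
    · have h1 := hc.modEq_one ℓ hℓ hd hℓc
      exact iff_of_true h1 ((hadd.of_dvd hd).trans (by simpa using h1.pow i))
  all_goals
    intro q hq hq'
    have h1 := factorization_eq_of_not_modEq_one e h h' hq' (Dvd.dvd.trans hq hc.dvd)
      (hc.not_modEq_one q hq' hq)
  · exact h1.1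
  · exact h1.2.1
  · rw [h.factorization_eq_of_dvd hc hq' hq, h'.factorization_eq_of_dvd hc' hq' hq, h1.1]
  · exact hui (hc.pow_dvd q _ hq' hq (Nat.ordProj_dvd m q))

end Coupling

section Local

variable {m n s t m' n' s' t' c p q k v d N : ℕ} {S : Set ℕ} {H : Type*} [Group H]

/-- An exponent that is `1 + p ^ v` at `p`, trivial at `S`, and `-1` at all other primes. -/
structure LocalExp (N : ℕ) (S : Set ℕ) (p v k : ℕ) : Prop where
  two_le : 2 ≤ k
  mem : ∀ ℓ, ℓ.Prime → ℓ ∣ N → ℓ ∈ S → k ≡ 1 [MOD ℓ ^ N]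
  self : k ≡ 1 + p ^ v [MOD p ^ N]
  not_mem : ∀ ℓ, ℓ.Prime → ℓ ∣ N → ℓ ∉ S → ℓ ≠ p → ℓ ^ N ∣ k + 1

theorem LocalExp.factorization (hk : LocalExp N S p v k) (hp : p.Prime) (hv : v < N) :
    (k - 1).factorization p = v := by
  have hk2 := hk.two_le
  have h1 : k - 1 ≡ p ^ v [MOD p ^ N] := by
    refine Nat.ModEq.add_left_cancel' 1 ?_
    rw [Nat.add_sub_cancel' (by omega)]
    exact hk.self
  have h2 : ∀ j ≤ N, p ^ j ∣ k - 1 ↔ j ≤ v := fun j hj => by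
    rw [(h1.of_dvd (pow_dvd_pow p hj)).dvd_iff dvd_rfl, Nat.pow_dvd_pow_iff_le_right hp.one_lt]
  have h0 : k - 1 ≠ 0 := by omega
  refine le_antisymm ?_ ((hp.pow_dvd_iff_le_factorization h0).1 ((h2 v hv.le).2 le_rfl))
  by_contra hlt
  have := (h2 (v + 1) hv).1 ((hp.pow_dvd_iff_le_factorization h0).2 (by omega))
  omega

theorem LocalExp.factorization_eq_zero (hk : LocalExp N S p v k) (hq : q.Prime) (hqN : q ∣ N)
    (hqS : q ∉ S) (hqp : q ≠ p) (hq2 : q ≠ 2) (hN : N ≠ 0) : (k - 1).factorization q = 0 := by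
  refine Nat.factorization_eq_zero_of_not_dvd fun h1 => ?_
  have h2 := (dvd_pow_self q hN).trans (hk.not_mem q hq hqN hqS hqp)
  have h3 := (Nat.dvd_sub h2 h1)
  rw [show k + 1 - (k - 1) = 2 by have := hk.two_le; omega] at h3
  exact hq2 ((Nat.prime_dvd_prime_iff_eq hq Nat.prime_two).1 h3)

theorem exists_localExp [Finite G] [Finite H] (e : MonoidAlgebra ℚ G ≃ₐ[ℚ] MonoidAlgebra ℚ H)
    (h : HasPres G m n s t) (h' : HasPres H m' n' s' t') (S : Set ℕ) (hp : p.Prime)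
    (hpG : p ∣ Nat.card G) (hpS : p ∉ S) (hv : 1 ≤ v) :
    ∃ k, LocalExp (Nat.card G) S p v k ∧ SameCount (Nat.card G) m n s t m' n' s' t' k := by
  have hN0 : Nat.card G ≠ 0 := Nat.card_pos.ne'
  obtain ⟨k, hk, hs⟩ := exists_sameCount e h h' (Nat.card G)
    (fun ℓ => if ℓ ∈ S then 1 else if ℓ = p then 1 + p ^ v else ℓ ^ Nat.card G - 1)
    (fun ℓ hℓ => by
      have hℓ' := Nat.prime_of_mem_primeFactors hℓ
      split_ifs with h1 h2
      · exact fun h3 => hℓ'.one_lt.ne' (Nat.dvd_one.1 h3)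
      · subst h2
        exact fun h3 => hℓ'.one_lt.ne' (Nat.dvd_one.1
          ((Nat.dvd_add_left (dvd_pow_self ℓ (by omega : v ≠ 0))).1 h3))
      · intro hd
        have h1 := (Nat.dvd_sub_iff_right (Nat.one_le_pow _ _ hℓ'.pos) (dvd_pow_self ℓ hN0)).1 hd
        exact hℓ'.one_lt.ne' (Nat.dvd_one.1 h1))
  have hk : ∀ ℓ, ℓ.Prime → ℓ ∣ Nat.card G → _ := fun ℓ hℓ hd =>
    hk ℓ (Nat.mem_primeFactors.2 ⟨hℓ, hd, Nat.card_pos.ne'⟩)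
  refine ⟨k, ⟨hs.1, fun ℓ hℓ hd hS => ?_, ?_, fun ℓ hℓ hd hS hℓp => ?_⟩, hs⟩
  · simpa only [hS, if_true] using hk ℓ hℓ hd
  · simpa only [hpS, if_false, if_true] using hk p hp hpG
  · have h1 := hk ℓ hℓ hd
    simp only [hS, hℓp, if_false] at h1
    have h2 := h1.add_right 1
    rw [Nat.sub_add_cancel (Nat.one_le_pow _ _ hℓ.pos)] at h2
    exact (h2.dvd_iff dvd_rfl).2 dvd_rfl

theorem orderOf_natCast_eq (hiff : ∀ y, t ^ y ≡ 1 [MOD d] ↔ t' ^ y ≡ 1 [MOD d]) :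
    orderOf (t : ZMod d) = orderOf (t' : ZMod d) :=
  Nat.dvd_antisymm (orderOf_natCast_dvd_iff.2 ((hiff _).2 (orderOf_natCast_dvd_iff.1 dvd_rfl)))
    (orderOf_natCast_dvd_iff.2 ((hiff _).1 (orderOf_natCast_dvd_iff.1 dvd_rfl)))

namespace MatchedPres

theorem modEq_one (M : MatchedPres G H S c m n s t m' n' s' t') (hq : q.Prime) (hqm : q ∣ m)
    (hqS : q ∉ S) : t ≡ 1 [MOD q] :=
  M.actLeft.modEq_one q hq hqm fun h => hqS (M.mem q hq h)

theorem mem_or_eq (M : MatchedPres G H S c m n s t m' n' s' t') [Finite G]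
    (h2 : ∀ ℓ, ℓ.Prime → ℓ ∉ S → ℓ ≠ p → ℓ ≠ 2) (hk : LocalExp (Nat.card G) S p v k)
    (hd : d ∣ m) (hj : ∃ j, t ^ j ≡ k [MOD d]) (hq : q.Prime) (hqd : q ∣ d) : q ∈ S ∨ q = p := by
  by_contra! hn
  obtain ⟨j, hj⟩ := hj
  have hqm := hqd.trans hd
  have hqG : q ∣ Nat.card G := M.left.pres.card ▸ hqm.mul_right n
  refine h2 q hq hn.1 hn.2 (eq_two_of_pow_modEq hq (i := 1) one_pos (M.modEq_one hq hqm hn.1)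
    (hj.of_dvd (by rwa [pow_one])) ?_).1
  rw [pow_one]
  exact (dvd_pow_self q Nat.card_pos.ne').trans (hk.not_mem q hq hqG hn.1 hn.2)

/-- Comparison of contributions at an exponent concentrated at `p`: only conditions at `p` have
to be checked. -/
theorem feasible_of_le_at (M : MatchedPres G H S c m n s t m' n' s' t') [Finite G] [Finite H]
    (hcard : Nat.card G = Nat.card H) (hp : p.Prime) (hpS : p ∉ S)
    (h2 : ∀ ℓ, ℓ.Prime → ℓ ∉ S → ℓ ≠ p → ℓ ≠ 2) (hk : LocalExp (Nat.card G) S p v k)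
    (hv : v < Nat.card G) (hs : SameCount (Nat.card G) m n s t m' n' s' t' k)
    (hle : ∀ d, Feasible m n s t k d → d.factorization p ≤ m'.factorization p ∧
      (∃ i, t ≡ t' ^ i [MOD p ^ d.factorization p]) ∧
      (∃ i, t' ≡ t ^ i [MOD p ^ d.factorization p]) ∧
      (d.factorization p + min (n.factorization p - (orderOf (t' : ZMod d)).factorization p) v ≤
        s.factorization p + v →
      d.factorization p + min (n'.factorization p - (orderOf (t' : ZMod d)).factorization p) v ≤
        s'.factorization p + v ∧
      min (n.factorization p - (orderOf (t' : ZMod d)).factorization p) v ≤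
        min (n'.factorization p - (orderOf (t' : ZMod d)).factorization p) v))
    (hd : Feasible m' n' s' t' k d) :
    Feasible m n s t k d ∧
      min (n.factorization p - (orderOf (t' : ZMod d)).factorization p) v =
        min (n'.factorization p - (orderOf (t' : ZMod d)).factorization p) v := by
  have hkp := hk.factorization hp hv
  have key := hs.feasible_of_le hcard M.left M.right (fun d hd => ?_) hd
  · exact ⟨key.1, hkp ▸ key.2 p⟩
  obtain ⟨hpm, ⟨i, hi⟩, ⟨i', hi'⟩, hpsn⟩ := hle d hd
  have hmem := fun q => M.mem_or_eq (q := q) h2 hk hd.1 hd.2.1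
  have hd0 : d ≠ 0 := (Nat.pos_of_dvd_of_pos hd.1 M.left.pos_left).ne'
  have hfac : ∀ q, q.Prime → d.factorization q ≤ m'.factorization q := by
    intro q hq
    by_cases hqd : q ∣ d
    · rcases hmem q hq hqd with hS | rfl
      · rw [← M.eq_m q hS hq]
        exact (Nat.factorization_le_iff_dvd hd0 M.left.pos_left.ne').2 hd.1 q
      · exact hpm
    · simp [Nat.factorization_eq_zero_of_not_dvd hqd]
  have hdm' : d ∣ m' := (Nat.factorization_prime_le_iff_dvd hd0 M.right.pos_left.ne').1 hfac
  have hpp : ∀ ℓ i, ℓ.Prime → ℓ ^ i ∣ d → 0 < i →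
      (ℓ = p ∧ ℓ ^ i ∣ p ^ d.factorization p) ∨ (t ≡ t' [MOD ℓ ^ i] ∧ k ≡ 1 [MOD ℓ ^ i]) := by
    intro ℓ a hℓ ha ha0
    have hℓd := (dvd_pow_self ℓ ha0.ne').trans ha
    rcases hmem ℓ hℓ hℓd with hS | rfl
    · right
      have him := ha.trans hd.1
      have hiG : ℓ ^ a ∣ Nat.card G := M.left.pres.card ▸ him.mul_right n
      refine ⟨(M.modEq ℓ hS hℓ).of_dvd (pow_dvd_pow ℓ
        ((hℓ.pow_dvd_iff_le_factorization M.left.pos_left.ne').1 him)), ?_⟩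
      refine (hk.mem ℓ hℓ (hℓd.trans (hd.1.trans (M.left.pres.card ▸ dvd_mul_right m n)))
        hS).of_dvd (pow_dvd_pow ℓ ?_)
      exact (Nat.lt_pow_self hℓ.one_lt).le.trans (Nat.le_of_dvd Nat.card_pos hiG)
    · exact Or.inl ⟨rfl, pow_dvd_pow ℓ ((hℓ.pow_dvd_iff_le_factorization hd0).1 ha)⟩
  have hD : orderOf (t : ZMod d) = orderOf (t' : ZMod d) := by
    refine orderOf_natCast_eq fun y => ⟨fun h => ?_, fun h => ?_⟩
    · refine modEq_of_forall_prime_pow fun ℓ a hℓ ha ha0 => ?_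
      rcases hpp ℓ a hℓ ha ha0 with ⟨rfl, hdv⟩ | h3
      · refine ((hi'.of_dvd hdv).pow y).trans ?_
        rw [pow_right_comm]
        simpa using (h.of_dvd ha).pow i'
      · exact (h3.1.symm.pow y).trans (h.of_dvd ha)
    · refine modEq_of_forall_prime_pow fun ℓ a hℓ ha ha0 => ?_
      rcases hpp ℓ a hℓ ha ha0 with ⟨rfl, hdv⟩ | h3
      · refine ((hi.of_dvd hdv).pow y).trans ?_
        rw [pow_right_comm]
        simpa using (h.of_dvd ha).pow i
      · exact (h3.1.pow y).trans (h.of_dvd ha)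
  have hps := ((M.left.feasible_iff hk.two_le hd.1).1 hd).2 p hp
  rw [hkp, hD] at hps
  obtain ⟨hps, hpn⟩ := hpsn hps
  have hj : ∃ j, t' ^ j ≡ k [MOD d] := by
    obtain ⟨j, hj⟩ := hd.2.1
    refine ⟨i * j, modEq_of_forall_prime_pow fun ℓ a hℓ ha ha0 => ?_⟩
    rcases hpp ℓ a hℓ ha ha0 with ⟨rfl, hdv⟩ | h3
    · rw [pow_mul]
      exact ((hi.of_dvd hdv).symm.pow j).trans (hj.of_dvd ha)
    · refine Nat.ModEq.trans (h3.1.symm.pow _) (Nat.ModEq.trans ?_ h3.2.symm)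
      rw [mul_comm, pow_mul]
      simpa using ((hj.of_dvd ha).trans h3.2).pow i
  have hN0 : Nat.card G ≠ 0 := Nat.card_pos.ne'
  have hnG : ∀ q, ¬ q ∣ Nat.card G → n.factorization q = 0 ∧ n'.factorization q = 0 := by
    intro q hq
    refine ⟨Nat.factorization_eq_zero_of_not_dvd fun h => hq ?_,
      Nat.factorization_eq_zero_of_not_dvd fun h => hq ?_⟩
    · exact h.trans (M.left.pres.card ▸ dvd_mul_left n m)
    · exact h.trans (hcard ▸ M.right.pres.card ▸ dvd_mul_left n' m')
  refine ⟨(M.right.feasible_iff hk.two_le hdm').2 ⟨hj, fun q hq => ?_⟩, hD, fun q hq => ?_⟩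
  · by_cases hqS : q ∈ S
    · have := ((M.left.feasible_iff hk.two_le hd.1).1 hd).2 q hq
      rwa [M.eq_n q hqS hq, M.eq_s q hqS hq, hD] at this
    by_cases hqp : q = p
    · subst hqp
      rw [hkp]
      exact hps
    · have h3 : d.factorization q = 0 := Nat.factorization_eq_zero_of_not_dvd fun h =>
        (hmem q hq h).elim hqS hqp
      omega
  · by_cases hqS : q ∈ S
    · rw [M.eq_n q hqS hq]
    by_cases hqp : q = p
    · subst hqp
      rw [hkp]
      exact hpn
    by_cases hqG : q ∣ Nat.card G
    · simp [hk.factorization_eq_zero hq hqG hqS hqp (h2 q hq hqS hqp) hN0]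
    · simp [(hnG q hqG).1]

end MatchedPres

end Local

namespace MatchedPres

variable {m n s t m' n' s' t' c p q k v d N : ℕ} {S : Set ℕ} {H : Type*} [Group H]
  [Finite G]

theorem modEq_actPart (M : MatchedPres G H S c m n s t m' n' s' t') : t ≡ t' [MOD c] := by
  refine modEq_of_forall_prime_pow fun ℓ i hℓ hi hi0 => ?_
  exact (M.modEq ℓ (M.mem ℓ hℓ ((dvd_pow_self ℓ hi0.ne').trans hi)) hℓ).of_dvd (pow_dvd_pow ℓ
    ((hℓ.pow_dvd_iff_le_factorization M.left.pos_left.ne').1 (hi.trans M.actLeft.dvd)))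

theorem orderOf_eq (M : MatchedPres G H S c m n s t m' n' s' t') :
    orderOf (t : ZMod c) = orderOf (t' : ZMod c) := by
  rw [(ZMod.natCast_eq_natCast_iff _ _ _).2 M.modEq_actPart]

theorem exponent_modEq_one (M : MatchedPres G H S c m n s t m' n' s' t')
    (hk : LocalExp (Nat.card G) S p v k) : k ≡ 1 [MOD c] := by
  refine modEq_of_forall_prime_pow fun ℓ i hℓ hi hi0 => ?_
  have hiG : ℓ ^ i ∣ Nat.card G := hi.trans (M.actLeft.dvd.trans
    (M.left.pres.card ▸ dvd_mul_right m n))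
  have hℓi := dvd_pow_self ℓ hi0.ne'
  exact (hk.mem ℓ hℓ (hℓi.trans hiG) (M.mem ℓ hℓ (hℓi.trans hi))).of_dvd (pow_dvd_pow ℓ
    ((Nat.lt_pow_self hℓ.one_lt).le.trans (Nat.le_of_dvd Nat.card_pos hiG)))

variable [Finite H]

theorem trivExp_le_trivExp (M : MatchedPres G H S c m n s t m' n' s' t')
    (e : MonoidAlgebra ℚ G ≃ₐ[ℚ] MonoidAlgebra ℚ H) (hp : p.Prime) (hpS : p ∉ S)
    (h2 : ∀ ℓ, ℓ.Prime → ℓ ∉ S → ℓ ≠ p → ℓ ≠ 2) : trivExp m t p ≤ trivExp m' t' p := by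
  by_contra! hlt
  have hmin := min_trivExp_eq e M.left M.right hp
  have hadd := factorization_add_trivExp_eq e M.left M.right p
  obtain ⟨hrm, hrt⟩ := (le_trivExp_iff M.left.pos_left M.left.one_lt.le hp).1
    (le_refl (trivExp m t p))
  have hpm : p ∣ m := (dvd_pow_self p (by omega)).trans hrm
  have hlt_add := M.left.lt_add M.actLeft hp hrm hrt (by omega) (by omega)
  have ho := M.left.factorization_orderOf_le (p := p) M.actLeft.dvd
  have hpG : p ∣ Nat.card G := M.left.pres.card ▸ hpm.mul_right n
  set v := min (s.factorization p) (n.factorization p) with hvdef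
  have hvG : v < Nat.card G := (min_le_right _ _).trans_lt
    ((Nat.factorization_lt p M.left.pos_right.ne').trans_le
      (Nat.le_of_dvd Nat.card_pos (M.left.pres.card ▸ dvd_mul_left n m)))
  obtain ⟨k, hk, hs⟩ := exists_localExp (v := v) e M.left.pres M.right.pres S hp hpG hpS (by omega)
  have hm' := trivExp_le (t := t') (p := p) M.right.pos_left
  have hc : Feasible m' n' s' t' k c := ⟨M.actRight.dvd,
    ⟨0, by simpa using (M.exponent_modEq_one hk).symm⟩,
    mul_dvd_mul (M.actRight.dvd_of_modEq M.right.pres.mul_modEq M.right.one_lt.le)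
      (Nat.gcd_dvd_right _ _)⟩
  have key := M.feasible_of_le_at (card_eq_of_algEquiv e) hp hpS h2 hk hvG hs
    (fun d hd => ?_) hc
  · have heq := key.2
    rw [← M.orderOf_eq] at heq
    omega
  have hd0 : d ≠ 0 := (Nat.pos_of_dvd_of_pos hd.1 M.left.pos_left).ne'
  have hdv : d.factorization p ≤ v := by
    by_contra! hdv
    obtain ⟨j, hj⟩ := hd.2.1
    have h3 : t ^ j ≡ 1 [MOD p ^ (v + 1)] := by
      simpa using (hrt.of_dvd (pow_dvd_pow p (by omega : v + 1 ≤ trivExp m t p))).pow j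
    have h4 := hj.of_dvd ((pow_dvd_pow p hdv).trans (Nat.ordProj_dvd d p))
    have h5 := h3.symm.trans (h4.trans (hk.self.of_dvd (pow_dvd_pow p hvG)))
    have h6 := (Nat.modEq_iff_dvd' (by omega)).1 h5
    rw [Nat.add_sub_cancel_left, Nat.pow_dvd_pow_iff_le_right hp.one_lt] at h6
    omega
  have h3 := M.left.modEq_one_of_le hp (by omega : d.factorization p ≤ trivExp m t p)
  have h4 := M.right.modEq_one_of_le hp (by omega : d.factorization p ≤ trivExp m' t' p)
  exact ⟨by omega, ⟨1, by simpa using h3.trans h4.symm⟩, ⟨1, by simpa using h4.trans h3.symm⟩,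
    by omega⟩

theorem trivExp_eq (M : MatchedPres G H S c m n s t m' n' s' t')
    (e : MonoidAlgebra ℚ G ≃ₐ[ℚ] MonoidAlgebra ℚ H) (hp : p.Prime) (hpS : p ∉ S)
    (h2 : ∀ ℓ, ℓ.Prime → ℓ ∉ S → ℓ ≠ p → ℓ ≠ 2) : trivExp m t p = trivExp m' t' p :=
  (M.trivExp_le_trivExp e hp hpS h2).antisymm (M.symm.trivExp_le_trivExp e.symm hp hpS h2)

end MatchedPres

section TrivExp

variable {m n s t m' n' s' t' c p q k v d N : ℕ} {S : Set ℕ} {H : Type*} [Group H] [Finite G]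

theorem MinPres.exists_pow_modEq (h : MinPres G m n s t) (hp : p.Prime)
    (hr : p ≠ 2 ∨ 2 ≤ trivExp m t p ∨ trivExp m t p = m.factorization p)
    (hr1 : 1 ≤ trivExp m t p) {u x : ℕ} (hx : x ≤ m.factorization p)
    (hu : u ≡ 1 [MOD p ^ trivExp m t p]) : ∃ i, t ^ i ≡ u [MOD p ^ x] := by
  have ht := h.modEq_one_of_le hp le_rfl
  by_cases hrm : trivExp m t p = m.factorization p
  · refine ⟨1, ?_⟩
    rw [pow_one]
    exact (ht.trans hu.symm).of_dvd (pow_dvd_pow p (hrm ▸ hx))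
  · have hle := trivExp_le (t := t) (p := p) h.pos_left
    refine ArXiv230800432.exists_pow_modEq hp hr1 h.one_lt.le ht (fun h1 => ?_) (by tauto) hu x
    have := (le_trivExp_iff h.pos_left h.one_lt.le hp).2
      ⟨(pow_dvd_pow p (by omega)).trans (Nat.ordProj_dvd m p), h1⟩
    omega

theorem factorization_orderOf_le_sub (hp : p.Prime) {r x : ℕ} (hr : 1 ≤ r)
    (ht : t ≡ 1 [MOD p ^ r]) : (orderOf (t : ZMod (p ^ x))).factorization p ≤ x - r := by
  have h1 : t ^ p ^ (x - r) ≡ 1 [MOD p ^ x] :=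
    (pow_modEq_one_of_dvd hr ht (dvd_refl (p ^ (x - r)))).of_dvd (pow_dvd_pow p (by omega))
  have h2 := orderOf_natCast_dvd_iff.2 h1
  obtain ⟨y, hy, h3⟩ := (Nat.dvd_prime_pow hp).1 h2
  rw [h3, hp.factorization_pow, Finsupp.single_eq_same]
  exact hy

namespace MatchedPres

variable [Finite H]

theorem factorization_s_le (M : MatchedPres G H S c m n s t m' n' s' t')
    (e : MonoidAlgebra ℚ G ≃ₐ[ℚ] MonoidAlgebra ℚ H) (hp : p.Prime) (hpS : p ∉ S)
    (h2 : ∀ ℓ, ℓ.Prime → ℓ ∉ S → ℓ ≠ p → ℓ ≠ 2)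
    (hr : p ≠ 2 ∨ 2 ≤ trivExp m t p ∨ trivExp m t p = m.factorization p)
    (hrr : trivExp m t p = trivExp m' t' p) (hmm : m.factorization p = m'.factorization p)
    (hnn : n.factorization p = n'.factorization p)
    (hσ : s.factorization p = m.factorization p ∨ s.factorization p < n.factorization p) :
    s'.factorization p ≤ s.factorization p := by
  by_contra! hlt
  have hsm := M.right.factorization_le (p := p)
  have hmr := M.left.le_factorization_add p
  have hr1 : 1 ≤ trivExp m t p := by omega
  have hσ : s.factorization p < n.factorization p := by omega
  have ht := M.left.modEq_one_of_le hp le_rfl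
  have ht' := M.right.modEq_one_of_le hp le_rfl
  have hr' : p ≠ 2 ∨ 2 ≤ trivExp m' t' p ∨ trivExp m' t' p = m'.factorization p := by
    rwa [← hrr, ← hmm]
  set x := s.factorization p + 1 with hx
  set r := trivExp m t p with hrdef
  set v := min x r with hv
  have hpm : p ∣ m := (hp.dvd_iff_one_le_factorization M.left.pos_left.ne').2 (by omega)
  have hpG : p ∣ Nat.card G := M.left.pres.card ▸ hpm.mul_right n
  have hxG : x < Nat.card G := by
    refine (Nat.factorization_lt p M.left.pos_left.ne').trans_le'
      (by omega : x ≤ m.factorization p) |>.trans_le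
      (Nat.le_of_dvd Nat.card_pos (M.left.pres.card ▸ dvd_mul_right m n))
  have hvG : v < Nat.card G := by omega
  obtain ⟨k, hk, hs⟩ := exists_localExp (v := v) e M.left.pres M.right.pres S hp hpG hpS (by omega)
  have hxm' : p ^ x ∣ m' := (hp.pow_dvd_iff_le_factorization M.right.pos_left.ne').2 (by omega)
  have hfac : (p ^ x).factorization p = x := by simp [hp.factorization_pow]
  have hf : Feasible m' n' s' t' k (p ^ x) := by
    refine (M.right.feasible_iff hk.two_le hxm').2 ⟨?_, fun q _ => ?_⟩
    · have h3 := hk.self.of_dvd (pow_dvd_pow p hxG.le)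
      by_cases hxr : x ≤ r
      · refine ⟨0, ?_⟩
        rw [hv, min_eq_left hxr] at h3
        simpa using h3.symm
      · rw [hv, min_eq_right (by omega)] at h3
        obtain ⟨i, hi⟩ := M.right.exists_pow_modEq hp hr' (by omega) (u := 1 + p ^ r)
          (by omega : x ≤ _) (by rw [← hrr]; simp [Nat.ModEq])
        exact ⟨i, hi.trans h3.symm⟩
    · by_cases hqp : q = p
      · subst hqp
        omega
      · simp [hp.factorization_pow, Ne.symm hqp]
  have key := M.feasible_of_le_at (card_eq_of_algEquiv e) hp hpS h2 hk hvG hs (fun d hd => ?_) hf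
  · have h3 := ((M.left.feasible_iff hk.two_le key.1.1).1 key.1).2 p hp
    rw [hk.factorization hp hvG, hfac] at h3
    have h4 := factorization_orderOf_le_sub hp hr1 ht (x := x)
    omega
  · have hd0 : d ≠ 0 := (Nat.pos_of_dvd_of_pos hd.1 M.left.pos_left).ne'
    have hdm := (Nat.factorization_le_iff_dvd hd0 M.left.pos_left.ne').2 hd.1 p
    obtain ⟨i, hi⟩ := M.left.exists_pow_modEq hp hr hr1 hdm (hrr ▸ ht')
    obtain ⟨i', hi'⟩ := M.right.exists_pow_modEq hp hr' (by omega) (hmm ▸ hdm) (hrr ▸ ht)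
    exact ⟨by omega, ⟨i', hi'.symm⟩, ⟨i, hi.symm⟩, by omega⟩

end MatchedPres

end TrivExp

section Replace

variable {m n s t u m' n' s' t' c p q j x : ℕ} {S : Set ℕ} {H : Type*} [Group H] [Finite G]

theorem pow_dvd_of_dvd_pow_mul (hp : p.Prime) (hq : q.Prime) (hqp : q ≠ p) {a i M : ℕ}
    (h : q ^ i ∣ p ^ a * M) : q ^ i ∣ M :=
  (Nat.Coprime.pow i a ((Nat.coprime_primes hq hp).2 hqp)).dvd_of_dvd_mul_left h

/-- The `p`-part of `s` can be enlarged to that of `m` unless the geometric sum obstructs it. -/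
theorem MinPres.exists_factorization_eq (h : MinPres G m n s t) (hp : p.Prime)
    (hT : ¬ p ^ (s.factorization p + 1) ∣ ∑ k ∈ Finset.range n, t ^ k) :
    ∃ s₂, MinPres G m n s₂ t ∧ s₂.factorization p = m.factorization p ∧
      ∀ q, q.Prime → q ≠ p → s₂.factorization q = s.factorization q := by
  set T := ∑ k ∈ Finset.range n, t ^ k with hTdef
  have hT0 : 0 < T := Nat.pos_of_ne_zero fun h0 => hT (h0 ▸ dvd_zero _)
  obtain ⟨T', hTT', hpT', -⟩ := exists_eq_pow_mul hp hT0
  have hβ : T.factorization p ≤ s.factorization p := by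
    by_contra hlt
    exact hT ((hp.pow_dvd_iff_le_factorization hT0.ne').2 (by omega))
  obtain ⟨s₁, hs₁⟩ := (hp.pow_dvd_iff_le_factorization h.ne_zero).2 hβ
  obtain ⟨M, hmM, hpM, hM0⟩ := exists_eq_pow_mul hp h.pos_left
  have hpos := Nat.pow_pos (n := m.factorization p) hp.pos
  obtain ⟨x, hx⟩ := exists_mul_modEq (a := M * T') (M := p ^ m.factorization p)
    ((p ^ m.factorization p - 1) * s₁)
    (Nat.Coprime.pow_right _ ((hp.coprime_iff_not_dvd.2 (fun h1 =>
      ((hp.dvd_mul).1 h1).elim hpM hpT')).symm)) hpos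
  have hs2 := h.pres.add_geomSum (M * x)
  rw [← hTdef] at hs2
  set s₃ := s + M * x * T with hs₃
  have hpd : p ^ m.factorization p ∣ s₃ := by
    have h1 : s₃ = p ^ T.factorization p * (M * T' * x + s₁) := by
      rw [hs₃]
      nth_rewrite 1 [hs₁]
      nth_rewrite 2 [hTT']
      ring
    rw [h1]
    refine Dvd.dvd.mul_left ?_ _
    refine ((hx.add_right s₁).dvd_iff dvd_rfl).2 ?_
    rw [Nat.sub_mul, one_mul, Nat.sub_add_cancel (Nat.le_mul_of_pos_left _ hpos)]
    exact dvd_mul_right _ _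
  have hg0 : s₃.gcd m ≠ 0 := (Nat.gcd_pos_of_pos_right _ h.pos_left).ne'
  refine ⟨s₃.gcd m, ⟨hs2.of_gcd_eq (by simp), h.minimal, Nat.gcd_dvd_right _ _, h.one_lt⟩, ?_, ?_⟩
  · refine le_antisymm ((Nat.factorization_le_iff_dvd hg0 h.pos_left.ne').2
      (Nat.gcd_dvd_right _ _) p) ?_
    rw [← hp.pow_dvd_iff_le_factorization hg0]
    exact Nat.dvd_gcd hpd (Nat.ordProj_dvd m p)
  · intro q hq hqp
    refine eq_of_forall_le_iff fun i => ?_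
    rw [← hq.pow_dvd_iff_le_factorization hg0, ← hq.pow_dvd_iff_le_factorization h.ne_zero,
      Nat.dvd_gcd_iff]
    have key : q ^ i ∣ m → (q ^ i ∣ s₃ ↔ q ^ i ∣ s) := fun hi => by
      rw [hmM] at hi
      have := pow_dvd_of_dvd_pow_mul hp hq hqp hi
      rw [hs₃, mul_assoc]
      exact (Nat.dvd_add_iff_left (this.mul_right _)).symm
    exact ⟨fun h1 => (key h1.2).1 h1.1, fun h1 => ⟨(key (h1.trans h.dvd)).2 h1, h1.trans h.dvd⟩⟩

theorem MinPres.factorization_lt_of_dvd_geomSum (h : MinPres G m n s t) (hp : p.Prime)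
    (hr : p ≠ 2 ∨ 2 ≤ trivExp m t p ∨ trivExp m t p = m.factorization p)
    (hr1 : 1 ≤ trivExp m t p) (hσ : s.factorization p < m.factorization p)
    (hd : p ^ (s.factorization p + 1) ∣ ∑ k ∈ Finset.range n, t ^ k) :
    s.factorization p < n.factorization p := by
  rw [← Nat.succ_le_iff, Nat.succ_eq_add_one]
  by_cases hrm : trivExp m t p = m.factorization p
  · rw [← hp.pow_dvd_iff_le_factorization h.pos_right.ne']
    refine ((geomSum_modEq (h.modEq_one_of_le hp (by omega :
      s.factorization p + 1 ≤ trivExp m t p)) n).dvd_iff dvd_rfl).1 hd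
  · have h4 : p ≠ 2 ∨ t ≡ 1 [MOD 4] ∨ ¬ p ∣ n := by
      rcases eq_or_ne p 2 with rfl | h2
      · have : 2 ≤ trivExp m t 2 := by tauto
        exact Or.inr (Or.inl (h.modEq_one_of_le Nat.prime_two this))
      · exact Or.inl h2
    have ht1 := h.modEq_one_of_le hp hr1
    rw [pow_one] at ht1
    rw [← factorization_geomSum hp ht1 h4 h.pos_right h.one_lt.le]
    refine (hp.pow_dvd_iff_le_factorization ?_).1 hd
    refine (Finset.sum_pos (fun k _ => Nat.pow_pos (by have := h.one_lt; omega)) ?_).ne'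
    simpa using h.pos_right.ne'

/-- Powers of `t` realizable by a change of generators, prescribed at `p` and trivial elsewhere. -/
theorem MinPres.exists_coprime_pow (h : MinPres G m n s t) (hc : IsActPart c m t) (hp : p.Prime)
    (hpm : p ∣ m) (ht : t ≡ 1 [MOD p]) (hpj : ¬ p ∣ j) (hj : t ^ j ≡ t [MOD c]) :
    ∃ i, i.Coprime (Nat.card G) ∧ t ^ i ≡ t ^ j [MOD p ^ m.factorization p] ∧
      ∀ q a, q.Prime → q ≠ p → q ^ a ∣ m → t ^ i ≡ t [MOD q ^ a] := by
  have hmG : m ∣ Nat.card G := h.pres.card ▸ dvd_mul_right m n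
  obtain ⟨R, hGR, hpR, hR0⟩ := exists_eq_pow_mul hp (Nat.card_pos (α := G))
  set P := p ^ (Nat.card G).factorization p with hP
  have hPR : P.Coprime R := Nat.Coprime.pow_left _ (hp.coprime_iff_not_dvd.2 hpR)
  obtain ⟨i, hiP, hiR⟩ := Nat.chineseRemainder hPR j 1
  have hμ : m.factorization p ≤ (Nat.card G).factorization p :=
    (Nat.factorization_le_iff_dvd h.pos_left.ne' Nat.card_pos.ne').2 hmG p
  have hμ1 : 1 ≤ m.factorization p :=
    (hp.dvd_iff_one_le_factorization h.pos_left.ne').1 hpm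
  have hpow : ∀ {a b M : ℕ}, a ≡ b [MOD orderOf (t : ZMod M)] → t ^ a ≡ t ^ b [MOD M] := by
    intro a b M hab
    rw [← ZMod.natCast_eq_natCast_iff]
    push_cast
    exact pow_eq_pow_of_modEq hab (pow_orderOf_eq_one _)
  refine ⟨i, ?_, hpow (hiP.of_dvd (orderOf_natCast_dvd_iff.2 ?_)), ?_⟩
  · rw [hGR]
    refine Nat.Coprime.mul_right (Nat.Coprime.pow_right _ ?_) ?_
    · refine (hp.coprime_iff_not_dvd.2 fun h1 => hpj ?_).symm
      exact ((hiP.of_dvd (dvd_pow_self p (by omega))).dvd_iff dvd_rfl).1 h1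
    · exact hiR.gcd_eq.trans (Nat.gcd_one_left _)
  · exact (pow_modEq_one_of_dvd le_rfl (by simpa using ht)
      (pow_dvd_pow p hμ)).of_dvd (pow_dvd_pow p (by omega))
  · intro q a hq hqp hqa
    nth_rewrite 2 [← pow_one t]
    refine hpow (modEq_of_forall_prime_pow fun ℓ b hℓ hb hb0 => ?_)
    have hbG : ℓ ^ b ∣ Nat.card G := hb.trans ((h.orderOf_dvd hqa).trans
      (h.pres.card ▸ dvd_mul_left n m))
    by_cases hℓp : ℓ = p
    · subst hℓp
      have h1 := pow_dvd_of_dvd_pow_mul hq hℓ hqp.symm (mul_comm _ (q ^ a) ▸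
        hb.trans (hc.orderOf_dvd hqa))
      have h2 : j ≡ 1 [MOD orderOf (t : ZMod c)] := by
        have h3 : (ZMod.unitOfCoprime t (h.pres.coprime.coprime_dvd_right hc.dvd)) ^ j =
            (ZMod.unitOfCoprime t (h.pres.coprime.coprime_dvd_right hc.dvd)) ^ 1 := by
          ext
          rw [Units.val_pow_eq_pow_val, Units.val_pow_eq_pow_val, ZMod.coe_unitOfCoprime, pow_one]
          exact_mod_cast (ZMod.natCast_eq_natCast_iff _ _ _).2 hj
        rwa [pow_eq_pow_iff_modEq, ← orderOf_units, ZMod.coe_unitOfCoprime] at h3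
      refine (hiP.of_dvd (pow_dvd_pow ℓ ?_)).trans (h2.of_dvd h1)
      exact (hℓ.pow_dvd_iff_le_factorization Nat.card_pos.ne').1 hbG
    · refine hiR.of_dvd (pow_dvd_of_dvd_pow_mul hp hℓ hℓp (hGR ▸ hbG))

namespace MatchedPres

theorem replace_conj (M : MatchedPres G H S c m n s t m' n' s' t') (hp : p.Prime) (hpS : p ∉ S)
    (hu : HasPres G m n s u) (hq : ∀ q a, q.Prime → q ≠ p → q ^ a ∣ m → u ≡ t [MOD q ^ a])
    (hup : p ∣ m → u ≡ 1 [MOD p]) : MatchedPres G H S c m n s (u + 2 * m) m' n' s' t' where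
  left := M.left.conj_add hu
  right := M.right
  actLeft := M.actLeft.congr_conj fun ℓ hℓ hd => by
    have h1 : u + 2 * m ≡ u [MOD ℓ] := (show u + 2 * m ≡ u [MOD m] by simp [Nat.ModEq]).of_dvd hd
    by_cases hℓp : ℓ = p
    · subst hℓp
      exact iff_of_true (M.modEq_one hℓ hd hpS) (h1.trans (hup hd))
    · have h2 := hq ℓ 1 hℓ hℓp (by simpa using hd)
      rw [pow_one] at h2
      exact ⟨fun h3 => h1.trans (h2.trans h3), fun h3 => (h1.trans h2).symm.trans h3⟩
  actRight := M.actRight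
  mem := M.mem
  eq_m := M.eq_m
  eq_n := M.eq_n
  eq_s := M.eq_s
  modEq q hqS hq' := by
    have hd := Nat.ordProj_dvd m q
    exact (((show u + 2 * m ≡ u [MOD m] by simp [Nat.ModEq]).of_dvd hd).trans
      (hq q _ hq' (fun h => hpS (h ▸ hqS)) hd)).trans (M.modEq q hqS hq')

/-- Normalization of `s` at `p`. -/
theorem exists_normalized (M : MatchedPres G H S c m n s t m' n' s' t') (hp : p.Prime)
    (hpS : p ∉ S) : ∃ s₂, MatchedPres G H S c m n s₂ t m' n' s' t' ∧
      (s₂.factorization p = m.factorization p ∨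
        p ^ (s₂.factorization p + 1) ∣ ∑ k ∈ Finset.range n, t ^ k) := by
  by_cases hT : p ^ (s.factorization p + 1) ∣ ∑ k ∈ Finset.range n, t ^ k
  · exact ⟨s, M, Or.inr hT⟩
  obtain ⟨s₂, h, h1, h2⟩ := M.left.exists_factorization_eq hp hT
  exact ⟨s₂, ⟨h, M.right, M.actLeft, M.actRight, M.mem, M.eq_m, M.eq_n, fun q hq hq' =>
    (h2 q hq' fun h => hpS (h ▸ hq)).trans (M.eq_s q hq hq'), M.modEq⟩, Or.inl h1⟩

end MatchedPres

end Replace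

namespace MatchedPres

variable {m n s t u m' n' s' t' c p q j x : ℕ} {S : Set ℕ} {H : Type*} [Group H]

theorem insert (M : MatchedPres G H S c m n s t m' n' s' t')
    (hm : p.Prime → m.factorization p = m'.factorization p)
    (hn : p.Prime → n.factorization p = n'.factorization p)
    (hs : p.Prime → s.factorization p = s'.factorization p)
    (ht : p.Prime → t ≡ t' [MOD p ^ m.factorization p]) :
    MatchedPres G H (insert p S) c m n s t m' n' s' t' where
  left := M.left
  right := M.right
  actLeft := M.actLeft
  actRight := M.actRight
  mem q hq hd := Set.mem_insert_of_mem _ (M.mem q hq hd)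
  eq_m q hq hq' := (Set.mem_insert_iff.1 hq).elim (fun h => h ▸ hm (h ▸ hq')) (M.eq_m q · hq')
  eq_n q hq hq' := (Set.mem_insert_iff.1 hq).elim (fun h => h ▸ hn (h ▸ hq')) (M.eq_n q · hq')
  eq_s q hq hq' := (Set.mem_insert_iff.1 hq).elim (fun h => h ▸ hs (h ▸ hq')) (M.eq_s q · hq')
  modEq q hq hq' := (Set.mem_insert_iff.1 hq).elim (fun h => h ▸ ht (h ▸ hq')) (M.modEq q · hq')

theorem not_dvd_actPart (M : MatchedPres G H S c m n s t m' n' s' t') (hp : p.Prime)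
    (hpS : p ∉ S) : ¬ p ∣ c := fun h => hpS (M.mem p hp h)

theorem mul_dvd (M : MatchedPres G H S c m n s t m' n' s' t') (hp : p.Prime)
    (hpS : p ∉ S) (hx : x ≤ m.factorization p) : c * p ^ x ∣ m :=
  Nat.Coprime.mul_dvd_of_dvd_of_dvd
    (Nat.Coprime.pow_right _ (hp.coprime_iff_not_dvd.2 (M.not_dvd_actPart hp hpS)).symm)
    M.actLeft.dvd ((pow_dvd_pow p hx).trans (Nat.ordProj_dvd m p))

variable [Finite G] [Finite H]

theorem exists_pow_modEq_mul (M : MatchedPres G H S c m n s t m' n' s' t')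
    (e : MonoidAlgebra ℚ G ≃ₐ[ℚ] MonoidAlgebra ℚ H) (hp : p.Prime) (hpS : p ∉ S)
    (hr : trivExp m t p = trivExp m' t' p) (hlt : trivExp m t p < m.factorization p)
    (hμ : m.factorization p = m'.factorization p) (hx : x ≤ m.factorization p)
    (hle : x + min (n.factorization p - (orderOf (t : ZMod (c * p ^ x))).factorization p)
      (trivExp m t p) ≤ s.factorization p + trivExp m t p) :
    ∃ j, t ^ j ≡ t [MOD c] ∧ t ^ j ≡ t' [MOD p ^ x] := by
  have hcard := card_eq_of_algEquiv e
  have hm0 := M.left.pos_left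
  have hm0' := M.right.pos_left
  have hmG : m ∣ Nat.card G := M.left.pres.card ▸ dvd_mul_right m n
  have hN0 : Nat.card G ≠ 0 := Nat.card_pos.ne'
  have hpm : p ∣ m := (hp.dvd_iff_one_le_factorization hm0.ne').2 (by omega)
  have hpm' : p ∣ m' := (hp.dvd_iff_one_le_factorization hm0'.ne').2 (by omega)
  have hSdvd : ∀ ℓ, ℓ.Prime → ℓ ∈ S → (ℓ ∣ m ↔ ℓ ∣ m') := fun ℓ hℓ hS => by
    rw [hℓ.dvd_iff_one_le_factorization hm0.ne', hℓ.dvd_iff_one_le_factorization hm0'.ne',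
      M.eq_m ℓ hS hℓ]
  have hcop : ∀ ℓ, ℓ.Prime → ℓ ∣ m → ¬ ℓ ∣ t := fun ℓ hℓ hd h1 =>
    Nat.not_coprime_of_dvd_of_dvd hℓ.one_lt h1 hd M.left.pres.coprime
  have hcop' : ∀ ℓ, ℓ.Prime → ℓ ∣ m' → ¬ ℓ ∣ t' := fun ℓ hℓ hd h1 =>
    Nat.not_coprime_of_dvd_of_dvd hℓ.one_lt h1 hd M.right.pres.coprime
  have hkill : ∀ ℓ, ℓ.Prime → ¬ ℓ ∣ ℓ ^ Nat.card G - 1 := fun ℓ hℓ hd => by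
    have h1 := (Nat.dvd_sub_iff_right (Nat.one_le_pow _ _ hℓ.pos) (dvd_pow_self ℓ hN0)).1 hd
    exact hℓ.one_lt.ne' (Nat.dvd_one.1 h1)
  have ht := M.left.modEq_one_of_le hp le_rfl
  have ht' := hr ▸ M.right.modEq_one_of_le hp le_rfl
  have hnt : ¬ t ≡ 1 [MOD p ^ (trivExp m t p + 1)] := fun h1 => by
    have := (le_trivExp_iff hm0 M.left.one_lt.le hp).2
      ⟨(pow_dvd_pow p hlt).trans (Nat.ordProj_dvd m p), h1⟩
    omega
  have hnt' : ¬ t' ≡ 1 [MOD p ^ (trivExp m t p + 1)] := fun h1 => by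
    have := (le_trivExp_iff hm0' M.right.one_lt.le hp).2
      ⟨(pow_dvd_pow p (hμ ▸ hlt)).trans (Nat.ordProj_dvd m' p), h1⟩
    omega
  obtain ⟨k, k', hk2, hk2', hk, hk', hF, -⟩ := exists_coupled e M.left M.right
    (fun ℓ => if ℓ ∈ S then (if ℓ ∣ m then t else 1) else if ℓ = p then t
      else ℓ ^ Nat.card G - 1)
    (fun ℓ => if ℓ ∈ S then (if ℓ ∣ m then t else 1) else if ℓ = p then t'
      else ℓ ^ Nat.card G - 1)
    (fun ℓ hℓ _ => by
      split_ifs with h1 h2 h3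
      · exact hcop ℓ hℓ h2
      · exact fun h3 => hℓ.one_lt.ne' (Nat.dvd_one.1 h3)
      · exact h3 ▸ hcop p hp hpm
      · exact hkill ℓ hℓ)
    (fun ℓ hℓ _ => by
      split_ifs with h1 h2 h3
      · exact hcop ℓ hℓ h2
      · exact fun h3 => hℓ.one_lt.ne' (Nat.dvd_one.1 h3)
      · exact h3 ▸ hcop' p hp hpm'
      · exact hkill ℓ hℓ)
    (fun ℓ i hℓ _ => by
      split_ifs with h1 h2 h3
      · rfl
      · rfl
      · subst h3
        by_cases hi : i ≤ trivExp m t ℓ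
        · exact iff_of_true (ht.of_dvd (pow_dvd_pow ℓ hi)) (ht'.of_dvd (pow_dvd_pow ℓ hi))
        · exact iff_of_false (fun h => hnt (h.of_dvd (pow_dvd_pow ℓ (by omega))))
            (fun h => hnt' (h.of_dvd (pow_dvd_pow ℓ (by omega))))
      · rfl)
    (fun ℓ hℓ hG => by
      by_cases hS : ℓ ∈ S
      · right
        intro i
        simp only [hS, if_true]
        by_cases hd : ℓ ∣ m
        · simp only [hd, if_true]
          refine ⟨fun _ => rfl, fun hi => ((M.modEq ℓ hS hℓ).of_dvd (pow_dvd_pow ℓ ?_)).symm⟩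
          rw [M.eq_m ℓ hS hℓ]
          exact (hℓ.pow_dvd_iff_le_factorization hm0'.ne').1 hi
        · have hd' := (hSdvd ℓ hℓ hS).not.1 hd
          simp only [hd, if_false]
          refine ⟨fun hi => ?_, fun hi => ?_⟩
          all_goals
            rcases Nat.eq_zero_or_pos i with rfl | hi0
            · simp [Nat.modEq_one]
          · exact absurd ((dvd_pow_self ℓ hi0.ne').trans hi) hd
          · exact absurd ((dvd_pow_self ℓ hi0.ne').trans hi) hd'
      by_cases hℓp : ℓ = p
      · right
        subst hℓp
        simp [hS, Nat.ModEq.refl]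
      · left
        have := Nat.sub_add_cancel (Nat.one_le_pow (Nat.card G) ℓ hℓ.pos)
        simp only [hS, hℓp, if_false, this, true_and]
        exact ⟨fun h1 => M.modEq_one hℓ h1 hS, fun h1 => M.symm.modEq_one hℓ h1 hS⟩)
  have hpk := hk p hp (hpm.trans hmG)
  have hpk' := hk' p hp (hpm.trans hmG)
  simp only [hpS, if_false, if_true] at hpk hpk'
  have hexp : ∀ ℓ i, ℓ.Prime → ℓ ^ i ∣ m → ℓ ^ i ∣ ℓ ^ Nat.card G := fun ℓ i hℓ hi =>
    pow_dvd_pow ℓ ((Nat.lt_pow_self hℓ.one_lt).le.trans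
      (Nat.le_of_dvd Nat.card_pos (hi.trans hmG)))
  have hxm := (pow_dvd_pow p hx).trans (Nat.ordProj_dvd m p)
  have hcS : ∀ k, (∀ ℓ, ℓ.Prime → ℓ ∣ c → k ≡ t [MOD ℓ ^ Nat.card G]) → k ≡ t [MOD c] := by
    intro k hk
    refine modEq_of_forall_prime_pow fun ℓ i hℓ hi hi0 => ?_
    exact (hk ℓ hℓ ((dvd_pow_self ℓ hi0.ne').trans hi)).of_dvd
      (hexp ℓ i hℓ (hi.trans M.actLeft.dvd))
  have hkc : k ≡ t [MOD c] := hcS k fun ℓ hℓ hd => by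
    have hℓm := hd.trans M.actLeft.dvd
    simpa only [M.mem ℓ hℓ hd, if_true, hℓm] using hk ℓ hℓ (hℓm.trans hmG)
  have hkc' : k' ≡ t [MOD c] := hcS k' fun ℓ hℓ hd => by
    have hℓm := hd.trans M.actLeft.dvd
    simpa only [M.mem ℓ hℓ hd, if_true, hℓm] using hk' ℓ hℓ (hℓm.trans hmG)
  have hkp : k ≡ t [MOD p ^ x] := hpk.of_dvd (hexp p x hp hxm)
  have hkp' : k' ≡ t' [MOD p ^ x] := hpk'.of_dvd (hexp p x hp hxm)
  have hpc := M.not_dvd_actPart hp hpS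
  have hc0 : c ≠ 0 := (Nat.pos_of_dvd_of_pos M.actLeft.dvd hm0).ne'
  have hcx : c.Coprime (p ^ x) := Nat.Coprime.pow_right _ (hp.coprime_iff_not_dvd.2 hpc).symm
  have hkr : (k - 1).factorization p = trivExp m t p := by
    have hk0 : k - 1 ≠ 0 := by omega
    have h1 : ∀ i, i ≤ m.factorization p → (p ^ i ∣ k - 1 ↔ t ≡ 1 [MOD p ^ i]) := fun i hi => by
      have h2 := hpk.of_dvd (hexp p i hp ((pow_dvd_pow p hi).trans (Nat.ordProj_dvd m p)))
      rw [← Nat.modEq_iff_dvd' (by omega)]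
      exact ⟨fun h3 => h2.symm.trans h3.symm, fun h3 => (h2.trans h3).symm⟩
    refine le_antisymm ?_ ((hp.pow_dvd_iff_le_factorization hk0).1 ((h1 _ hlt.le).2 ht))
    by_contra hgt
    exact hnt ((h1 _ hlt).1 ((hp.pow_dvd_iff_le_factorization hk0).2 (by omega)))
  obtain ⟨j, hj⟩ := hF (c * p ^ x) ((M.left.feasible_iff hk2 (M.mul_dvd hp hpS hx)).2
    ⟨⟨1, by
      rw [pow_one]
      exact (Nat.modEq_and_modEq_iff_modEq_mul hcx).1 ⟨hkc.symm, hkp.symm⟩⟩, fun q hq => by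
      rw [Nat.factorization_mul hc0 (pow_ne_zero _ hp.ne_zero), Finsupp.add_apply,
        hp.factorization_pow]
      by_cases hqp : q = p
      · subst hqp
        rw [Nat.factorization_eq_zero_of_not_dvd hpc, hkr, Finsupp.single_eq_same, zero_add]
        exact hle
      · rw [Finsupp.single_eq_of_ne hqp, add_zero]
        by_cases hqc : q ∣ c
        · rw [M.actLeft.factorization_eq hm0 hq hqc,
            M.left.factorization_eq_of_dvd M.actLeft hq hqc]
          omega
        · rw [Nat.factorization_eq_zero_of_not_dvd hqc]
          omega⟩)
  exact ⟨j, (hj.of_dvd (dvd_mul_right _ _)).trans hkc',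
    (hj.of_dvd (dvd_mul_left _ _)).trans hkp'⟩

/-- After a change of generators on the left, the actions agree modulo `p ^ x`. -/
theorem exists_conj_modEq (M : MatchedPres G H S c m n s t m' n' s' t')
    (e : MonoidAlgebra ℚ G ≃ₐ[ℚ] MonoidAlgebra ℚ H) (hp : p.Prime) (hpS : p ∉ S)
    (hr : trivExp m t p = trivExp m' t' p) (hlt : trivExp m t p < m.factorization p)
    (hμ : m.factorization p = m'.factorization p) (hx : x ≤ m.factorization p)
    (hle : x + min (n.factorization p - (orderOf (t : ZMod (c * p ^ x))).factorization p)
      (trivExp m t p) ≤ s.factorization p + trivExp m t p) :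
    ∃ u, MatchedPres G H S c m n s u m' n' s' t' ∧ u ≡ t' [MOD p ^ x] := by
  obtain ⟨j, hjc, hjx⟩ := M.exists_pow_modEq_mul e hp hpS hr hlt hμ hx hle
  have hm0' := M.right.pos_left
  have hpm : p ∣ m := (hp.dvd_iff_one_le_factorization M.left.pos_left.ne').2 (by omega)
  have ht1 := M.modEq_one hp hpm hpS
  have hr1 : 1 ≤ trivExp m t p := (le_trivExp_iff M.left.pos_left M.left.one_lt.le hp).2
    (by simpa using ⟨hpm, ht1⟩)
  by_cases hpj : p ∣ j
  · refine ⟨t, M, ?_⟩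
    have ht := M.left.modEq_one_of_le hp le_rfl
    have ht' := M.right.modEq_one_of_le hp le_rfl
    by_cases hxr : x ≤ trivExp m t p
    · exact (ht.of_dvd (pow_dvd_pow p hxr)).trans (ht'.of_dvd (pow_dvd_pow p (hr ▸ hxr))).symm
    · have h1 := pow_modEq_one_of_dvd (e := 1) hr1 ht (show p ^ 1 ∣ j by rwa [pow_one])
      have h2 := h1.symm.trans (hjx.of_dvd (pow_dvd_pow p (by omega)))
      have := (le_trivExp_iff hm0' M.right.one_lt.le hp).2
        ⟨(pow_dvd_pow p (hμ ▸ hlt)).trans (Nat.ordProj_dvd m' p), h2.symm⟩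
      omega
  · obtain ⟨i, hi, hip, hiq⟩ := M.left.exists_coprime_pow M.actLeft hp hpm ht1 hpj hjc
    refine ⟨_, M.replace_conj hp hpS (M.left.pres.pow_conj hi) hiq
      (fun _ => by simpa using ht1.pow i), ?_⟩
    have hd := Nat.ordProj_dvd m p
    refine ((Nat.ModEq.trans ?_ hip).of_dvd (pow_dvd_pow p hx)).trans hjx
    exact (show t ^ i + 2 * m ≡ t ^ i [MOD m] by simp [Nat.ModEq]).of_dvd hd

end MatchedPres

section LiftExponent

theorem pow_sub_one_dvd_choose_two {p r l : ℕ} (hp : p.Prime) (h : p ^ r ∣ l) :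
    p ^ (r - 1) ∣ l.choose 2 := by
  have h1 : p ^ r ∣ 2 * l.choose 2 := by
    rw [Nat.choose_two_right, Nat.mul_div_cancel' (Nat.even_mul_pred_self l).two_dvd]
    exact h.mul_right _
  rcases Nat.eq_zero_or_pos r with rfl | hr
  · simp
  rcases eq_or_ne p 2 with rfl | h2
  · rw [← Nat.sub_add_cancel hr, pow_succ'] at h1
    exact Nat.dvd_of_mul_dvd_mul_left Nat.two_pos h1
  · exact (pow_dvd_pow p (Nat.sub_le r 1)).trans
      ((Nat.Coprime.pow_left r ((Nat.coprime_primes hp Nat.prime_two).2 h2)).dvd_of_dvd_mul_left h1)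

theorem exists_add_mul_modEq {a b P Q : ℕ} (h : a ≡ b [MOD P]) (hPQ : P ∣ Q) (hQ : 0 < Q) :
    ∃ d, b + P * d ≡ a [MOD Q] := by
  have hle : b ≤ a + Q * b := by nlinarith
  have h1 : b ≡ a + Q * b [MOD P] := by
    have := h.symm.add (Nat.modEq_zero_iff_dvd.2 (hPQ.mul_right b)).symm
    simpa using this
  obtain ⟨d, hd⟩ := (Nat.modEq_iff_dvd' hle).1 h1
  refine ⟨d, ?_⟩
  rw [← hd, Nat.add_sub_cancel' hle]
  simp [Nat.ModEq]

variable {m n s t u c p : ℕ}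

/-- Replacing the generator `a` of the normal subgroup by a suitable power of `a * b ^ y`. -/
theorem MinPres.retwist [Finite G] (h : MinPres G m n s t) {L n₂ ξ l : ℕ} (hn : n = L * n₂)
    (hs : L ∣ s) (hm : L ∣ m) (hl : L ∣ l) (hτ : t ^ (n₂ * ξ) ≡ 1 [MOD L])
    (hsum : ∑ k ∈ Finset.range l, (t ^ (n₂ * ξ)) ^ k + s * (ξ * (l / L)) + 1 ≡ t [MOD m]) :
    HasPres G m n s (l + 1) := by
  obtain ⟨m', n', s', h', hd, heq⟩ := h.pres.twist (i := 1) (y := n₂ * ξ) (l := l)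
    (q := ξ * (l / L)) (w := 1) (Nat.coprime_one_left m) (by
      nth_rewrite 1 [← Nat.mul_div_cancel' hl]
      rw [hn]
      ring) (by simpa using hsum)
  rw [mul_one] at heq
  refine heq (le_antisymm (Nat.le_of_dvd h.pos_left ?_) (h.minimal _ _ _ _ h'))
  have := hd L ξ (m / L) (by rw [hn]; ring) (by
    nth_rewrite 1 [← Nat.mul_div_cancel' hm]
    refine mul_dvd_mul_right (dvd_add ?_ (hs.mul_right ξ)) _
    rw [one_mul]
    exact ((geomSum_modEq hτ L).dvd_iff dvd_rfl).2 dvd_rfl)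
  rwa [Nat.mul_div_cancel' hm] at this

theorem MinPres.exists_hasPres_modEq [Finite G] (h : MinPres G m n s t) (hc : IsActPart c m t)
    (hp : p.Prime) {r e t' : ℕ} (hr : 1 ≤ r)
    (ht : t ≡ 1 [MOD p ^ r]) (ht' : t' ≡ 1 [MOD p ^ r]) (hnt' : ¬ t' ≡ 1 [MOD p ^ (r + 1)])
    (hrμ : r < m.factorization p) (he : e ≤ n.factorization p)
    (ho : (orderOf (t : ZMod c)).factorization p ≤ e)
    (hes : n.factorization p ≤ s.factorization p + e) (her : n.factorization p ≤ r + e)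
    (hμ : m.factorization p + 1 ≤ 2 * r + e)
    (htt : t ≡ t' [MOD p ^ (s.factorization p + r + e - n.factorization p)])
    (hX : s.factorization p + r + e - n.factorization p ≤ m.factorization p) :
    ∃ u, HasPres G m n s u ∧ u ≡ t' [MOD p ^ m.factorization p] ∧
      ∀ q a, q.Prime → q ≠ p → q ^ a ∣ m → u ≡ t [MOD q ^ a] := by
  obtain ⟨M, hmM, hpM, hM0⟩ := exists_eq_pow_mul hp h.pos_left
  obtain ⟨s₀, hs, hps, -⟩ := exists_eq_pow_mul hp (Nat.pos_of_ne_zero h.ne_zero)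
  set μ := m.factorization p
  set ν := n.factorization p
  set σ := s.factorization p
  set X := σ + r + e - ν
  have hMm : M ∣ m := ⟨p ^ μ, by rw [hmM]; ring⟩
  have hcop : ∀ a b, ¬ p ∣ b → b.Coprime (p ^ a) := fun a b hb =>
    (Nat.Coprime.pow_left a (hp.coprime_iff_not_dvd.2 hb)).symm
  have hPpos : 0 < p ^ μ := Nat.pow_pos hp.pos
  obtain ⟨u, hup, huM⟩ := Nat.chineseRemainder (hcop μ M hpM).symm t' t
  obtain ⟨l, hl⟩ : ∃ l, u + 2 * m = l + 1 := ⟨u + 2 * m - 1, by have := h.pos_left; omega⟩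
  have hlu : l + 1 ≡ u [MOD m] := by rw [← hl]; simp [Nat.ModEq]
  have hlp : l + 1 ≡ t' [MOD p ^ μ] := (hlu.of_dvd (Nat.ordProj_dvd m p)).trans hup
  have hlM : l + 1 ≡ t [MOD M] := (hlu.of_dvd hMm).trans huM
  have hdvd : ∀ i, i ≤ μ → (p ^ i ∣ l ↔ t' ≡ 1 [MOD p ^ i]) := fun i hi => by
    have h1 := hlp.of_dvd (pow_dvd_pow p hi)
    rw [← Nat.modEq_zero_iff_dvd]
    constructor
    · intro h2
      exact h1.symm.trans (h2.add_right 1)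
    · intro h2
      exact (h1.trans h2 : l + 1 ≡ 0 + 1 [MOD p ^ i]).add_right_cancel' 1
  have hl0 : 0 < l := by have := h.pos_left; omega
  obtain ⟨l₀, hl₀⟩ := (hdvd r hrμ.le).2 ht'
  have hpl₀ : ¬ p ∣ l₀ := fun hd => hnt' ((hdvd _ hrμ).1 (by
    rw [hl₀, pow_succ]; exact mul_dvd_mul_left _ hd))
  have hDp : orderOf (t : ZMod c) * p ^ (ν - e) ∣ n :=
    mul_pow_dvd_of_factorization_le hp (h.orderOf_dvd hc.dvd) h.pos_right
      (by change _ + (ν - e) ≤ ν; omega)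
  obtain ⟨n₂, hn₂⟩ := (pow_dvd_pow p (Nat.sub_le ν e)).trans (Nat.ordProj_dvd n p)
  have hDn : orderOf (t : ZMod c) ∣ n₂ := by
    rw [hn₂, mul_comm] at hDp
    exact Nat.dvd_of_mul_dvd_mul_left (Nat.pow_pos hp.pos) hDp
  have hen : p ^ e ∣ n₂ := by
    have h1 := Nat.ordProj_dvd n p
    rw [show n.factorization p = (ν - e) + e by change ν = _; omega, pow_add] at h1
    nth_rewrite 1 [hn₂] at h1
    exact Nat.dvd_of_mul_dvd_mul_left (Nat.pow_pos hp.pos) h1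
  have hlt : t ≡ l + 1 [MOD p ^ X] := htt.trans (hlp.of_dvd (pow_dvd_pow p hX)).symm
  obtain ⟨d, hd⟩ := exists_add_mul_modEq hlt (pow_dvd_pow p hX) hPpos
  have hnd : ¬ p ∣ s₀ * l₀ * M := fun h1 =>
    (hp.dvd_mul.1 h1).elim (fun h2 => (hp.dvd_mul.1 h2).elim hps hpl₀) hpM
  obtain ⟨ξ₀, hξ₀⟩ := exists_mul_modEq d (hcop μ _ hnd) hPpos
  have hLdiv : l / p ^ (ν - e) = p ^ (r - (ν - e)) * l₀ := by
    rw [hl₀, show r = (ν - e) + (r - (ν - e)) by omega, pow_add, mul_assoc,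
      Nat.mul_div_cancel_left _ (Nat.pow_pos hp.pos)]
    congr 3
    omega
  have hs₁ : s * (M * ξ₀ * (l / p ^ (ν - e))) = p ^ X * (s₀ * l₀ * M * ξ₀) := by
    rw [hLdiv]
    nth_rewrite 1 [hs]
    rw [show X = σ + (r - (ν - e)) by omega, pow_add]
    ring
  have hτM : t ^ (n₂ * (M * ξ₀)) ≡ 1 [MOD M] :=
    orderOf_natCast_dvd_iff.1 ((hc.orderOf_dvd hMm).trans
      (mul_dvd_mul hDn (dvd_mul_right M ξ₀)))
  have hτp : t ^ (n₂ * (M * ξ₀)) ≡ 1 [MOD p ^ (r + e)] :=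
    pow_modEq_one_of_dvd hr ht (hen.mul_right _)
  set τ := t ^ (n₂ * (M * ξ₀)) with hτ
  have hτ1 : 1 ≤ τ := Nat.one_le_pow _ _ (by have := h.one_lt; omega)
  have hsum : ∑ k ∈ Finset.range l, τ ^ k ≡ l [MOD p ^ μ] := by
    obtain ⟨v, hv⟩ : ∃ v, τ = 1 + v := ⟨τ - 1, by omega⟩
    have hvd : p ^ (r + e) ∣ v := by
      have h1 := (Nat.modEq_iff_dvd' hτ1).1 hτp.symm
      rwa [hv, Nat.add_sub_cancel_left] at h1
    have h2 : p ^ μ ∣ v ^ 2 := by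
      refine (pow_dvd_pow p (by omega : μ ≤ (r + e) * 2)).trans ?_
      rw [pow_mul]
      exact pow_dvd_pow_of_dvd hvd 2
    have h3 : p ^ μ ∣ v * l.choose 2 := by
      refine (pow_dvd_pow p (by omega : μ ≤ (r + e) + (r - 1))).trans ?_
      rw [pow_add]
      exact mul_dvd_mul hvd (pow_sub_one_dvd_choose_two hp ⟨l₀, hl₀⟩)
    rw [hv]
    refine ((geomSum_one_add_modEq v l).of_dvd h2).trans ?_
    simpa using (Nat.modEq_zero_iff_dvd.2 h3).add_left l
  refine ⟨l + 1, h.retwist (L := p ^ (ν - e)) (ξ := M * ξ₀) hn₂ ?_ ?_ ?_ ?_ ?_, hlp, ?_⟩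
  · exact (pow_dvd_pow p (by omega)).trans (Nat.ordProj_dvd s p)
  · exact (pow_dvd_pow p (by omega : ν - e ≤ μ)).trans (Nat.ordProj_dvd m p)
  · exact (pow_dvd_pow p (by omega : ν - e ≤ r)).trans ⟨l₀, hl₀⟩
  · exact hτp.of_dvd (pow_dvd_pow p (by omega))
  · rw [hs₁, hmM, ← Nat.modEq_and_modEq_iff_modEq_mul (hcop μ M hpM).symm]
    constructor
    · refine ((hsum.add ((hξ₀.mul_left (p ^ X)))).add_right 1).trans ?_
      rw [add_right_comm]
      exact hd
    · refine ((geomSum_modEq hτM l).add (Nat.modEq_zero_iff_dvd.2 ?_)).add_right 1 |>.trans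
        (by simpa using hlM)
      exact (((dvd_mul_left M _).mul_right _).mul_left _)
  · intro q a hq hqp hqa
    refine hlM.of_dvd ?_
    rw [hmM] at hqa
    exact pow_dvd_of_dvd_pow_mul hp hq hqp hqa

end LiftExponent

namespace MatchedPres

variable {m n s t m' n' s' t' c p : ℕ} {S : Set ℕ} {H : Type*} [Group H] [Finite G]

theorem one_le_trivExp (M : MatchedPres G H S c m n s t m' n' s' t') (hp : p.Prime)
    (hpS : p ∉ S) (hpm : 0 < m.factorization p) : 1 ≤ trivExp m t p := by
  have hd := (hp.dvd_iff_one_le_factorization M.left.pos_left.ne').2 hpm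
  exact (le_trivExp_iff M.left.pos_left M.left.one_lt.le hp).2
    (by simpa using ⟨hd, M.modEq_one hp hd hpS⟩)

variable [Finite H]

theorem factorization_eq (M : MatchedPres G H S c m n s t m' n' s' t')
    (e : MonoidAlgebra ℚ G ≃ₐ[ℚ] MonoidAlgebra ℚ H) (hp : p.Prime) (hpS : p ∉ S)
    (h2 : ∀ ℓ, ℓ.Prime → ℓ ∉ S → ℓ ≠ p → ℓ ≠ 2) :
    m.factorization p = m'.factorization p ∧ n.factorization p = n'.factorization p := by
  have h1 := M.trivExp_eq e hp hpS h2
  have h3 := factorization_add_trivExp_eq e M.left M.right p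
  have h4 := factorization_add_factorization_eq e M.left M.right p
  omega

theorem insert_of_factorization_eq_zero (M : MatchedPres G H S c m n s t m' n' s' t')
    (e : MonoidAlgebra ℚ G ≃ₐ[ℚ] MonoidAlgebra ℚ H) (hp : p.Prime) (hpS : p ∉ S)
    (h2 : ∀ ℓ, ℓ.Prime → ℓ ∉ S → ℓ ≠ p → ℓ ≠ 2) (h0 : m.factorization p = 0) :
    MatchedPres G H (Insert.insert p S) c m n s t m' n' s' t' := by
  obtain ⟨hm, hn⟩ := M.factorization_eq e hp hpS h2
  have h3 := M.left.factorization_le (p := p)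
  have h4 := M.right.factorization_le (p := p)
  exact M.insert (fun _ => hm) (fun _ => hn) (fun _ => by omega) fun _ => by
    rw [h0, pow_zero]
    exact Nat.modEq_one

/-- Matching at a prime where the powers of `t` are governed by `trivExp`. -/
theorem exists_insert_of_trivExp (M : MatchedPres G H S c m n s t m' n' s' t')
    (e : MonoidAlgebra ℚ G ≃ₐ[ℚ] MonoidAlgebra ℚ H) (hp : p.Prime) (hpS : p ∉ S)
    (h2 : ∀ ℓ, ℓ.Prime → ℓ ∉ S → ℓ ≠ p → ℓ ≠ 2)
    (hr : p ≠ 2 ∨ 2 ≤ trivExp m t p ∨ trivExp m t p = m.factorization p) :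
    ∃ s u s', MatchedPres G H (Insert.insert p S) c m n s u m' n' s' t' := by
  rcases Nat.eq_zero_or_pos (m.factorization p) with h0 | hμ0
  · exact ⟨s, t, s', M.insert_of_factorization_eq_zero e hp hpS h2 h0⟩
  have hrr := M.trivExp_eq e hp hpS h2
  have hr1 := M.one_le_trivExp hp hpS hμ0
  obtain ⟨hmm, hnn⟩ := M.factorization_eq e hp hpS h2
  have hr' : p ≠ 2 ∨ 2 ≤ trivExp m' t' p ∨ trivExp m' t' p = m'.factorization p := by
    rwa [← hrr, ← hmm]
  obtain ⟨s₁, M₁, hN₁⟩ := M.exists_normalized hp hpS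
  obtain ⟨s₂, M₂, hN₂⟩ := M₁.symm.exists_normalized hp hpS
  have hσ₁ : s₁.factorization p = m.factorization p ∨ s₁.factorization p < n.factorization p := by
    by_cases hlt : s₁.factorization p = m.factorization p
    · exact Or.inl hlt
    · exact Or.inr (M₁.left.factorization_lt_of_dvd_geomSum hp hr hr1
        (lt_of_le_of_ne M₁.left.factorization_le hlt) (hN₁.resolve_left hlt))
  have hσ₂ : s₂.factorization p = m'.factorization p ∨
      s₂.factorization p < n'.factorization p := by
    by_cases hlt : s₂.factorization p = m'.factorization p
    · exact Or.inl hlt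
    · exact Or.inr (M₂.left.factorization_lt_of_dvd_geomSum hp hr' (hrr ▸ hr1)
        (lt_of_le_of_ne M₂.left.factorization_le hlt) (hN₂.resolve_left hlt))
  have hss : s₁.factorization p = s₂.factorization p := le_antisymm
    (M₂.factorization_s_le e.symm hp hpS h2 hr' hrr.symm hmm.symm hnn.symm hσ₂)
    (M₂.symm.factorization_s_le e hp hpS h2 hr hrr hmm hnn hσ₁)
  replace M := M₂.symm
  have hm0 := M.left.pos_left
  have ht1 := M.left.modEq_one_of_le hp le_rfl
  have ht1' := hrr ▸ M.right.modEq_one_of_le hp le_rfl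
  rcases (trivExp_le (t := t) (p := p) hm0).eq_or_lt with hrμ | hrμ
  · exact ⟨s₁, t, s₂, M.insert (fun _ => hmm) (fun _ => hnn) (fun _ => hss)
      fun _ => hrμ ▸ ht1.trans ht1'.symm⟩
  have hnt' : ¬ t' ≡ 1 [MOD p ^ (trivExp m t p + 1)] := fun h1 => by
    have := (le_trivExp_iff M.right.pos_left M.right.one_lt.le hp).2
      ⟨(pow_dvd_pow p (hmm ▸ hrμ)).trans (Nat.ordProj_dvd m' p), h1⟩
    omega
  set r := trivExp m t p with hrdef
  set μ := m.factorization p with hμ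
  set ν := n.factorization p with hν
  set σ := s₁.factorization p with hσ
  set o := (orderOf (t : ZMod c)).factorization p with ho
  have hoν : o ≤ ν := M.left.factorization_orderOf_le M.actLeft.dvd
  set f := max o (ν - r) with hf
  set X := σ + r + f - ν with hX
  have hdvd := M.mul_dvd hp hpS (min_le_left μ X)
  have hoD : o ≤ (orderOf (t : ZMod (c * p ^ min μ X))).factorization p :=
    (Nat.factorization_le_iff_dvd (M.left.orderOf_pos M.actLeft.dvd).ne'
      (M.left.orderOf_pos hdvd).ne').2 (orderOf_natCast_dvd_iff.2
        ((orderOf_natCast_dvd_iff.1 dvd_rfl).of_dvd (dvd_mul_right _ _))) p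
  obtain ⟨u, M₃, hu⟩ := M.exists_conj_modEq e hp hpS hrr hrμ hmm (min_le_left μ X) (by
    change _ + min (ν - _) r ≤ σ + r
    omega)
  rcases le_or_gt μ X with hle | hlt
  · rw [min_eq_left hle] at hu
    exact ⟨s₁, u, s₂, M₃.insert (fun _ => hmm) (fun _ => hnn) (fun _ => hss) fun _ => hu⟩
  rw [min_eq_right hlt.le] at hu
  have hru : trivExp m u p = r := (M₃.trivExp_eq e hp hpS h2).trans hrr.symm
  have hou : (u : ZMod c) = t :=
    (ZMod.natCast_eq_natCast_iff _ _ _).2 (M₃.modEq_actPart.trans M.modEq_actPart.symm)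
  have hσν : σ < ν := hσ₁.resolve_left fun h1 => by omega
  have hadd := M.left.le_factorization_add p
  have hνσ : ν ≤ σ + f := by
    by_cases hσr : σ < r
    · have h3 := M.left.lt_add M.actLeft hp
        ((pow_dvd_pow p hrμ.le).trans (Nat.ordProj_dvd m p)) ht1
        (by rcases hr with h | h | h
            · exact Or.inl h
            · exact Or.inr (Or.inl h)
            · omega) (by rw [← hσ, ← hν]; omega)
      rw [← hσ, ← hν, ← ho] at h3
      omega
    · omega
  obtain ⟨v, hv, hvp, hvq⟩ := M₃.left.exists_hasPres_modEq M₃.actLeft hp hr1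
    (hru ▸ M₃.left.modEq_one_of_le hp le_rfl) ht1' hnt' hrμ (e := f)
    (by rw [← hν]; omega) (by rw [hou, ← ho]; omega) (by rw [← hσ, ← hν]; omega)
    (by rw [← hν]; omega) (by rw [← hμ]; omega) hu hlt.le
  refine ⟨s₁, v + 2 * m, s₂, (M₃.replace_conj hp hpS hv hvq fun hd => ?_).insert (fun _ => hmm)
    (fun _ => hnn) (fun _ => hss) fun _ => ?_⟩
  · exact (hvp.of_dvd (dvd_pow_self p hμ0.ne')).trans (M.symm.modEq_one hp
      ((hp.dvd_iff_one_le_factorization M.right.pos_left.ne').2 (hmm ▸ hμ0)) hpS)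
  · exact ((show v + 2 * m ≡ v [MOD m] by simp [Nat.ModEq]).of_dvd
      (Nat.ordProj_dvd m p)).trans hvp

end MatchedPres

theorem pow_modEq_one_of_two_pow_dvd_geomSum {t h μ : ℕ} (ht : Odd t) (hh : Even h)
    (hd : 2 ^ μ ∣ ∑ k ∈ Finset.range (h * 2), t ^ k) : t ^ h ≡ 1 [MOD 2 ^ μ] := by
  have h4 : t ^ h % 4 = 1 := by
    obtain ⟨a, rfl⟩ := hh
    obtain ⟨b, rfl⟩ := ht
    rw [← two_mul, pow_mul, Nat.pow_mod, show (2 * b + 1) ^ 2 = 4 * (b * (b + 1)) + 1 by ring]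
    simp [Nat.add_mod]
  obtain ⟨x, rfl⟩ : ∃ x, t = x + 1 := ⟨t - 1, by have := ht.pos; omega⟩
  have hx : 2 ∣ x := by
    obtain ⟨b, hb⟩ := ht
    exact ⟨b, by omega⟩
  rw [geomSum_mul, Finset.sum_range_succ, Finset.sum_range_one, pow_zero, pow_one,
    show 1 + (x + 1) ^ h = 2 * (((x + 1) ^ h + 1) / 2) by omega, ← mul_assoc] at hd
  have hcop : (2 ^ μ).Coprime (((x + 1) ^ h + 1) / 2) :=
    Nat.Coprime.pow_left _ (Nat.coprime_two_left.2 (Nat.odd_iff.2 (by omega)))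
  have h1 := hcop.dvd_of_dvd_mul_right hd
  have h2 := (geom_sum_mul_add x h)
  rw [← h2]
  have h3 := h1.trans (mul_dvd_mul_left _ hx)
  simpa using (Nat.modEq_zero_iff_dvd.2 h3).add_right 1

theorem two_pow_dvd_add_one_of_dvd_geomSum {t h μ : ℕ} (ht : Odd t) (hh : Odd h)
    (hd : 2 ^ μ ∣ ∑ k ∈ Finset.range (2 * h), t ^ k) : 2 ^ μ ∣ t + 1 := by
  rw [geomSum_mul, Finset.sum_range_succ, Finset.sum_range_one, pow_zero, pow_one,
    add_comm] at hd
  refine (Nat.Coprime.pow_left _ (Nat.coprime_two_left.2 ?_)).dvd_of_dvd_mul_right hd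
  have h1 : t ^ 2 ≡ 1 [MOD 2] := Nat.odd_iff.1 ht.pow
  have h2 := geomSum_modEq h1 h
  exact Nat.odd_iff.2 (Eq.trans h2 (Nat.odd_iff.1 hh))

namespace MatchedPres

variable {m n s t u m' n' s' t' c : ℕ} {S : Set ℕ} {H : Type*} [Group H] [Finite G] [Finite H]

theorem factorization_le_orderOf_two (M : MatchedPres G H S c m n s t m' n' s' t')
    (e : MonoidAlgebra ℚ G ≃ₐ[ℚ] MonoidAlgebra ℚ H)
    (hr : trivExp m t 2 = 1) (hμ : 1 < m.factorization 2)
    (hmm : m.factorization 2 = m'.factorization 2)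
    (hnn : n.factorization 2 = n'.factorization 2)
    (hσ : s.factorization 2 + 1 = m.factorization 2)
    (hσ' : s'.factorization 2 = m'.factorization 2)
    (htt : t ≡ t' [MOD 2 ^ m.factorization 2]) :
    n.factorization 2 ≤ (orderOf (t : ZMod (2 ^ m.factorization 2))).factorization 2 := by
  have hcard := card_eq_of_algEquiv e
  have hm0 := M.left.pos_left
  have hm0' := M.right.pos_left
  have hp := Nat.prime_two
  have hmG : m ∣ Nat.card G := M.left.pres.card ▸ dvd_mul_right m n
  have hN0 : Nat.card G ≠ 0 := Nat.card_pos.ne'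
  have hpm : 2 ∣ m := (hp.dvd_iff_one_le_factorization hm0.ne').2 (by omega)
  have hcop : ∀ ℓ, ℓ.Prime → ℓ ∣ m → ¬ ℓ ∣ t := fun ℓ hℓ hd h1 =>
    Nat.not_coprime_of_dvd_of_dvd hℓ.one_lt h1 hd M.left.pres.coprime
  obtain ⟨k, hk, hs⟩ := exists_sameCount e M.left.pres M.right.pres (Nat.card G)
    (fun ℓ => if ℓ ∈ S ∨ ℓ = 2 then (if ℓ ∣ m then t else 1) else ℓ ^ Nat.card G - 1)
    (fun ℓ hℓ => by
      replace hℓ := Nat.prime_of_mem_primeFactors hℓ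
      split_ifs with h1 h2
      · exact hcop ℓ hℓ h2
      · exact fun h3 => hℓ.one_lt.ne' (Nat.dvd_one.1 h3)
      · intro hd
        have h1 := (Nat.dvd_sub_iff_right (Nat.one_le_pow _ _ hℓ.pos) (dvd_pow_self ℓ hN0)).1 hd
        exact hℓ.one_lt.ne' (Nat.dvd_one.1 h1))
  have hk2 := hs.1
  have hexp : ∀ ℓ i, ℓ.Prime → ℓ ^ i ∣ m → ℓ ^ i ∣ ℓ ^ Nat.card G := fun ℓ i hℓ hi =>
    pow_dvd_pow ℓ ((Nat.lt_pow_self hℓ.one_lt).le.trans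
      (Nat.le_of_dvd Nat.card_pos (hi.trans hmG)))
  have hkS : ∀ ℓ, ℓ.Prime → ℓ ∣ m → (ℓ ∈ S ∨ ℓ = 2) → k ≡ t [MOD ℓ ^ Nat.card G] := by
    intro ℓ hℓ hd h1
    simpa only [h1, hd, if_true] using hk ℓ (Nat.mem_primeFactors.2 ⟨hℓ, hd.trans hmG, hN0⟩)
  have hkn : ∀ ℓ, ℓ.Prime → ℓ ∣ Nat.card G → ¬ (ℓ ∈ S ∨ ℓ = 2) → ℓ ^ Nat.card G ∣ k + 1 := by
    intro ℓ hℓ hd h1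
    have h2 := hk ℓ (Nat.mem_primeFactors.2 ⟨hℓ, hd, hN0⟩)
    simp only [h1, if_false] at h2
    have h3 := h2.add_right 1
    rw [Nat.sub_add_cancel (Nat.one_le_pow _ _ hℓ.pos)] at h3
    exact (h3.dvd_iff dvd_rfl).2 dvd_rfl
  have hk1 : (k - 1).factorization 2 = 1 := by
    have h1 : ∀ i, i ≤ m.factorization 2 → (2 ^ i ∣ k - 1 ↔ i ≤ 1) := fun i hi => by
      have him := (pow_dvd_pow 2 hi).trans (Nat.ordProj_dvd m 2)
      have h2 := (hkS 2 hp hpm (Or.inr rfl)).of_dvd (hexp 2 i hp him)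
      have h3 := le_trivExp_iff hm0 M.left.one_lt.le hp (j := i)
      rw [hr, and_iff_right him] at h3
      rw [← Nat.modEq_iff_dvd' (by omega), h3]
      exact ⟨fun h3 => h2.symm.trans h3.symm, fun h3 => (h2.trans h3).symm⟩
    have hk0 : k - 1 ≠ 0 := by omega
    refine le_antisymm ?_ ((hp.pow_dvd_iff_le_factorization hk0).1 ((h1 1 hμ.le).2 le_rfl))
    by_contra hgt
    have := (h1 2 hμ).1 ((hp.pow_dvd_iff_le_factorization hk0).2 (by omega))
    omega
  have hdm' : 2 ^ m.factorization 2 ∣ m' := hmm ▸ Nat.ordProj_dvd m' 2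
  have hdm : 2 ^ m.factorization 2 ∣ m := Nat.ordProj_dvd m 2
  have hF : Feasible m' n' s' t' k (2 ^ m.factorization 2) := by
    refine (M.right.feasible_iff hk2 hdm').2 ⟨⟨1, ?_⟩, fun q hq => ?_⟩
    · rw [pow_one]
      exact htt.symm.trans ((hkS 2 hp hpm (Or.inr rfl)).of_dvd (hexp 2 _ hp hdm)).symm
    · rw [hp.factorization_pow]
      by_cases hqp : q = 2
      · subst hqp
        rw [Finsupp.single_eq_same]
        omega
      · rw [Finsupp.single_eq_of_ne hqp]
        omega
  have key := hs.feasible_of_le hcard M.left M.right (fun d hd => ?_) hF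
  · have h3 := ((M.left.feasible_iff hk2 hdm).1 key.1).2 2 hp
    rw [hp.factorization_pow, Finsupp.single_eq_same, hk1] at h3
    omega
  have hd0 : d ≠ 0 := (Nat.pos_of_dvd_of_pos hd.1 hm0).ne'
  have hmem : ∀ q, q.Prime → q ∣ d → q ∈ S ∨ q = 2 := by
    intro q hq hqd
    by_contra hn
    obtain ⟨j, hj⟩ := hd.2.1
    have hqm := hqd.trans hd.1
    refine hn (Or.inr (eq_two_of_pow_modEq hq (i := 1) one_pos
      (M.modEq_one hq hqm fun h => hn (Or.inl h)) (hj.of_dvd (by rwa [pow_one])) ?_).1)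
    rw [pow_one]
    exact (dvd_pow_self q hN0).trans (hkn q hq (hqm.trans hmG) hn)
  have hfac : ∀ q, q.Prime → d.factorization q ≤ m'.factorization q := by
    intro q hq
    by_cases hqd : q ∣ d
    · have h1 := (Nat.factorization_le_iff_dvd hd0 hm0.ne').2 hd.1 q
      rcases hmem q hq hqd with hS | rfl
      · rwa [← M.eq_m q hS hq]
      · rwa [← hmm]
    · simp [Nat.factorization_eq_zero_of_not_dvd hqd]
  have hdm'' : d ∣ m' := (Nat.factorization_prime_le_iff_dvd hd0 hm0'.ne').1 hfac
  have htd : t ≡ t' [MOD d] := by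
    refine modEq_of_forall_prime_pow fun ℓ a hℓ ha ha0 => ?_
    have hle := (hℓ.pow_dvd_iff_le_factorization hm0.ne').1 (ha.trans hd.1)
    rcases hmem ℓ hℓ ((dvd_pow_self ℓ ha0.ne').trans ha) with hS | rfl
    · exact (M.modEq ℓ hS hℓ).of_dvd (pow_dvd_pow ℓ hle)
    · exact htt.of_dvd (pow_dvd_pow 2 hle)
  have hD : orderOf (t : ZMod d) = orderOf (t' : ZMod d) := by
    rw [(ZMod.natCast_eq_natCast_iff _ _ _).2 htd]
  have hle := ((M.left.feasible_iff hk2 hd.1).1 hd).2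
  refine ⟨(M.right.feasible_iff hk2 hdm'').2 ⟨?_, fun q hq => ?_⟩, hD, fun q hq => ?_⟩
  · obtain ⟨j, hj⟩ := hd.2.1
    exact ⟨j, (htd.symm.pow j).trans hj⟩
  · have := hle q hq
    rw [hD] at this
    by_cases hqS : q ∈ S
    · rwa [M.eq_n q hqS hq, M.eq_s q hqS hq] at this
    by_cases hqp : q = 2
    · subst hqp
      rw [hnn] at this
      omega
    · have h3 : d.factorization q = 0 := Nat.factorization_eq_zero_of_not_dvd fun h =>
        (hmem q hq h).elim hqS hqp
      omega
  · by_cases hqS : q ∈ S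
    · rw [M.eq_n q hqS hq]
    by_cases hqp : q = 2
    · subst hqp
      rw [hnn]
    by_cases hqG : q ∣ Nat.card G
    · have h4 : (k - 1).factorization q = 0 := by
        refine Nat.factorization_eq_zero_of_not_dvd fun h1 => ?_
        have h2 := (dvd_pow_self q hN0).trans (hkn q hq hqG (by tauto))
        have h3 := (Nat.dvd_sub h2 h1)
        rw [show k + 1 - (k - 1) = 2 by omega] at h3
        exact hqp ((Nat.prime_dvd_prime_iff_eq hq Nat.prime_two).1 h3)
      simp [h4]
    · have : n.factorization q = 0 := Nat.factorization_eq_zero_of_not_dvd fun h =>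
        hqG (h.trans (M.left.pres.card ▸ dvd_mul_left n m))
      simp [this]

end MatchedPres

namespace IsPres

variable [Finite G] {a b : G} {m n s t μ : ℕ}

theorem card_inv_eq_self_le_two (h : IsPres a b m n s t) (ht : 2 ^ μ ∣ t + 1)
    (hn : n.factorization 2 = 1) (hs : ¬ 2 ^ μ ∣ s) (hμ : 2 ^ μ ∣ m) :
    Nat.card {g : G // g⁻¹ = g} ≤ 2 := by
  have hm0 := h.pos_left
  have hn0 := h.pos_right
  obtain ⟨w, hw, hw2, hw0⟩ := exists_eq_pow_mul Nat.prime_two hn0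
  rw [hn, pow_one] at hw
  have hodd : Odd w := Nat.not_even_iff_odd.1 fun h => hw2 h.two_dvd
  have hsub : {g : G | g⁻¹ = g} ⊆ {1, a ^ (m / 2)} := by
    intro g hg
    obtain ⟨x, y, rfl⟩ := h.form g
    have h1 : (a ^ x * b ^ y) ^ 2 = 1 := by
      rw [pow_two]
      exact inv_eq_iff_mul_eq_one.1 hg
    rw [mul_pow_eq h.conj, Finset.sum_range_succ, Finset.sum_range_one, pow_zero, pow_one,
      ← pow_zero a, h.pow_mul_pow_eq_iff, hw, mul_comm 2 w,
      Nat.mul_dvd_mul_iff_right two_pos] at h1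
    obtain ⟨⟨z, rfl⟩, h2⟩ := h1
    rw [show w * z * 2 / (w * 2) = z by
      rw [mul_right_comm, Nat.mul_div_cancel_left _ (by omega)]] at h2
    rcases Nat.even_or_odd z with ⟨i, rfl⟩ | hz
    · have h3 : a ^ x * b ^ (w * (i + i)) = a ^ (x + s * i) := by
        rw [show w * (i + i) = n * i by rw [hw]; ring, pow_mul, h.pow, ← pow_mul, ← pow_add]
      rw [h3]
      have h4 : a ^ (2 * (x + s * i)) = 1 := by
        rw [mul_comm, pow_mul, ← h3, pow_two]
        exact inv_eq_iff_mul_eq_one.1 hg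
      rw [← pow_zero a, h.pow_eq_pow, Nat.modEq_zero_iff_dvd] at h4
      obtain ⟨j, hj⟩ := h4
      rw [Set.mem_insert_iff, Set.mem_singleton_iff, ← pow_zero a, h.pow_eq_pow, h.pow_eq_pow]
      rcases Nat.even_or_odd' j with ⟨j, rfl | rfl⟩
      · left
        exact Nat.modEq_zero_iff_dvd.2 ⟨j, by linarith⟩
      · right
        have h5 : x + s * i = m / 2 + m * j := by
          have h6 : m * (2 * j + 1) = 2 * (m * j) + m := by ring
          omega
        rw [h5]
        simp [Nat.ModEq]
    · have h3 : 2 ^ μ ∣ 1 + t ^ (w * z) := by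
        rw [add_comm]
        have := (hodd.mul hz).nat_add_dvd_pow_add_pow t 1
        rw [one_pow] at this
        exact ht.trans this
      have h4 := (Nat.modEq_zero_iff_dvd.1 h2)
      have h5 := (Nat.dvd_add_right (h3.mul_left x)).1 (hμ.trans h4)
      exact absurd ((Nat.Coprime.pow_left _ (Nat.coprime_two_left.2 hz)).dvd_of_dvd_mul_right h5) hs
  have h6 := (Set.ncard_le_ncard hsub (Set.toFinite _)).trans (Set.ncard_insert_le _ _)
  rwa [Set.ncard_singleton] at h6

theorem two_lt_card_inv_eq_self (h : IsPres a b m n s t) (hm : 2 ∣ m) (hn : 2 ∣ n)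
    (hs : 2 ^ m.factorization 2 ∣ s) : 2 < Nat.card {g : G // g⁻¹ = g} := by
  have hm0 := h.pos_left
  have hn0 := h.pos_right
  obtain ⟨w, hw, hw2, hw0⟩ := exists_eq_pow_mul Nat.prime_two hm0
  obtain ⟨i, hi⟩ := hm
  obtain ⟨j, hj⟩ := hn
  have h1 : ∀ z, b ^ (j * w) ≠ a ^ z := by
    intro z hz
    rw [← one_mul (b ^ _), ← pow_zero a, h.pow_mul_pow_eq_iff, hj, mul_comm 2 j,
      Nat.mul_dvd_mul_iff_left (by omega)] at hz
    exact hw2 hz.1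
  have hsub : ({1, a ^ i, b ^ (j * w)} : Set G) ⊆ {g : G | g⁻¹ = g} := by
    intro g hg
    refine inv_eq_iff_mul_eq_one.2 ?_
    rcases hg with rfl | rfl | rfl
    · simp
    · rw [← pow_add, ← two_mul, ← hi, ← h.order, pow_orderOf_eq_one]
    · rw [← pow_add, ← two_mul, ← mul_assoc, ← hj, pow_mul, h.pow, ← pow_mul, ← pow_zero a,
        h.pow_eq_pow, Nat.modEq_zero_iff_dvd]
      nth_rewrite 1 [hw]
      exact mul_dvd_mul_right hs w
  have h2 : (1 : G) ≠ a ^ i := by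
    intro h2
    rw [← pow_zero a, h.pow_eq_pow] at h2
    have := Nat.le_of_dvd (by omega) (Nat.modEq_zero_iff_dvd.1 h2.symm)
    omega
  have h3 := Set.ncard_le_ncard hsub (Set.toFinite _)
  rw [Set.ncard_eq_three.2 ⟨1, a ^ i, b ^ (j * w), h2, fun h => h1 0 (by rw [pow_zero, h]),
    fun h => h1 i h.symm, rfl⟩] at h3
  exact h3

end IsPres

namespace MatchedPres

variable {m n s t u m' n' s' t' c : ℕ} {S : Set ℕ} {H : Type*} [Group H] [Finite G]

theorem odd_left (M : MatchedPres G H S c m n s t m' n' s' t')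
    (hμ : 0 < m.factorization 2) : Odd t := by
  have h2m := (Nat.prime_two.dvd_iff_one_le_factorization M.left.pos_left.ne').2 hμ
  by_contra h
  exact Nat.not_coprime_of_dvd_of_dvd one_lt_two (Nat.not_odd_iff_even.1 h).two_dvd h2m
    M.left.pres.coprime

variable [Finite H]

theorem exists_conj_modEq_of_factorization_eq (M : MatchedPres G H S c m n s t m' n' s' t')
    (e : MonoidAlgebra ℚ G ≃ₐ[ℚ] MonoidAlgebra ℚ H) (h2S : 2 ∉ S)
    (hr : trivExp m t 2 < m.factorization 2)
    (hσ : s.factorization 2 = m.factorization 2) :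
    ∃ u, MatchedPres G H S c m n s u m' n' s' t' ∧ u ≡ t' [MOD 2 ^ m.factorization 2] := by
  have hp := Nat.prime_two
  obtain ⟨hmm, -⟩ := M.factorization_eq e hp h2S fun _ _ _ h => h
  refine M.exists_conj_modEq e hp h2S (M.trivExp_eq e hp h2S fun _ _ _ h => h) hr hmm le_rfl ?_
  rw [hσ]
  gcongr
  exact min_le_right _ _

theorem false_of_factorization_s_ne (M : MatchedPres G H S c m n s t m' n' s' t')
    (e : MonoidAlgebra ℚ G ≃ₐ[ℚ] MonoidAlgebra ℚ H) (h2S : 2 ∉ S)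
    (hr : trivExp m t 2 = 1) (hμ : 1 < m.factorization 2)
    (hσ : s.factorization 2 + 1 = m.factorization 2)
    (hN : 2 ^ m.factorization 2 ∣ ∑ k ∈ Finset.range n, t ^ k)
    (hσ' : s'.factorization 2 = m'.factorization 2) : False := by
  have hp := Nat.prime_two
  obtain ⟨hmm, hnn⟩ := M.factorization_eq e hp h2S fun _ _ _ h => h
  have hrr := M.trivExp_eq e hp h2S fun _ _ _ h => h
  have hodd := M.odd_left (by omega)
  have hn0 := M.left.pos_right
  have hs0 := M.left.ne_zero
  have hνD : n.factorization 2 ≤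
      (orderOf (t : ZMod (2 ^ m.factorization 2))).factorization 2 := by
    obtain ⟨u, M', hu⟩ := M.symm.exists_conj_modEq_of_factorization_eq e.symm h2S (by omega) hσ'
    exact M'.symm.factorization_le_orderOf_two e hr hμ hmm hnn hσ hσ' (hmm ▸ hu.symm)
  have hDpos := M.left.orderOf_pos (Nat.ordProj_dvd m 2)
  have h2n : 2 ∣ n := by
    by_contra h
    have h1 := (two_pow_dvd_add_one_of_dvd_geomSum (μ := 1) hodd (h := n)
      (Nat.not_even_iff_odd.1 fun h' => h h'.two_dvd))
    have h2 : ∑ k ∈ Finset.range n, t ^ k ≡ n [MOD 2] :=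
      geomSum_modEq (Nat.odd_iff.1 hodd) n
    exact h (((h2.dvd_iff dvd_rfl).1 ((dvd_pow_self 2 (by omega)).trans hN)))
  obtain ⟨h, rfl⟩ := h2n
  have hh0 : h ≠ 0 := by omega
  have hνh : (2 * h).factorization 2 = 1 + h.factorization 2 := by
    rw [Nat.factorization_mul two_ne_zero hh0, Finsupp.add_apply, hp.factorization_self]
  rcases Nat.even_or_odd h with he | ho
  · have h1 := pow_modEq_one_of_two_pow_dvd_geomSum hodd he (by rwa [mul_comm])
    have h2 := (Nat.factorization_le_iff_dvd hDpos.ne' hh0).2 (orderOf_natCast_dvd_iff.2 h1) 2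
    omega
  · have h1 := two_pow_dvd_add_one_of_dvd_geomSum hodd ho hN
    have hh : h.factorization 2 = 0 :=
      Nat.factorization_eq_zero_of_not_dvd fun h' =>
        Nat.not_even_iff_odd.2 ho (even_iff_two_dvd.2 h')
    obtain ⟨a, b, hab⟩ := M.left.pres
    obtain ⟨a', b', hab'⟩ := M.right.pres
    have h2 := hab.card_inv_eq_self_le_two h1 (by omega) (fun h3 => by
      have := (hp.pow_dvd_iff_le_factorization hs0).1 h3
      omega) (Nat.ordProj_dvd m 2)
    have h3 := hab'.two_lt_card_inv_eq_self
      ((hp.dvd_iff_one_le_factorization M.right.pos_left.ne').2 (by omega))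
      ((hp.dvd_iff_one_le_factorization M.right.pos_right.ne').2 (by omega))
      (hσ' ▸ Nat.ordProj_dvd s' 2)
    have h4 := card_inv_eq_self_eq e
    omega

end MatchedPres

theorem MinPres.exists_hasPres_modEq_two [Finite G] {m n s t t' c : ℕ} (h : MinPres G m n s t)
    (hc : IsActPart c m t) (hσ : s.factorization 2 + 1 = m.factorization 2)
    (hμ : 1 < m.factorization 2) (hn : 2 ∣ n)
    (ho : (orderOf (t : ZMod c)).factorization 2 < n.factorization 2)
    (ht : t ^ (n / 2) ≡ 1 [MOD 2 ^ m.factorization 2]) (ht' : t' ≡ 3 [MOD 4])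
    (htt : t ≡ t' [MOD 2 ^ s.factorization 2]) (hne : ¬ t ≡ t' [MOD 2 ^ m.factorization 2]) :
    ∃ v, HasPres G m n s v ∧ v ≡ t' [MOD 2 ^ m.factorization 2] ∧
      ∀ q a, q.Prime → q ≠ 2 → q ^ a ∣ m → v ≡ t [MOD q ^ a] := by
  have hp := Nat.prime_two
  obtain ⟨M, hM, hM2, hM0⟩ := exists_eq_pow_mul hp h.pos_left
  obtain ⟨w, hw, hw2, -⟩ := exists_eq_pow_mul hp (Nat.pos_of_ne_zero h.ne_zero)
  obtain ⟨n₂, rfl⟩ := hn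
  rw [Nat.mul_div_cancel_left _ two_pos] at ht
  have hMm : M ∣ m := ⟨_, hM.trans (mul_comm _ _)⟩
  have hcop : (2 ^ m.factorization 2).Coprime M :=
    Nat.Coprime.pow_left _ (hp.coprime_iff_not_dvd.2 hM2)
  obtain ⟨v, hv1, hv2⟩ := Nat.chineseRemainder hcop t' t
  have h4 : v % 4 = 3 := (hv1.of_dvd (pow_dvd_pow 2 hμ)).trans ht'
  obtain ⟨l, rfl⟩ : ∃ l, v = 2 * l + 1 := ⟨v / 2, by omega⟩
  have hl : ¬ 2 ∣ l := by omega
  refine ⟨2 * l + 1, ?_, hv1, fun q a hq hq2 ha => hv2.of_dvd ?_⟩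
  swap
  · rw [hM] at ha
    exact pow_dvd_of_dvd_pow_mul hp hq hq2 ha
  have hsplit : ∀ x y, x ≡ y [MOD 2 ^ m.factorization 2] → x ≡ y [MOD M] → x ≡ y [MOD m] := by
    intro x y h1 h2
    rw [hM]
    exact (Nat.modEq_and_modEq_iff_modEq_mul hcop).1 ⟨h1, h2⟩
  have hτ : t ^ (n₂ * M) ≡ 1 [MOD m] := by
    refine hsplit _ _ ?_ ?_
    · rw [pow_mul]
      simpa using ht.pow M
    · rw [← orderOf_natCast_dvd_iff]
      refine (hc.orderOf_dvd hMm).trans (mul_dvd_mul_right ?_ M)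
      have h1 := mul_pow_dvd_of_factorization_le hp (h.orderOf_dvd hc.dvd) h.pos_right
        (e := 1) (by omega)
      rw [pow_one, mul_comm] at h1
      exact Nat.dvd_of_mul_dvd_mul_left two_pos h1
  have h2m : 2 ∣ m := (dvd_pow_self 2 (by omega)).trans (Nat.ordProj_dvd m 2)
  refine h.retwist (ξ := M) rfl ((dvd_pow_self 2 (by omega)).trans (Nat.ordProj_dvd s 2)) h2m
    (dvd_mul_right 2 l) (hτ.of_dvd h2m) ?_
  refine (((geomSum_modEq hτ (2 * l)).add_right _).add_right 1).trans ?_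
  rw [Nat.mul_div_cancel_left _ two_pos, add_right_comm]
  refine hsplit _ _ ?_ ?_
  · obtain ⟨d, hd⟩ := exists_add_mul_modEq htt (pow_dvd_pow 2 (by omega :
      s.factorization 2 ≤ m.factorization 2)) (by positivity)
    have hd2 : ¬ 2 ∣ d := by
      rintro ⟨d, rfl⟩
      refine hne (hd.symm.trans ?_)
      rw [← mul_assoc, ← pow_succ, hσ]
      simp [Nat.ModEq]
    refine Nat.ModEq.trans (hv1.add ?_) hd
    have hsw : s * (M * l) = 2 ^ s.factorization 2 * (w * (M * l)) := by
      rw [← mul_assoc (2 ^ _), ← hw]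
    rw [hsw, ← hσ, pow_succ]
    refine Nat.ModEq.mul_left' _ ?_
    have h5 : ¬ 2 ∣ w * (M * l) := by
      rw [hp.dvd_mul, hp.dvd_mul]
      tauto
    unfold Nat.ModEq
    omega
  · refine (hv2.add_right _).trans ?_
    have : s * (M * l) ≡ 0 [MOD M] :=
      Nat.modEq_zero_iff_dvd.2 ((dvd_mul_right M l).mul_left s)
    simpa using this.add_left t

namespace MatchedPres

variable {m n s t u m' n' s' t' c : ℕ} {S : Set ℕ} {H : Type*} [Group H] [Finite G]

theorem modEq_three (M : MatchedPres G H S c m n s t m' n' s' t')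
    (hr : trivExp m t 2 = 1) (hμ : 1 < m.factorization 2) : t ≡ 3 [MOD 4] := by
  have hodd := Nat.odd_iff.1 (M.odd_left (by omega))
  have h1 : ¬ t ≡ 1 [MOD 2 ^ 2] := fun h => by
    have := (le_trivExp_iff M.left.pos_left M.left.one_lt.le Nat.prime_two).2
      ⟨(pow_dvd_pow 2 hμ).trans (Nat.ordProj_dvd m 2), h⟩
    omega
  unfold Nat.ModEq at *
  omega

variable [Finite H]

theorem exists_insert_two_of_normalized (M : MatchedPres G H S c m n s t m' n' s' t')
    (e : MonoidAlgebra ℚ G ≃ₐ[ℚ] MonoidAlgebra ℚ H) (h2S : 2 ∉ S)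
    (hr : trivExp m t 2 = 1) (hμ : 1 < m.factorization 2)
    (hσ : s.factorization 2 + 1 = m.factorization 2)
    (hσ' : s'.factorization 2 + 1 = m'.factorization 2)
    (hN' : 2 ^ m'.factorization 2 ∣ ∑ k ∈ Finset.range n', t' ^ k) :
    ∃ s u s', MatchedPres G H (Insert.insert 2 S) c m n s u m' n' s' t' := by
  have hp := Nat.prime_two
  obtain ⟨hmm, hnn⟩ := M.factorization_eq e hp h2S fun _ _ _ h => h
  have hrr := M.trivExp_eq e hp h2S fun _ _ _ h => h
  by_cases hle : n.factorization 2 ≤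
      (orderOf (t : ZMod (c * 2 ^ m.factorization 2))).factorization 2
  · obtain ⟨u, M', hu⟩ := M.exists_conj_modEq e hp h2S hrr (by omega) hmm le_rfl (by omega)
    exact ⟨s, u, s', M'.insert (fun _ => hmm) (fun _ => hnn) (fun _ => by omega) fun _ => hu⟩
  push Not at hle
  have hcm := M.mul_dvd hp h2S le_rfl
  have hDpos := M.left.orderOf_pos hcm
  have hD : orderOf (t : ZMod c) ∣ orderOf (t : ZMod (c * 2 ^ m.factorization 2)) :=
    orderOf_natCast_dvd_iff.2 ((orderOf_natCast_dvd_iff.1 dvd_rfl).of_dvd (dvd_mul_right _ _))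
  have hD2 : 2 ∣ orderOf (t : ZMod (c * 2 ^ m.factorization 2)) := by
    by_contra h2
    have h3 := (M.modEq_three hr hμ).pow (orderOf (t : ZMod (c * 2 ^ m.factorization 2)))
    have h4 : t ^ _ ≡ 1 [MOD 4] := (orderOf_natCast_dvd_iff.1 dvd_rfl).of_dvd
      ((pow_dvd_pow 2 hμ).trans (dvd_mul_left _ c))
    obtain ⟨i, hi⟩ := Nat.not_even_iff_odd.1 fun h' => h2 h'.two_dvd
    have h5 := h3.symm.trans h4
    rw [hi, pow_succ, pow_mul] at h5
    have h6 := (((show 3 ^ 2 ≡ 1 [MOD 4] by decide).pow i).mul_right 3).symm.trans h5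
    rw [one_pow] at h6
    exact absurd h6 (by decide)
  have hDc := (Nat.factorization_le_iff_dvd (M.left.orderOf_pos M.actLeft.dvd).ne' hDpos.ne').2 hD 2
  have hD1 := (hp.dvd_iff_one_le_factorization hDpos.ne').1 hD2
  obtain ⟨u, M₃, hu⟩ := M.exists_conj_modEq (x := s.factorization 2) e hp h2S hrr (by omega) hmm
    (by omega) (by gcongr; exact min_le_right _ _)
  have hru : trivExp m u 2 = 1 :=
    (M₃.trivExp_eq e hp h2S fun _ _ _ h => h).trans (hrr.symm.trans hr)
  have hou : (u : ZMod c) = t :=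
    (ZMod.natCast_eq_natCast_iff _ _ _).2 (M₃.modEq_actPart.trans M.modEq_actPart.symm)
  obtain ⟨s₃, M₄, hN⟩ := M₃.exists_normalized hp h2S
  have h1 := M₄.left.le_factorization_add 2
  have h2 := M₄.left.factorization_le (p := 2)
  by_cases hσ₃ : s₃.factorization 2 = m.factorization 2
  · exact (M₄.symm.false_of_factorization_s_ne e.symm h2S (by omega) (by omega) hσ' hN' hσ₃).elim
  have hν : 2 ∣ n := (hp.dvd_iff_one_le_factorization M.left.pos_right.ne').2 (by omega)
  have hs₃ : s₃.factorization 2 = s.factorization 2 := by omega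
  by_cases hut : u ≡ t' [MOD 2 ^ m.factorization 2]
  · exact ⟨s₃, u, s', M₄.insert (fun _ => hmm) (fun _ => hnn) (fun _ => by omega) fun _ => hut⟩
  have hn4 : Even (n / 2) := by
    have h3 := (hp.pow_dvd_iff_le_factorization M.left.pos_right.ne').2 (by omega : 2 ≤ _)
    exact even_iff_two_dvd.2 (by omega)
  have hun := pow_modEq_one_of_two_pow_dvd_geomSum (M₄.odd_left (by omega)) hn4
    (μ := m.factorization 2) (by
      rw [Nat.div_mul_cancel hν]
      exact (pow_dvd_pow 2 (by omega)).trans (hN.resolve_left hσ₃))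
  obtain ⟨v, hv, hvp, hvq⟩ := M₄.left.exists_hasPres_modEq_two M₄.actLeft (by omega) hμ hν
    (by rw [hou]; omega) hun (M₄.symm.modEq_three (by omega) (by omega)) (hs₃ ▸ hu) hut
  refine ⟨s₃, v + 2 * m, s', (M₄.replace_conj hp h2S hv hvq fun hd => ?_).insert (fun _ => hmm)
    (fun _ => hnn) (fun _ => by omega) fun _ => ?_⟩
  · exact (hvp.of_dvd (dvd_pow_self 2 (by omega))).trans
      (Nat.odd_iff.1 (M₄.symm.odd_left (by omega)))
  · exact ((show v + 2 * m ≡ v [MOD m] by simp [Nat.ModEq]).of_dvd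
      (Nat.ordProj_dvd m 2)).trans hvp

theorem exists_insert_two (M : MatchedPres G H S c m n s t m' n' s' t')
    (e : MonoidAlgebra ℚ G ≃ₐ[ℚ] MonoidAlgebra ℚ H) (h2S : 2 ∉ S) :
    ∃ s u s' u', MatchedPres G H (Insert.insert 2 S) c m n s u m' n' s' u' := by
  have hp := Nat.prime_two
  have h2 : ∀ ℓ : ℕ, ℓ.Prime → ℓ ∉ S → ℓ ≠ 2 → ℓ ≠ 2 := fun _ _ _ h => h
  rcases Nat.eq_zero_or_pos (m.factorization 2) with h0 | hμ0
  · exact ⟨s, t, s', t', M.insert_of_factorization_eq_zero e hp h2S h2 h0⟩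
  by_cases hr : 2 ≤ trivExp m t 2 ∨ trivExp m t 2 = m.factorization 2
  · obtain ⟨s₁, u, s₂, M'⟩ := M.exists_insert_of_trivExp e hp h2S h2 (Or.inr hr)
    exact ⟨s₁, u, s₂, t', M'⟩
  have hr1 := M.one_le_trivExp hp h2S hμ0
  have hrμ := trivExp_le (t := t) (p := 2) M.left.pos_left
  obtain ⟨hmm, hnn⟩ := M.factorization_eq e hp h2S h2
  have hrr := M.trivExp_eq e hp h2S h2
  obtain ⟨s₁, M₁, hN₁⟩ := M.exists_normalized hp h2S
  obtain ⟨s₂, M₂, hN₂⟩ := M₁.symm.exists_normalized hp h2S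
  have a1 := M₂.right.le_factorization_add 2
  have a2 := M₂.right.factorization_le (p := 2)
  have a3 := M₂.left.le_factorization_add 2
  have a4 := M₂.left.factorization_le (p := 2)
  have hr : trivExp m t 2 = 1 := by omega
  have hr' : trivExp m' t' 2 = 1 := by omega
  by_cases hσ₁ : s₁.factorization 2 = m.factorization 2 <;>
    by_cases hσ₂ : s₂.factorization 2 = m'.factorization 2
  · obtain ⟨u, M₃, hu⟩ := M₂.symm.exists_conj_modEq_of_factorization_eq e h2S (by omega) hσ₁
    exact ⟨s₁, u, s₂, t', M₃.insert (fun _ => hmm) (fun _ => hnn) (fun _ => by omega) fun _ => hu⟩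
  · exact (M₂.false_of_factorization_s_ne e.symm h2S (by omega) (by omega) (by omega)
      ((pow_dvd_pow 2 (by omega)).trans (hN₂.resolve_left hσ₂)) hσ₁).elim
  · exact (M₂.symm.false_of_factorization_s_ne e h2S (by omega) (by omega) (by omega)
      ((pow_dvd_pow 2 (by omega)).trans (hN₁.resolve_left hσ₁)) hσ₂).elim
  · obtain ⟨s₃, u, s₄, M'⟩ := M₂.symm.exists_insert_two_of_normalized e h2S hr (by omega)
      (by omega) (by omega) ((pow_dvd_pow 2 (by omega)).trans (hN₂.resolve_left hσ₂))
    exact ⟨s₃, u, s₄, t', M'⟩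

end MatchedPres

namespace MatchedPres

variable {m n s t m' n' s' t' c : ℕ} {S : Set ℕ} {H : Type*} [Group H] [Finite G] [Finite H]

theorem exists_superset (M : MatchedPres G H S c m n s t m' n' s' t')
    (e : MonoidAlgebra ℚ G ≃ₐ[ℚ] MonoidAlgebra ℚ H) (h2 : 2 ∈ S) (F : Finset ℕ)
    (hF : ∀ p ∈ F, p.Prime) :
    ∃ s u s' T, 2 ∈ T ∧ (F : Set ℕ) ⊆ T ∧ MatchedPres G H T c m n s u m' n' s' t' := by
  induction F using Finset.induction_on with
  | empty => exact ⟨s, t, s', S, h2, by simp, M⟩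
  | insert p F _ ih =>
    obtain ⟨s₁, u, s₂, T, hT, hFT, M₁⟩ := ih fun q hq => hF q (Finset.mem_insert_of_mem hq)
    by_cases hpT : p ∈ T
    · refine ⟨s₁, u, s₂, T, hT, ?_, M₁⟩
      rw [Finset.coe_insert]
      exact Set.insert_subset hpT hFT
    · have hp2 : p ≠ 2 := fun h => hpT (h ▸ hT)
      obtain ⟨s₃, v, s₄, M₂⟩ := M₁.exists_insert_of_trivExp e
        (hF p (Finset.mem_insert_self p F)) hpT (fun ℓ _ hℓ _ h => hℓ (h ▸ hT)) (Or.inl hp2)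
      refine ⟨s₃, v, s₄, _, Set.mem_insert_of_mem p hT, ?_, M₂⟩
      rw [Finset.coe_insert]
      exact Set.insert_subset_insert hFT

theorem nonempty_mulEquiv (M : MatchedPres G H S c m n s t m' n' s' t')
    (hcard : Nat.card G = Nat.card H) (hS : ∀ p ∈ (Nat.card G).primeFactors, p ∈ S) :
    Nonempty (G ≃* H) := by
  have hmem : ∀ x, x ∣ Nat.card G → ∀ p, p.Prime → p ∣ x → p ∈ S := fun x hx p hp hd =>
    hS p (Nat.mem_primeFactors.2 ⟨hp, hd.trans hx, Nat.card_pos.ne'⟩)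
  have heq : ∀ x y : ℕ, x ∣ Nat.card G → y ∣ Nat.card G →
      (∀ q ∈ S, q.Prime → x.factorization q = y.factorization q) → x = y := by
    intro x y hx hy h
    refine Nat.eq_of_factorization_eq (Nat.pos_of_dvd_of_pos hx Nat.card_pos).ne'
      (Nat.pos_of_dvd_of_pos hy Nat.card_pos).ne' fun p => ?_
    by_cases hp : p.Prime
    · by_cases hpS : p ∈ S
      · exact h p hpS hp
      · rw [Nat.factorization_eq_zero_of_not_dvd fun hd => hpS (hmem x hx p hp hd),
          Nat.factorization_eq_zero_of_not_dvd fun hd => hpS (hmem y hy p hp hd)]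
    · rw [Nat.factorization_eq_zero_of_not_prime _ hp, Nat.factorization_eq_zero_of_not_prime _ hp]
  have hmG : m ∣ Nat.card G := M.left.pres.card ▸ dvd_mul_right m n
  have hmG' : m' ∣ Nat.card G := hcard ▸ M.right.pres.card ▸ dvd_mul_right m' n'
  obtain rfl := heq m m' hmG hmG' M.eq_m
  obtain rfl := heq n n' (M.left.pres.card ▸ dvd_mul_left n m)
    (hcard ▸ M.right.pres.card ▸ dvd_mul_left n' m) M.eq_n
  obtain rfl := heq s s' (M.left.dvd.trans hmG) (M.right.dvd.trans hmG) M.eq_s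
  refine HasPres.nonempty_mulEquiv (M.left.pres.congr_conj ?_) M.right.pres
  refine modEq_of_forall_prime_pow fun ℓ k hℓ hk hk0 => ?_
  exact (M.modEq ℓ (hmem m hmG ℓ hℓ ((dvd_pow_self ℓ hk0.ne').trans hk)) hℓ).of_dvd
    (pow_dvd_pow ℓ ((hℓ.pow_dvd_iff_le_factorization M.left.pos_left.ne').1 hk))

end MatchedPres

/-- **Main Theorem.** Finite metacyclic groups with isomorphic rational group algebras
are isomorphic. -/
theorem isomorphic_of_qalgebra_iso {G H : Type*} [Group G] [Group H] [Finite G] [Finite H]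
    (hG : IsMetacyclic G) (hH : IsMetacyclic H)
    (h : Nonempty (MonoidAlgebra ℚ G ≃ₐ[ℚ] MonoidAlgebra ℚ H)) :
    Nonempty (G ≃* H) := by
  obtain ⟨e⟩ := h
  obtain ⟨m, n, s, t, hG⟩ := exists_minPres_of_isMetacyclic hG
  obtain ⟨m', n', s', t', hH⟩ := exists_minPres_of_isMetacyclic hH
  obtain ⟨c, hc⟩ := exists_isActPart hG.pos_left t
  obtain ⟨u, M⟩ := exists_matchedPres e hG hH hc
  have h2 : ∃ s u s' u' T, 2 ∈ T ∧ MatchedPres G H T c m n s u m' n' s' u' := by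
    by_cases h2 : 2 ∈ {q | q ∣ c}
    · exact ⟨s, u, s', t', _, h2, M⟩
    · obtain ⟨s, u, s', u', M⟩ := M.exists_insert_two e h2
      exact ⟨s, u, s', u', _, Set.mem_insert _ _, M⟩
  obtain ⟨s, u, s', u', T, h2, M⟩ := h2
  obtain ⟨s, v, s', T', -, hT', M⟩ := M.exists_superset e h2 (Nat.card G).primeFactors
    fun p hp => Nat.prime_of_mem_primeFactors hp
  exact M.nonempty_mulEquiv (card_eq_of_algEquiv e) hT'

end ArXiv230800432
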